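/- arXiv:math/0511176 — 2 statements merged into one kernel-verified Lean document; each statement's English description precedes it below -/
import Mathlib

section
/- Let K be a 2-adic field with √−1 ∈ K, and M/K a fully ramified biquadratic extension with two breaks b₁ < b₂ satisfying b₁ + b₂ < 2e_K, contained in a quaternion extension N = M(√α_k). Then def_M(α_k) equals b₂ + 2b₁, or 8e_K − 3b₂ − 2b₁, or satisfies b₂ + 2b₁ < def_M(α_k) < 8e_K − 3b₂ − 2b₁ with def_M(α_k) ≡ −b₂ (mod 8). -/
def DiscreteVal (F : Type*) [Field F] (v : F → WithTop ℤ) : Prop :=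
  v 0 = ⊤ ∧ (∀ x : F, v x = ⊤ → x = 0) ∧ (∀ x y : F, v (x * y) = v x + v y) ∧
    (∀ x y : F, min (v x) (v y) ≤ v (x + y)) ∧ (∃ π : F, v π = 1)

def HasQuadDefect {F : Type*} [Field F] (v : F → WithTop ℤ) (κ : F) (d : WithTop ℤ) : Prop :=
  IsGreatest {n : WithTop ℤ | ∃ k : F, v (k ^ 2 * κ - 1) = n} d

namespace UTB

/-- `v a ≥ n`. -/
def Vge {F : Type*} (v : F → WithTop ℤ) (a : F) (n : ℤ) : Prop := (n : WithTop ℤ) ≤ v a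

/-- `v a = n`. -/
def Veq {F : Type*} (v : F → WithTop ℤ) (a : F) (n : ℤ) : Prop := v a = (n : WithTop ℤ)

section basics
variable {F : Type*} [Field F] {v : F → WithTop ℤ}

theorem Veq.ge {a : F} {n : ℤ} (h : Veq v a n) : Vge v a n := le_of_eq h.symm

theorem Vge.mono {a : F} {m n : ℤ} (h : Vge v a n) (hmn : m ≤ n) : Vge v a m :=
  le_trans (by exact_mod_cast hmn) h

theorem Veq.mono {a : F} {m n : ℤ} (h : Veq v a n) (hmn : m ≤ n) : Vge v a m := h.ge.mono hmn

theorem Veq.congr {a : F} {m n : ℤ} (h : Veq v a n) (hmn : n = m) : Veq v a m := hmn ▸ h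

theorem Veq.unique {a : F} {m n : ℤ} (h : Veq v a m) (h' : Veq v a n) : m = n := by
  unfold Veq at h h'
  rw [h] at h'
  exact_mod_cast h'

theorem Vge.le_of_eq {a : F} {m n : ℤ} (h : Vge v a n) (h' : Veq v a m) : n ≤ m := by
  unfold Vge at h
  rw [h'] at h
  exact_mod_cast h

theorem Vge.eq_or {a : F} {n : ℤ} (h : Vge v a n) : Veq v a n ∨ Vge v a (n + 1) := by
  unfold Vge Veq at *
  rcases eq_or_ne (v a) ⊤ with ht | ht
  · right; rw [ht]; exact le_top
  · lift v a to ℤ using ht with m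
    norm_cast at h ⊢
    omega

variable (hv : DiscreteVal F v)
include hv

theorem vge_zero (n : ℤ) : Vge v (0 : F) n := by
  unfold Vge; rw [hv.1]; exact le_top

theorem Veq.ne_zero {a : F} {n : ℤ} (h : Veq v a n) : a ≠ 0 := by
  rintro rfl
  unfold Veq at h
  rw [hv.1] at h
  exact WithTop.coe_ne_top h.symm

theorem exists_veq {a : F} (ha : a ≠ 0) : ∃ n : ℤ, Veq v a n := by
  have : v a ≠ ⊤ := fun h => ha (hv.2.1 a h)
  obtain ⟨n, hn⟩ := WithTop.ne_top_iff_exists.1 this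
  exact ⟨n, hn.symm⟩

theorem Veq.mul {a b : F} {m n : ℤ} (ha : Veq v a m) (hb : Veq v b n) : Veq v (a * b) (m + n) := by
  unfold Veq at *
  rw [hv.2.2.1, ha, hb]; norm_cast

theorem Vge.mul {a b : F} {m n : ℤ} (ha : Vge v a m) (hb : Vge v b n) : Vge v (a * b) (m + n) := by
  unfold Vge at *
  rw [hv.2.2.1]; push_cast
  exact add_le_add ha hb

theorem Vge.add {a b : F} {n : ℤ} (ha : Vge v a n) (hb : Vge v b n) : Vge v (a + b) n :=
  le_trans (le_min ha hb) (hv.2.2.2.1 a b)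

theorem veq_one : Veq v (1 : F) 0 := by
  obtain ⟨n, hn⟩ := exists_veq hv (one_ne_zero (α := F))
  have h := Veq.mul hv hn hn
  rw [mul_one] at h
  have := h.unique hn
  have : n = 0 := by omega
  exact this ▸ hn

theorem veq_neg_one : Veq v (-1 : F) 0 := by
  obtain ⟨n, hn⟩ := exists_veq hv (neg_ne_zero.2 (one_ne_zero (α := F)))
  have h := Veq.mul hv hn hn
  rw [neg_mul_neg, mul_one] at h
  have := h.unique (veq_one hv)
  have : n = 0 := by omega
  exact this ▸ hn

theorem Veq.neg {a : F} {n : ℤ} (h : Veq v a n) : Veq v (-a) n := by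
  have := Veq.mul hv (veq_neg_one hv) h
  simpa using this

theorem Vge.neg {a : F} {n : ℤ} (h : Vge v a n) : Vge v (-a) n := by
  have := Vge.mul hv (veq_neg_one hv).ge h
  simpa using this

theorem Vge.sub {a b : F} {n : ℤ} (ha : Vge v a n) (hb : Vge v b n) : Vge v (a - b) n := by
  rw [sub_eq_add_neg]; exact Vge.add hv ha (Vge.neg hv hb)

theorem Veq.add {a b : F} {m n : ℤ} (ha : Veq v a m) (hb : Vge v b n) (h : m < n) :
    Veq v (a + b) m := by
  have h1 : Vge v (a + b) m := Vge.add hv ha.ge (hb.mono h.le)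
  rcases h1.eq_or with h2 | h2
  · exact h2
  · have : Vge v (a + b - b) (m + 1) := Vge.sub hv h2 (hb.mono h)
    rw [add_sub_cancel_right] at this
    have := this.le_of_eq ha
    omega

theorem Veq.sub {a b : F} {m n : ℤ} (ha : Veq v a m) (hb : Vge v b n) (h : m < n) :
    Veq v (a - b) m := by
  rw [sub_eq_add_neg]; exact Veq.add hv ha (Vge.neg hv hb) h

/-- If `v b = n` and `v (a - b) > n` then `v a = n`. -/
theorem Veq.of_sub {a b : F} {m n : ℤ} (hb : Veq v b n) (hab : Vge v (a - b) m) (h : n < m) :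
    Veq v a n := by
  have := Veq.add hv hb hab h
  simpa using this

theorem Veq.inv {a : F} {n : ℤ} (h : Veq v a n) : Veq v a⁻¹ (-n) := by
  have ha := Veq.ne_zero hv h
  obtain ⟨m, hm⟩ := exists_veq hv (inv_ne_zero ha)
  have h1 := Veq.mul hv h hm
  rw [mul_inv_cancel₀ ha] at h1
  have := h1.unique (veq_one hv)
  exact hm.congr (by omega)

theorem Veq.div {a b : F} {m n : ℤ} (ha : Veq v a m) (hb : Veq v b n) : Veq v (a / b) (m - n) := by
  rw [div_eq_mul_inv]; exact (Veq.mul hv ha (Veq.inv hv hb)).congr (by ring)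

theorem Vge.div {a b : F} {m n : ℤ} (ha : Vge v a m) (hb : Veq v b n) : Vge v (a / b) (m - n) := by
  rw [div_eq_mul_inv]; exact (Vge.mul hv ha (Veq.inv hv hb).ge).mono (by omega)

theorem Veq.sq {a : F} {n : ℤ} (h : Veq v a n) : Veq v (a ^ 2) (2 * n) := by
  rw [pow_two]; exact (Veq.mul hv h h).congr (by ring)

theorem Vge.sq {a : F} {n : ℤ} (h : Vge v a n) : Vge v (a ^ 2) (2 * n) := by
  rw [pow_two]; exact (Vge.mul hv h h).mono (by omega)

theorem Veq.of_sq {a : F} {n : ℤ} (h : Veq v (a ^ 2) (2 * n)) : Veq v a n := by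
  have ha : a ≠ 0 := by
    rintro rfl
    exact Veq.ne_zero hv h (by simp)
  obtain ⟨m, hm⟩ := exists_veq hv ha
  have := (Veq.sq hv hm).unique h
  exact hm.congr (by omega)

/-- product of units close to one -/
theorem veq_one_add {a : F} {n : ℤ} (h : Vge v a n) (hn : 0 < n) : Veq v (1 + a) 0 :=
  Veq.add hv (veq_one hv) h hn

theorem dvd_two_mul_of_vals {a b : F} {m n : ℤ} (hab : Veq v (a + b) n) (ha : Vge v a m)
    (hb : Vge v b m) : m ≤ n := (Vge.add hv ha hb).le_of_eq hab

/-- `(1+z)^2 = 1+w` with `v w = 2n < 2 v 2` gives `v z = n`. -/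
theorem sqrt_val {z w : F} {n ε : ℤ} (h2 : Veq v (2 : F) ε) (h : (1 + z) ^ 2 = 1 + w)
    (hw : Veq v w (2 * n)) (hn : n < ε) : Veq v z n := by
  have hz : z ≠ 0 := by
    rintro rfl
    have : w = 0 := by linear_combination -h
    exact Veq.ne_zero hv hw this
  obtain ⟨m, hm⟩ := exists_veq hv hz
  have hw' : w = z ^ 2 + 2 * z := by linear_combination -h
  have h1 := Veq.sq hv hm
  have h2' := Veq.mul hv h2 hm
  rw [hw'] at hw
  rcases lt_or_ge m ε with hlt | hge
  · have := (Veq.add hv h1 h2'.ge (by omega)).unique hw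
    exact hm.congr (by omega)
  · have := (Vge.add hv (h1.mono (m := 2 * ε) (by omega)) (h2'.mono (by omega))).le_of_eq hw
    omega

/-- The key maximality fact: an odd value below `2 v 2` is never `v (c^2 - 1)`. -/
theorem not_odd_sq {c : F} {n ε : ℤ} (h2 : Veq v (2 : F) ε) (hw : Veq v (c ^ 2 - 1) n)
    (hn : n < 2 * ε) : n % 2 = 0 := by
  have hz : c - 1 ≠ 0 := by
    intro h
    exact Veq.ne_zero hv hw (by linear_combination (c + 1) * h)
  obtain ⟨m, hm⟩ := exists_veq hv hz
  have hw' : c ^ 2 - 1 = (c - 1) ^ 2 + 2 * (c - 1) := by ring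
  have h1 := Veq.sq hv hm
  have h2' := Veq.mul hv h2 hm
  rw [hw'] at hw
  rcases lt_or_ge m ε with hlt | hge
  · have := (Veq.add hv h1 h2'.ge (by omega)).unique hw
    omega
  · have := (Vge.add hv (h1.mono (m := 2 * ε) (by omega)) (h2'.mono (by omega))).le_of_eq hw
    omega

theorem defect_eq {α C : F} {n ε d : ℤ} (h2 : Veq v (2 : F) ε) (hC : Veq v (C ^ 2 * α - 1) n)
    (hn0 : 0 < n) (hn : n < 2 * ε) (hodd : n % 2 = 1) (hd : HasQuadDefect v α (d : WithTop ℤ)) :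
    d = n := by
  obtain ⟨⟨c, hc⟩, hmax⟩ := hd
  have h1 : n ≤ d := by
    have := hmax ⟨C, hC⟩
    exact_mod_cast this
  by_contra hne
  have hlt : n < d := by omega
  have hc' : Veq v (c ^ 2 * α - 1) d := hc
  have hu : Veq v (C ^ 2 * α) 0 := by
    have := veq_one_add hv hC.ge hn0
    simpa using this
  have hα0 : α ≠ 0 := by
    rintro rfl
    exact Veq.ne_zero hv hu (by simp)
  have hC0 : C ≠ 0 := by
    rintro rfl
    exact Veq.ne_zero hv hu (by simp)
  have h3 : Veq v ((c ^ 2 * α - 1) - (C ^ 2 * α - 1)) n := by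
    have := Veq.neg hv (Veq.sub hv hC hc'.ge hlt)
    simpa using this
  have h4 := Veq.div hv h3 hu
  have h5 : ((c ^ 2 * α - 1) - (C ^ 2 * α - 1)) / (C ^ 2 * α) = (c / C) ^ 2 - 1 := by
    field_simp
    ring
  rw [h5] at h4
  have := not_odd_sq hv h2 h4 (by omega)
  omega

/-- valuations of a product of three principal units -/
theorem mul3 {p q r : F} {n : ℤ} (hn : 0 < n) (hp : Vge v p n) (hq : Vge v q n)
    (hr : Vge v r n)  (h : Veq v (p + q + r) n) : Veq v ((1 + p) * (1 + q) * (1 + r) - 1) n := by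
  have e : (1 + p) * (1 + q) * (1 + r) - 1 = (p + q + r) + (p * q + p * r + q * r + p * q * r) := by
    ring
  rw [e]
  refine Veq.add hv h (n := 2 * n) ?_ (by omega)
  have hpq := (Vge.mul hv hp hq)
  refine Vge.add hv (Vge.add hv (Vge.add hv (hpq.mono (by omega)) ?_) ?_) ?_
  · exact (Vge.mul hv hp hr).mono (by omega)
  · exact (Vge.mul hv hq hr).mono (by omega)
  · exact (Vge.mul hv hpq hr).mono (by omega)

end basics
end UTB
namespace UTB
section lift
variable {M : Type*} [Field M] {v : M → WithTop ℤ}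

/-- `F` is a subfield on which `v` takes values in `hℤ`, and elements of value in `2hℤ` are
squares modulo higher order terms (perfect residue field). -/
structure Good (v : M → WithTop ℤ) (F : Subfield M) (h : ℤ) : Prop where
  hh : h = 2 ∨ h = 4
  dvd : ∀ a ∈ F, ∀ n : ℤ, Veq v a n → h ∣ n
  sq : ∀ a ∈ F, ∀ j : ℤ, Veq v a (2 * h * j) → ∃ c ∈ F, Vge v (a - c ^ 2) (2 * h * j + 1)

variable (hv : DiscreteVal M v)
include hv

theorem Good.sq' {F : Subfield M} {h : ℤ} (G : Good v F h) {a : M} (ha : a ∈ F) {j : ℤ}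
    (hj : Veq v a (2 * h * j)) :
    ∃ c ∈ F, Vge v (a - c ^ 2) (2 * h * j + 1) ∧ Veq v c (h * j) := by
  obtain ⟨c, hc, hac⟩ := G.sq a ha j hj
  refine ⟨c, hc, hac, ?_⟩
  apply Veq.of_sq hv
  have : Vge v (c ^ 2 - a) (2 * h * j + 1) := by
    have := Vge.neg hv hac
    simpa using this
  exact (Veq.of_sub hv hj this (by omega)).congr (by ring)

theorem decomp {F : Subfield M} {h : ℤ} (G : Good v F h) {ε : ℤ} (h2 : Veq v (2 : M) ε)
    {w x : M} (hw : w ∈ F) (hx : x ∈ F) {j l : ℤ} (hwv : Veq v w (h + 2 * h * j))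
    (hxv : Veq v x (h + 2 * h * l)) (n : ℕ) (hn : (n : ℤ) < 2 * ε) :
    ∃ c ∈ F, ∃ d ∈ F, Veq v c (h * (l - j)) ∧ Vge v d (h * (l + 1)) ∧
      Vge v (x - w * c ^ 2 - d ^ 2) (h + 2 * h * l + 1 + n) := by
  have hw0 := Veq.ne_zero hv hwv
  induction n with
  | zero =>
    have hq : Veq v (x / w) (2 * h * (l - j)) := (Veq.div hv hxv hwv).congr (by ring)
    obtain ⟨c, hc, hcx, hcv⟩ := Good.sq' hv G (F.div_mem hx hw) hq
    refine ⟨c, hc, 0, F.zero_mem, hcv, vge_zero hv _, ?_⟩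
    have h3 := Vge.mul hv hwv.ge hcx
    have e : w * (x / w - c ^ 2) = x - w * c ^ 2 - 0 ^ 2 := by field_simp; ring
    rw [e] at h3
    refine h3.mono ?_
    push_cast
    linarith
  | succ n ih =>
    push_cast at hn ⊢
    obtain ⟨c, hc, d, hd, hcv, hdv, hR⟩ := ih (by omega)
    rcases hR.eq_or with hReq | hR'
    swap
    · exact ⟨c, hc, d, hd, hcv, hdv, hR'.mono (by omega)⟩
    have hRF : x - w * c ^ 2 - d ^ 2 ∈ F :=
      F.sub_mem (F.sub_mem hx (F.mul_mem hw (F.pow_mem hc 2))) (F.pow_mem hd 2)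
    obtain ⟨m, hm⟩ := G.dvd _ hRF _ hReq
    rcases Int.even_or_odd' m with ⟨j', rfl | rfl⟩
    · have hlt : l + 1 ≤ j' := by
        rcases G.hh with rfl | rfl <;> omega
      obtain ⟨d1, hd1, hRd, hd1v⟩ := Good.sq' hv G hRF (hReq.congr (m := 2 * h * j') (by linarith))
      refine ⟨c, hc, d + d1, F.add_mem hd hd1, hcv, ?_, ?_⟩
      · refine Vge.add hv hdv (hd1v.mono ?_)
        rcases G.hh with rfl | rfl <;> omega
      · have e : x - w * c ^ 2 - (d + d1) ^ 2 = (x - w * c ^ 2 - d ^ 2 - d1 ^ 2) - 2 * d * d1 := by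
          ring
        rw [e]
        refine Vge.sub hv (hRd.mono ?_)
          ((Vge.mul hv (Vge.mul hv h2.ge hdv) hd1v.ge).mono ?_)
        · rcases G.hh with rfl | rfl <;> omega
        · rcases G.hh with rfl | rfl <;> omega
    · have hlt : l + 1 ≤ j' := by
        rcases G.hh with rfl | rfl <;> omega
      have hq : Veq v ((x - w * c ^ 2 - d ^ 2) / w) (2 * h * (j' - j)) :=
        (Veq.div hv hReq hwv).congr (by rw [hm]; ring)
      obtain ⟨c1, hc1, hRc, hc1v⟩ := Good.sq' hv G (F.div_mem hRF hw) hq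
      refine ⟨c + c1, F.add_mem hc hc1, d, hd, ?_, hdv, ?_⟩
      · refine Veq.add hv hcv hc1v.ge ?_
        rcases G.hh with rfl | rfl <;> omega
      · have e : x - w * (c + c1) ^ 2 - d ^ 2 =
            w * ((x - w * c ^ 2 - d ^ 2) / w - c1 ^ 2) - 2 * w * c * c1 := by
          field_simp; ring
        rw [e]
        refine Vge.sub hv ((Vge.mul hv hwv.ge hRc).mono ?_)
          ((Vge.mul hv (Vge.mul hv (Vge.mul hv h2.ge hwv.ge) hcv.ge) hc1v.ge).mono ?_)
        · rcases G.hh with rfl | rfl <;> omega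
        · rcases G.hh with rfl | rfl <;> omega

theorem decomp' {F : Subfield M} {h : ℤ} (G : Good v F h) {ε : ℤ} (h2 : Veq v (2 : M) ε)
    (hε : 0 < ε)
    {w x : M} (hw : w ∈ F) (hx : x ∈ F) {j l : ℤ} (hwv : Veq v w (h + 2 * h * j))
    (hxv : Veq v x (h + 2 * h * l)) :
    ∃ c ∈ F, ∃ d ∈ F, Veq v c (h * (l - j)) ∧ Vge v d (h * (l + 1)) ∧
      Vge v (x - w * c ^ 2 - d ^ 2) (h + 2 * h * l + 2 * ε) := by
  obtain ⟨c, hc, d, hd, h3, h4, h5⟩ := decomp hv G h2 hw hx hwv hxv (2 * ε - 1).toNat (by omega)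
  exact ⟨c, hc, d, hd, h3, h4, h5.mono (by omega)⟩

/-- Lifting defects through a quadratic extension. -/
theorem quad_lift {F E : Subfield M} (hFE : F ≤ E) {h : ℤ} (G : Good v F h) {ε : ℤ}
    (h2 : Veq v (2 : M) ε)
    {w x z : M} (hw : w ∈ F) (hx : x ∈ F) (hz : z ∈ E) (hzw : (1 + z) ^ 2 = 1 + w)
    {j l W s : ℤ} (hW : 2 * W = h + 2 * h * j) (hs : s = h + 2 * h * l)
    (hwv : Veq v w (2 * W)) (hxv : Veq v x s) (hWε : W < ε) (hW0 : 0 < W) (hs0 : 0 < s) :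
    ∃ C ∈ E, C ≠ 0 ∧ (s < 2 * W → Veq v (C ^ 2 * (1 + x) - 1) (s + ε - W)) ∧
      (2 * W < s → ∀ r, 2 * r = s → Veq v (C ^ 2 * (1 + x) - 1) (ε + r)) := by
  have hzv : Veq v z W := sqrt_val hv h2 hzw hwv hWε
  obtain ⟨c, hc, d, hd, hcv, hdv, hR⟩ := decomp' hv G h2 (by omega) hw hx (hwv.congr hW)
    (hxv.congr hs)
  set R := x - w * c ^ 2 - d ^ 2 with hRdef
  have hzc := Veq.mul hv hzv hcv
  have hu : Veq v (1 + z * c + d) 0 := by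
    rw [add_assoc]
    refine veq_one_add hv (n := 1) (Vge.add hv (hzc.mono ?_) (hdv.mono ?_)) one_pos
    · rcases G.hh with rfl | rfl <;> omega
    · rcases G.hh with rfl | rfl <;> omega
  have hu0 := Veq.ne_zero hv hu
  refine ⟨(1 + z * c + d)⁻¹, E.inv_mem (E.add_mem (E.add_mem E.one_mem (E.mul_mem hz (hFE hc)))
    (hFE hd)), inv_ne_zero hu0, ?_, ?_⟩
  all_goals
    intro hlt
    have e : ((1 + z * c + d)⁻¹) ^ 2 * (1 + x) - 1 =
        (2 * z * c * c - 2 * (z * c) + (R - 2 * d - 2 * (z * c) * d)) / (1 + z * c + d) ^ 2 := by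
      field_simp
      rw [hRdef]
      linear_combination (-c ^ 2) * hzw
    have hA := Veq.mul hv (Veq.mul hv (Veq.mul hv h2 hzv) hcv) hcv
    have hB := Veq.mul hv h2 hzc
    have hD : ∀ n, 2 * n ≤ 2 * ε + s + 2 → Vge v (R - 2 * d - 2 * (z * c) * d) n := by
      intro n hn
      refine Vge.sub hv (Vge.sub hv (hR.mono ?_) ((Vge.mul hv h2.ge hdv).mono ?_))
        ((Vge.mul hv hB.ge hdv).mono ?_)
      · rcases G.hh with rfl | rfl <;> omega
      · rcases G.hh with rfl | rfl <;> omega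
      · rcases G.hh with rfl | rfl <;> omega
    rw [e]
  · refine (Veq.div hv (m := s + ε - W) ?_ (Veq.sq hv hu)).congr (by ring)
    refine Veq.add hv (n := s + ε - W + 1) (Veq.sub hv (hA.congr ?_) hB.ge ?_) (hD _ ?_) (by omega)
    · rcases G.hh with rfl | rfl <;> omega
    · rcases G.hh with rfl | rfl <;> omega
    · rcases G.hh with rfl | rfl <;> omega
  · intro r hr
    refine (Veq.div hv (m := ε + r) ?_ (Veq.sq hv hu)).congr (by ring)
    refine Veq.add hv (n := ε + r + 1) ?_ (hD _ ?_) (by omega)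
    · rw [← neg_sub]
      refine Veq.neg hv (Veq.sub hv (hB.congr ?_) hA.ge ?_)
      · rcases G.hh with rfl | rfl <;> omega
      · rcases G.hh with rfl | rfl <;> omega
    · rcases G.hh with rfl | rfl <;> omega

/-- Lifting defects: the case of an element of odd valuation. -/
theorem quad_lift0 {F E : Subfield M} (hFE : F ≤ E) {h : ℤ} (G : Good v F h) {ε : ℤ}
    (h2 : Veq v (2 : M) ε)
    {w x z : M} (hw : w ∈ F) (hx : x ∈ F) (hz : z ∈ E) (hzw : (1 + z) ^ 2 = 1 + w)
    {j l W s : ℤ} (hW : 2 * W = h + 2 * h * j) (hs : s = h + 2 * h * l)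
    (hwv : Veq v w (2 * W)) (hxv : Veq v x s) (hWε : W < ε) (hW0 : 0 < W) :
    ∃ C ∈ E, C ≠ 0 ∧ Veq v (C ^ 2 * x - 1) (ε - W) := by
  have hzv : Veq v z W := sqrt_val hv h2 hzw hwv hWε
  obtain ⟨c, hc, d, hd, hcv, hdv, hR⟩ := decomp' hv G h2 (by omega) hw hx (hwv.congr hW)
    (hxv.congr hs)
  set R := x - w * c ^ 2 - d ^ 2 with hRdef
  have hzc := Veq.mul hv hzv hcv
  have hu : Veq v (z * c + d) (W + h * (l - j)) := by
    refine Veq.add hv hzc hdv ?_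
    rcases G.hh with rfl | rfl <;> omega
  have hu0 := Veq.ne_zero hv hu
  refine ⟨(z * c + d)⁻¹, E.inv_mem (E.add_mem (E.mul_mem hz (hFE hc))
    (hFE hd)), inv_ne_zero hu0, ?_⟩
  have e : ((z * c + d)⁻¹) ^ 2 * x - 1 =
      (2 * z * c * c + (R - 2 * (z * c) * d)) / (z * c + d) ^ 2 := by
    field_simp
    rw [hRdef]
    linear_combination (-c ^ 2) * hzw
  have hA := Veq.mul hv (Veq.mul hv (Veq.mul hv h2 hzv) hcv) hcv
  have hB := Veq.mul hv h2 hzc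
  rw [e]
  refine (Veq.div hv (Veq.add hv hA (Vge.sub hv (n := s + ε - W + 1) (hR.mono ?_)
    ((Vge.mul hv hB.ge hdv).mono ?_)) ?_) (Veq.sq hv hu)).congr ?_
  all_goals rcases G.hh with rfl | rfl <;> omega

/-- Improving a principal unit by squares. -/
theorem improve {F : Subfield M} {h : ℤ} (G : Good v F h) {ε : ℤ} (h2 : Veq v (2 : M) ε)
    {T : ℤ} (hT : T ≤ 2 * ε) (n : ℕ) : ∀ (x : M) (_ : x ∈ F) (m : ℤ) (_ : 0 < m)
    (_ : T ≤ m + n) (_ : Vge v x m),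
    ∃ C ∈ F, C ≠ 0 ∧ (Vge v (C ^ 2 * (1 + x) - 1) T ∨
      ∃ l : ℤ, m ≤ h + 2 * h * l ∧ h + 2 * h * l < T ∧
        Veq v (C ^ 2 * (1 + x) - 1) (h + 2 * h * l)) := by
  induction n with
  | zero =>
    intro x hx m hm hTm hxm
    refine ⟨1, F.one_mem, one_ne_zero, Or.inl ?_⟩
    have : (1 : M) ^ 2 * (1 + x) - 1 = x := by ring
    rw [this]
    exact hxm.mono (by push_cast at hTm; omega)
  | succ n ih =>
    intro x hx m hm hTm hxm
    push_cast at hTm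
    have e1 : (1 : M) ^ 2 * (1 + x) - 1 = x := by ring
    rcases lt_or_ge m T with hlt | hge
    swap
    · refine ⟨1, F.one_mem, one_ne_zero, Or.inl ?_⟩
      rw [e1]
      exact hxm.mono hge
    rcases hxm.eq_or with heq | hgt
    swap
    · obtain ⟨C, hC, hC0, h3⟩ := ih x hx (m + 1) (by omega) (by omega) hgt
      refine ⟨C, hC, hC0, ?_⟩
      rcases h3 with h3 | ⟨l, h4, h5, h6⟩
      · exact Or.inl h3
      · exact Or.inr ⟨l, by omega, h5, h6⟩
    obtain ⟨t, ht⟩ := G.dvd _ hx _ heq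
    rcases Int.even_or_odd' t with ⟨j, rfl | rfl⟩
    swap
    · refine ⟨1, F.one_mem, one_ne_zero, Or.inr ⟨j, ?_, ?_, ?_⟩⟩
      · linarith
      · linarith
      · rw [e1]; exact heq.congr (by linarith)
    obtain ⟨c, hc, hxc, hcv⟩ := Good.sq' hv G hx (heq.congr (m := 2 * h * j) (by linarith))
    have hj0 : 0 < h * j := by linarith
    have hu : Veq v (1 + c) 0 := veq_one_add hv hcv.ge hj0
    have hu0 := Veq.ne_zero hv hu
    set x' := (x - c ^ 2 - 2 * c) / (1 + c) ^ 2 with hx'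
    have hx'F : x' ∈ F := by
      refine F.div_mem (F.sub_mem (F.sub_mem hx (F.pow_mem hc 2)) (F.mul_mem ?_ hc))
        (F.pow_mem (F.add_mem F.one_mem hc) 2)
      exact ofNat_mem F 2
    have hx'v : Vge v x' (m + 1) := by
      refine (Vge.div hv (Vge.sub hv (n := m + 1) (hxc.mono ?_)
        ((Vge.mul hv h2.ge hcv.ge).mono ?_)) (Veq.sq hv hu)).mono (by omega)
      · linarith
      · linarith
    obtain ⟨C, hC, hC0, h3⟩ := ih x' hx'F (m + 1) (by omega) (by omega) hx'v
    refine ⟨C / (1 + c), F.div_mem hC (F.add_mem F.one_mem hc), div_ne_zero hC0 hu0, ?_⟩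
    have e : (C / (1 + c)) ^ 2 * (1 + x) - 1 = C ^ 2 * (1 + x') - 1 := by
      rw [hx']; field_simp; ring
    rw [e]
    rcases h3 with h3 | ⟨l, h4, h5, h6⟩
    · exact Or.inl h3
    · exact Or.inr ⟨l, by omega, h5, h6⟩

theorem improve' {F : Subfield M} {h : ℤ} (G : Good v F h) {ε : ℤ} (h2 : Veq v (2 : M) ε)
    {T : ℤ} (hT : T ≤ 2 * ε) {x : M} (hx : x ∈ F) {m : ℤ} (hm : 0 < m) (hxm : Vge v x m) :
    ∃ C ∈ F, C ≠ 0 ∧ (Vge v (C ^ 2 * (1 + x) - 1) T ∨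
      ∃ l : ℤ, m ≤ h + 2 * h * l ∧ h + 2 * h * l < T ∧
        Veq v (C ^ 2 * (1 + x) - 1) (h + 2 * h * l)) :=
  improve hv G h2 hT (T - m).toNat x hx m hm (by omega) hxm

/-- Trichotomy for square classes. -/
theorem classify {F : Subfield M} {h : ℤ} (G : Good v F h) {ε : ℤ} (h2 : Veq v (2 : M) ε)
    {T : ℤ} (hT : T ≤ 2 * ε) {k : M} (hk : k ∈ F) (hk0 : k ≠ 0) :
    (∃ l, Veq v k (h + 2 * h * l)) ∨ ∃ C ∈ F, C ≠ 0 ∧ (Vge v (C ^ 2 * k - 1) T ∨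
      ∃ l : ℤ, 0 < h + 2 * h * l ∧ h + 2 * h * l < T ∧
        Veq v (C ^ 2 * k - 1) (h + 2 * h * l)) := by
  obtain ⟨n, hn⟩ := exists_veq hv hk0
  obtain ⟨t, ht⟩ := G.dvd _ hk _ hn
  rcases Int.even_or_odd' t with ⟨j, rfl | rfl⟩
  swap
  · exact Or.inl ⟨j, hn.congr (by linarith)⟩
  right
  obtain ⟨c, hc, hkc, hcv⟩ := Good.sq' hv G hk (hn.congr (m := 2 * h * j) (by linarith))
  have hc0 := Veq.ne_zero hv hcv
  have hx : Vge v ((k - c ^ 2) / c ^ 2) 1 :=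
    (Vge.div hv hkc (Veq.sq hv hcv)).mono (by linarith)
  obtain ⟨C, hC, hC0, h3⟩ := improve' hv G h2 hT
    (F.div_mem (F.sub_mem hk (F.pow_mem hc 2)) (F.pow_mem hc 2)) one_pos hx
  refine ⟨C / c, F.div_mem hC hc, div_ne_zero hC0 hc0, ?_⟩
  have e : (C / c) ^ 2 * k - 1 = C ^ 2 * (1 + (k - c ^ 2) / c ^ 2) - 1 := by
    field_simp; ring
  rw [e]
  rcases h3 with h3 | ⟨l, h4, h5, h6⟩
  · exact Or.inl h3
  · exact Or.inr ⟨l, by omega, h5, h6⟩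

end lift
end UTB
namespace UTB
section core
variable {M : Type*} [Field M] {v : M → WithTop ℤ}

/-- The conclusion of the theorem. -/
def Concl (e b₁ b₂ d : ℤ) : Prop :=
  d = b₂ + 2 * b₁ ∨ d = 8 * e - 3 * b₂ - 2 * b₁ ∨
        (b₂ + 2 * b₁ < d ∧ d < 8 * e - 3 * b₂ - 2 * b₁ ∧ Int.ModEq 8 d (-b₂))

variable (hv : DiscreteVal M v)
include hv

theorem k0_identity {i z w : M} (h2 : (2 : M) ≠ 0) (hi : i ^ 2 = -1) (hzw : (1 + z) ^ 2 = 1 + w) :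
    (1 + i * w / 2) * (1 + z) = (1 + (1 + i) * z / 2) ^ 2 + i * w * z / 2 := by
  have hw : w = z ^ 2 + 2 * z := by linear_combination -hzw
  subst hw
  field_simp
  linear_combination (-z ^ 2) * hi

theorem core {K' L E : Subfield M} (GdK : Good v K' 4) (GdL : Good v L 2) (GdE : Good v E 2)
    (hKL : K' ≤ L) (hKE : K' ≤ E) {e b₁ b₂ : ℤ} (h2 : Veq v (2 : M) (4 * e))
    {i : M} (hiK : i ∈ K') (hi : i ^ 2 = -1) (hb0 : 0 < b₁) (hb : b₁ < b₂)
    (hbe : b₁ + b₂ < 2 * e) (hb1 : b₁ % 2 = 1) (hbs : (b₁ + b₂) % 4 = 2)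
    {z₁ w₁ z₂ w₂ δ k : M} (hz₁ : (1 + z₁) ^ 2 = 1 + w₁) (hz₂ : (1 + z₂) ^ 2 = 1 + w₂)
    (hw₁ : w₁ ∈ K') (hw₂ : w₂ ∈ K') (hz₁L : z₁ ∈ L) (hz₂E : z₂ ∈ E)
    (hw₁v : Veq v w₁ (8 * e - 4 * b₁)) (hw₂v : Veq v w₂ (8 * e - 2 * b₁ - 2 * b₂))
    (hδ : δ ∈ L) (hδv : Vge v δ (8 * e - 2 * b₂ - 4 * b₁)) (hk : k ∈ K') (hk0 : k ≠ 0) :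
    ∃ C : M, ∃ n : ℤ, Veq v (C ^ 2 * (k * (1 + z₂) * (1 + δ)) - 1) n ∧ 0 < n ∧ n < 8 * e ∧
      n % 2 = 1 ∧ Concl e b₁ b₂ n := by
  have hLT : L ≤ ⊤ := le_top
  have hET : E ≤ ⊤ := le_top
  have h20 : (2 : M) ≠ 0 := Veq.ne_zero hv h2
  obtain ⟨j₁, hj₁⟩ : ∃ j, 2 * (4 * e - 2 * b₁) = 4 + 2 * 4 * j :=
    ⟨(8 * e - 4 * b₁ - 4) / 8, by omega⟩
  obtain ⟨j₂, hj₂⟩ : ∃ j, 2 * (4 * e - b₁ - b₂) = 4 + 2 * 4 * j :=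
    ⟨(8 * e - 2 * b₁ - 2 * b₂ - 4) / 8, by omega⟩
  -- generator of M over L
  obtain ⟨CL, hCL, hCL0, hCLv, -⟩ := quad_lift hv hKL GdK h2 hw₁ hw₂ hz₁L hz₁ hj₁ hj₂
    (hw₁v.congr (by omega)) (hw₂v.congr (by omega)) (by omega) (by omega) (by omega)
  replace hCLv := (hCLv (by omega)).congr (m := 2 * (4 * e - b₂)) (by omega)
  have hwL : CL ^ 2 * (1 + w₂) - 1 ∈ L :=
    L.sub_mem (L.mul_mem (L.pow_mem hCL 2) (L.add_mem L.one_mem (hKL hw₂))) L.one_mem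
  have hzL : (1 + (CL * (1 + z₂) - 1)) ^ 2 = 1 + (CL ^ 2 * (1 + w₂) - 1) := by
    linear_combination CL ^ 2 * hz₂
  -- generator of M over E
  obtain ⟨CE, hCE, hCE0, -, hCEv⟩ := quad_lift hv hKE GdK h2 hw₂ hw₁ hz₂E hz₂ hj₂ hj₁
    (hw₂v.congr (by omega)) (hw₁v.congr (by omega)) (by omega) (by omega) (by omega)
  replace hCEv := (hCEv (by omega) (4 * e - 2 * b₁) rfl).congr (m := 2 * (4 * e - b₁)) (by omega)
  have hwE : CE ^ 2 * (1 + w₁) - 1 ∈ E :=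
    E.sub_mem (E.mul_mem (E.pow_mem hCE 2) (E.add_mem E.one_mem (hKE hw₁))) E.one_mem
  have hzE : (1 + (CE * (1 + z₁) - 1)) ^ 2 = 1 + (CE ^ 2 * (1 + w₁) - 1) := by
    linear_combination CE ^ 2 * hz₁
  -- lifting from L to M
  have liftL : ∀ x ∈ L, ∀ l : ℤ, 0 < 2 + 2 * 2 * l → 2 + 2 * 2 * l < 8 * e - 2 * b₂ →
      Veq v x (2 + 2 * 2 * l) →
      ∃ C : M, C ≠ 0 ∧ Veq v (C ^ 2 * (1 + x) - 1) (2 + 2 * 2 * l + b₂) := by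
    intro x hx l hl0 hl hxv
    obtain ⟨j, hj⟩ : ∃ j, 2 * (4 * e - b₂) = 2 + 2 * 2 * j :=
      ⟨(8 * e - 2 * b₂ - 2) / 4, by omega⟩
    obtain ⟨C, -, hC0, hC, -⟩ := quad_lift hv hLT GdL h2 hwL hx (Subfield.mem_top _) hzL hj rfl
      hCLv hxv (by omega) (by omega) (by omega)
    exact ⟨C, hC0, (hC (by omega)).congr (by omega)⟩
  -- the element k₀ (1 + z₂)
  have hz₂v : Veq v z₂ (4 * e - b₁ - b₂) :=
    sqrt_val hv h2 hz₂ (hw₂v.congr (by omega)) (by omega)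
  have hiv : Veq v i 0 := by
    apply Veq.of_sq hv
    rw [hi]
    exact veq_neg_one hv
  have h1i : Veq v (1 + i) (2 * e) := by
    apply Veq.of_sq hv
    have : (1 + i) ^ 2 = 2 * i := by linear_combination hi
    rw [this]
    exact (Veq.mul hv h2 hiv).congr (by ring)
  set k₀ := 1 + i * w₂ / 2 with hk₀
  have hk₀K : k₀ ∈ K' := K'.add_mem K'.one_mem (K'.div_mem (K'.mul_mem hiK hw₂) (ofNat_mem K' 2))
  have hk₀v : Veq v k₀ 0 :=
    veq_one_add hv (Veq.div hv (Veq.mul hv hiv hw₂v) h2).ge (by omega)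
  have hk₀0 := Veq.ne_zero hv hk₀v
  set t := 1 + (1 + i) * z₂ / 2 with ht
  have htv : Veq v t 0 :=
    veq_one_add hv (Veq.div hv (Veq.mul hv h1i hz₂v) h2).ge (by omega)
  have ht0 := Veq.ne_zero hv htv
  have htE : t ∈ E := E.add_mem E.one_mem (E.div_mem (E.mul_mem (E.add_mem E.one_mem (hKE hiK))
    hz₂E) (ofNat_mem E 2))
  set x₀ := i * w₂ * z₂ / 2 / t ^ 2 with hx₀
  have hx₀E : x₀ ∈ E := E.div_mem (E.div_mem (E.mul_mem (E.mul_mem (hKE hiK) (hKE hw₂)) hz₂E)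
    (ofNat_mem E 2)) (E.pow_mem htE 2)
  have hx₀v : Veq v x₀ (8 * e - 3 * b₁ - 3 * b₂) :=
    (Veq.div hv (Veq.div hv (Veq.mul hv (Veq.mul hv hiv hw₂v) hz₂v) h2) (Veq.sq hv htv)).congr
      (by ring)
  have hk₀z : k₀ * (1 + z₂) = t ^ 2 * (1 + x₀) := by
    rw [hk₀, k0_identity hv h20 hi hz₂, ← ht, hx₀, mul_add, mul_one,
      mul_div_cancel₀ _ (pow_ne_zero 2 ht0)]
  obtain ⟨l₀, hl₀⟩ : ∃ l, 8 * e - 3 * b₁ - 3 * b₂ = 2 + 2 * 2 * l :=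
    ⟨(8 * e - 3 * b₁ - 3 * b₂ - 2) / 4, by omega⟩
  obtain ⟨jE, hjE⟩ : ∃ j, 2 * (4 * e - b₁) = 2 + 2 * 2 * j := ⟨(8 * e - 2 * b₁ - 2) / 4, by omega⟩
  obtain ⟨C₀, -, hC₀0, hC₀v, -⟩ := quad_lift hv hET GdE h2 hwE hx₀E (Subfield.mem_top _) hzE hjE hl₀
      hCEv hx₀v (by omega) (by omega) (by omega)
  replace hC₀v := (hC₀v (by omega)).congr (m := 8 * e - 3 * b₂ - 2 * b₁) (by omega)
  -- the element 1 + δ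
  obtain ⟨C₁, hC₁0, hC₁v⟩ : ∃ C : M, C ≠ 0 ∧
      Vge v (C ^ 2 * (1 + δ) - 1) (8 * e - 3 * b₂ - 2 * b₁ + 1) := by
    obtain ⟨C, hC, hC0, h3⟩ := improve' hv GdL h2 (T := 8 * e - 2 * b₂) (by omega) hδ
      (by omega) hδv
    rcases h3 with h3 | ⟨l, h4, h5, h6⟩
    · exact ⟨C, hC0, h3.mono (by omega)⟩
    · obtain ⟨C', hC'0, h7⟩ := liftL _ (L.sub_mem (L.mul_mem (L.pow_mem hC 2)
        (L.add_mem L.one_mem hδ)) L.one_mem) l (by omega) h5 h6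
      refine ⟨C' * C, mul_ne_zero hC'0 hC0, ?_⟩
      have e1 : (C' * C) ^ 2 * (1 + δ) - 1 = C' ^ 2 * (1 + (C ^ 2 * (1 + δ) - 1)) - 1 := by ring
      rw [e1]
      exact h7.mono (by omega)
  -- the element k / k₀
  have hkk : k / k₀ ∈ K' := K'.div_mem hk hk₀K
  have hkk0 : k / k₀ ≠ 0 := div_ne_zero hk0 hk₀0
  have hC₂ : ∃ C : M, C ≠ 0 ∧ (Vge v (C ^ 2 * (k / k₀) - 1) (8 * e - 3 * b₂ - 2 * b₁ + 1) ∨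
      ∃ n : ℤ, Veq v (C ^ 2 * (k / k₀) - 1) n ∧ (n = b₂ + 2 * b₁ ∨ 
        (b₂ + 2 * b₁ < n ∧ (n + b₂) % 8 = 0))) := by
    rcases classify hv GdK h2 (T := 8 * e - 2 * b₁ - 2 * b₂) (by omega) hkk hkk0 with
      ⟨l, hl⟩ | ⟨C, hC, hC0, h3 | ⟨l, h4, h5, h6⟩⟩
    · obtain ⟨C, hC, hC0, h3⟩ := quad_lift0 hv hKL GdK h2 hw₁ hkk hz₁L hz₁ hj₁ rfl
        (hw₁v.congr (by omega)) hl (by omega) (by omega)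
      obtain ⟨l', hl'⟩ : ∃ l, 2 * b₁ = 2 + 2 * 2 * l := ⟨(2 * b₁ - 2) / 4, by omega⟩
      obtain ⟨C', hC'0, h7⟩ := liftL _ (L.sub_mem (L.mul_mem (L.pow_mem hC 2)
        (hKL hkk)) L.one_mem) l' (by omega) (by omega) (h3.congr (by omega))
      refine ⟨C' * C, mul_ne_zero hC'0 hC0, Or.inr ⟨b₂ + 2 * b₁, ?_, Or.inl rfl⟩⟩
      have e1 : (C' * C) ^ 2 * (k / k₀) - 1 = C' ^ 2 * (1 + (C ^ 2 * (k / k₀) - 1)) - 1 := by ring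
      rw [e1]
      exact h7.congr (by omega)
    · exact ⟨C, hC0, Or.inl (h3.mono (by omega))⟩
    · have hx' : C ^ 2 * (k / k₀) - 1 ∈ K' :=
        K'.sub_mem (K'.mul_mem (K'.pow_mem hC 2) hkk) K'.one_mem
      obtain ⟨C₃, hC₃, hC₃0, h8, -⟩ := quad_lift hv hKL GdK h2 hw₁ hx' hz₁L hz₁ hj₁ rfl
        (hw₁v.congr (by omega)) h6 (by omega) (by omega) h4
      replace h8 := h8 (by omega)
      obtain ⟨l', hl'⟩ : ∃ l', 4 + 2 * 4 * l + 2 * b₁ = 2 + 2 * 2 * l' :=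
        ⟨(4 + 2 * 4 * l + 2 * b₁ - 2) / 4, by omega⟩
      obtain ⟨C', hC'0, h7⟩ := liftL _ (L.sub_mem (L.mul_mem (L.pow_mem hC₃ 2)
        (L.add_mem L.one_mem (hKL hx'))) L.one_mem) l' (by omega) (by omega) (h8.congr (by omega))
      refine ⟨C' * C₃ * C, mul_ne_zero (mul_ne_zero hC'0 hC₃0) hC0,
        Or.inr ⟨4 + 2 * 4 * l + 2 * b₁ + b₂, ?_, Or.inr ⟨by omega, by omega⟩⟩⟩
      have e1 : (C' * C₃ * C) ^ 2 * (k / k₀) - 1 =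
        C' ^ 2 * (1 + (C₃ ^ 2 * (1 + (C ^ 2 * (k / k₀) - 1)) - 1)) - 1 := by ring
      rw [e1]
      exact h7.congr (by omega)
  obtain ⟨C₂, hC₂0, h9⟩ := hC₂
  have etot : (C₂ * (C₀ / t) * C₁) ^ 2 * (k * (1 + z₂) * (1 + δ)) - 1 =
      (1 + (C₂ ^ 2 * (k / k₀) - 1)) * (1 + (C₀ ^ 2 * (1 + x₀) - 1)) *
        (1 + (C₁ ^ 2 * (1 + δ) - 1)) - 1 := by
    have e2 : 1 + z₂ = t ^ 2 * (1 + x₀) / k₀ := by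
      rw [← hk₀z]; field_simp
    rw [e2]
    field_simp
    ring
  refine ⟨C₂ * (C₀ / t) * C₁, ?_⟩
  rw [etot]
  set p := C₂ ^ 2 * (k / k₀) - 1 with hp
  set q := C₀ ^ 2 * (1 + x₀) - 1 with hq
  set r := C₁ ^ 2 * (1 + δ) - 1 with hr
  have hD : ∀ (_ : Vge v p (8 * e - 3 * b₂ - 2 * b₁ + 1)), ∃ n : ℤ,
      Veq v ((1 + p) * (1 + q) * (1 + r) - 1) n ∧ 0 < n ∧ n < 8 * e ∧
      n % 2 = 1 ∧ Concl e b₁ b₂ n := by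
    intro h
    refine ⟨8 * e - 3 * b₂ - 2 * b₁, ?_, by omega, by omega, by omega, Or.inr (Or.inl rfl)⟩
    refine mul3 hv (by omega) (h.mono (by omega)) hC₀v.ge (hC₁v.mono (by omega)) ?_
    have := Veq.add hv hC₀v (Vge.add hv h hC₁v) (by omega)
    have e3 : p + q + r = q + (p + r) := by ring
    rw [e3]; exact this
  rcases h9 with h9 | ⟨n, hn, hn'⟩
  · exact hD h9
  · rcases lt_or_ge (8 * e - 3 * b₂ - 2 * b₁) n with hlt | hge
    · exact hD (hn.mono (by omega))
    · have hnlt : n < 8 * e - 3 * b₂ - 2 * b₁ := by omega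
      refine ⟨n, ?_, by omega, by omega, by omega, ?_⟩
      · refine mul3 hv (by omega) hn.ge (hC₀v.mono (by omega)) (hC₁v.mono (by omega)) ?_
        rw [add_assoc]
        exact Veq.add hv hn (n := n + 1) (Vge.add hv (hC₀v.mono (by omega))
          (hC₁v.mono (by omega))) (by omega)
      · rcases hn' with hn' | ⟨h10, h11⟩
        · exact Or.inl hn'
        · refine Or.inr (Or.inr ⟨h10, hnlt, ?_⟩)
          unfold Int.ModEq
          omega

end core
end UTB
namespace UTB
section ram
variable {M : Type*} [Field M] {v : M → WithTop ℤ}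

/-- Ramification data of a biquadratic extension `M / K'` with group generated by `σ, τ`. -/
structure Ram (v : M → WithTop ℤ) (K' : Subfield M) (σ τ : M ≃+* M) (π : M) (s t e : ℤ) :
    Prop where
  ss : ∀ a, σ (σ a) = a
  tt : ∀ a, τ (τ a) = a
  comm : ∀ a, σ (τ a) = τ (σ a)
  vs : ∀ a, v (σ a) = v a
  vt : ∀ a, v (τ a) = v a
  mem : ∀ a, a ∈ K' ↔ σ a = a ∧ τ a = a
  good : Good v K' 4
  pi : Veq v π 1
  bs : Veq v (σ π - π) (s + 1)
  bt : Veq v (τ π - π) (t + 1)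
  two : Veq v (2 : M) (4 * e)
  epos : 0 < e

theorem Ram.symm {K' : Subfield M} {σ τ : M ≃+* M} {π : M} {s t e : ℤ}
    (R : Ram v K' σ τ π s t e) : Ram v K' τ σ π t s e where
  ss := R.tt
  tt := R.ss
  comm a := (R.comm a).symm
  vs := R.vt
  vt := R.vs
  mem a := by rw [R.mem a, and_comm]
  good := R.good
  pi := R.pi
  bs := R.bt
  bt := R.bs
  two := R.two
  epos := R.epos

/-- Fixed subfield. -/
def fix (σ : M ≃+* M) : Subfield M := RingHom.eqLocusField (σ : M →+* M) (RingHom.id M)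

theorem mem_fix {σ : M ≃+* M} {a : M} : a ∈ fix σ ↔ σ a = a := Iff.rfl

variable (hv : DiscreteVal M v)
include hv

theorem split_val {a b : M} {n : ℤ} (h : Veq v (a + b) n) (hab : ∀ m, Veq v a m → ¬ Veq v b m) :
    (Veq v a n ∧ Vge v b (n + 1)) ∨ (Veq v b n ∧ Vge v a (n + 1)) := by
  rcases eq_or_ne a 0 with rfl | ha
  · right; rw [zero_add] at h; exact ⟨h, vge_zero hv _⟩
  rcases eq_or_ne b 0 with rfl | hb
  · left; rw [add_zero] at h; exact ⟨h, vge_zero hv _⟩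
  obtain ⟨m, hm⟩ := exists_veq hv ha
  obtain ⟨l, hl⟩ := exists_veq hv hb
  rcases lt_trichotomy m l with hlt | rfl | hlt
  · have := (Veq.add hv hm hl.ge hlt).unique h
    subst this
    exact Or.inl ⟨hm, hl.mono hlt⟩
  · exact absurd hl (hab _ hm)
  · have := Veq.add hv hl hm.ge hlt
    rw [add_comm] at this
    have := this.unique h
    subst this
    exact Or.inr ⟨hl, hm.mono hlt⟩

variable {K' : Subfield M} {σ τ : M ≃+* M} {π : M} {s t e : ℤ} (R : Ram v K' σ τ π s t e)
include R

theorem Ram.vqs {a : M} {n : ℤ} (h : Veq v a n) : Veq v (σ a) n := by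
  unfold Veq; rw [R.vs]; exact h

theorem Ram.vqt {a : M} {n : ℤ} (h : Veq v a n) : Veq v (τ a) n := by
  unfold Veq; rw [R.vt]; exact h

theorem Ram.lamv : Veq v (π * σ π) 2 := Veq.mul hv R.pi (R.vqs hv R.pi)

theorem Ram.lams : σ (π * σ π) = π * σ π := by rw [map_mul, R.ss, mul_comm]

theorem Ram.lamt : τ (π * σ π) - π * σ π ≠ 0 := by
  intro h
  have h1 : π * σ π ∈ K' := (R.mem _).2 ⟨R.lams hv, sub_eq_zero.1 h⟩
  have := R.good.dvd _ h1 _ (R.lamv hv)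
  omega

theorem Ram.le_fix : K' ≤ fix σ := fun a ha => mem_fix.2 ((R.mem a).1 ha).1

theorem Ram.decompE {p : M} (hp : σ p = p) : ∃ p0 ∈ K', ∃ q ∈ K', p = p0 + q * (π * σ π) ∧
    τ p - p = q * (τ (π * σ π) - π * σ π) := by
  have h0 := R.lamt hv
  have hq : (τ p - p) / (τ (π * σ π) - π * σ π) ∈ K' := by
    rw [R.mem]
    constructor
    · rw [map_div₀, map_sub, map_sub, R.comm p, R.comm, R.lams hv, hp]
    · rw [map_div₀, map_sub, map_sub, R.tt, R.tt, ← neg_sub (τ p) p,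
        ← neg_sub (τ (π * σ π)) (π * σ π), neg_div_neg_eq]
  set q := (τ p - p) / (τ (π * σ π) - π * σ π) with hqd
  have hqe : τ p - p = q * (τ (π * σ π) - π * σ π) := by
    rw [hqd, div_mul_cancel₀ _ h0]
  refine ⟨p - q * (π * σ π), ?_, q, hq, by ring, hqe⟩
  have hq' := (R.mem q).1 hq
  rw [R.mem]
  constructor
  · rw [map_sub, map_mul σ q, R.lams hv, hp, hq'.1]
  · rw [map_sub, map_mul τ q, hq'.2]
    linear_combination hqe

theorem Ram.splitE {p : M} (hp : σ p = p) {n : ℤ} (hn : Veq v p n) :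
    ∃ p0 ∈ K', ∃ q ∈ K', p = p0 + q * (π * σ π) ∧
    τ p - p = q * (τ (π * σ π) - π * σ π) ∧
    ((n % 4 = 0 ∧ Veq v p0 n ∧ Vge v (q * (π * σ π)) (n + 1)) ∨
      (n % 4 = 2 ∧ Veq v (q * (π * σ π)) n)) := by
  obtain ⟨p0, hp0, q, hq, h1, h2⟩ := R.decompE hv hp
  refine ⟨p0, hp0, q, hq, h1, h2, ?_⟩
  have hqm : ∀ m, Veq v (q * (π * σ π)) m → m % 4 = 2 := by
    intro m hm
    have hq0 : q ≠ 0 := by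
      rintro rfl
      exact Veq.ne_zero hv hm (by simp)
    obtain ⟨l, hl⟩ := exists_veq hv hq0
    have := (Veq.mul hv hl (R.lamv hv)).unique hm
    have := R.good.dvd q hq l hl
    omega
  have hpm : ∀ m, Veq v p0 m → m % 4 = 0 := by
    intro m hm
    have := R.good.dvd p0 hp0 m hm
    omega
  have hn' := hn
  rw [h1] at hn'
  rcases split_val hv hn' (fun m ha hb => by have := hqm m hb; have := hpm m ha; omega) with h | h
  · exact Or.inl ⟨hpm _ h.1, h⟩
  · exact Or.inr ⟨hqm _ h.1, h.1⟩

theorem Ram.evenE {p : M} (hp : σ p = p) {n : ℤ} (hn : Veq v p n) : n % 2 = 0 := by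
  obtain ⟨p0, hp0, q, hq, h1, h2, h3⟩ := R.splitE hv hp hn
  omega

theorem Ram.goodE : Good v (fix σ) 2 where
  hh := Or.inl rfl
  dvd a ha n hn := by
    have := R.evenE hv (mem_fix.1 ha) hn
    omega
  sq a ha j hj := by
    have key : ∀ b : M, σ b = b → ∀ i : ℤ, Veq v b (2 * 4 * i) →
        ∃ c ∈ K', Vge v (b - c ^ 2) (2 * 4 * i + 1) := by
      intro b hb i hbi
      obtain ⟨p0, hp0, q, hq, h1, h2, h3⟩ := R.splitE hv hb hbi
      rcases h3 with ⟨-, h4, h5⟩ | ⟨h4, -⟩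
      · obtain ⟨c, hc, hcv⟩ := R.good.sq p0 hp0 i h4
        refine ⟨c, hc, ?_⟩
        rw [h1]
        have e1 : p0 + q * (π * σ π) - c ^ 2 = (p0 - c ^ 2) + q * (π * σ π) := by ring
        rw [e1]
        exact Vge.add hv hcv h5
      · omega
    rcases Int.even_or_odd' j with ⟨i, rfl | rfl⟩
    · obtain ⟨c, hc, hcv⟩ := key a (mem_fix.1 ha) i (hj.congr (by ring))
      exact ⟨c, R.le_fix hv hc, hcv.mono (by omega)⟩
    · have hl0 := Veq.ne_zero hv (R.lamv hv)
      have hl2 := Veq.sq hv (R.lamv hv)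
      obtain ⟨c, hc, hcv⟩ := key (a / (π * σ π) ^ 2)
        (by rw [map_div₀, map_pow, R.lams hv, mem_fix.1 ha]) i
        ((Veq.div hv hj hl2).congr (by ring))
      refine ⟨c * (π * σ π), (fix σ).mul_mem (R.le_fix hv hc) (mem_fix.2 (R.lams hv)), ?_⟩
      have e1 : a - (c * (π * σ π)) ^ 2 = (a / (π * σ π) ^ 2 - c ^ 2) * (π * σ π) ^ 2 := by
        rw [sub_mul, div_mul_cancel₀ _ (pow_ne_zero 2 hl0)]; ring
      rw [e1]
      exact (Vge.mul hv hcv hl2.ge).mono (by omega)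

theorem Ram.splitM {a : M} {n : ℤ} (hn : Veq v a n) :
    (n % 2 = 1 → Veq v (σ a - a) (n + s)) ∧ (n % 2 = 0 → Vge v (σ a - a) (n + s + 1)) := by
  have h0 : σ π - π ≠ 0 := Veq.ne_zero hv R.bs
  set q := (σ a - a) / (σ π - π) with hqd
  have hqe : σ a - a = q * (σ π - π) := by
    rw [hqd, div_mul_cancel₀ _ h0]
  have hq : σ q = q := by
    rw [hqd, map_div₀, map_sub, map_sub, R.ss, R.ss, ← neg_sub (σ a) a,
        ← neg_sub (σ π) π, neg_div_neg_eq]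
  have hp : σ (a - q * π) = a - q * π := by
    rw [map_sub, map_mul, hq]
    linear_combination hqe
  have hn' : Veq v ((a - q * π) + q * π) n := by rwa [sub_add_cancel]
  have hqm : ∀ m, Veq v (q * π) m → m % 2 = 1 := by
    intro m hm
    have hq0 : q ≠ 0 := by
      intro h
      exact Veq.ne_zero hv hm (by simp [h])
    obtain ⟨l, hl⟩ := exists_veq hv hq0
    have := (Veq.mul hv hl R.pi).unique hm
    have := R.evenE hv hq hl
    omega
  have hpm : ∀ m, Veq v (a - q * π) m → m % 2 = 0 := fun m hm => R.evenE hv hp hm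
  have hpi0 := Veq.ne_zero hv R.pi
  have e1 : σ a - a = q * π * ((σ π - π) / π) := by
    rw [hqe]; field_simp
  have hd := Veq.div hv R.bs R.pi
  rcases split_val hv hn' (fun m ha hb => by have := hqm m hb; have := hpm m ha; omega) with h | h
  · have := hpm _ h.1
    refine ⟨fun _ => by omega, fun _ => ?_⟩
    rw [e1]
    exact (Vge.mul hv h.2 hd.ge).mono (by omega)
  · have := hqm _ h.1
    refine ⟨fun _ => ?_, fun _ => by omega⟩
    rw [e1]
    exact (Veq.mul hv h.1 hd).congr (by omega)

theorem Ram.s_pos : 0 < s := by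
  have h0 : 0 ≤ s := by
    have := (Vge.sub hv (R.vqs hv R.pi).ge R.pi.ge).le_of_eq R.bs
    omega
  rcases eq_or_lt_of_le h0 with h | h
  swap
  · exact h
  exfalso
  have hpi0 := Veq.ne_zero hv R.pi
  have hspi0 := Veq.ne_zero hv (R.vqs hv R.pi)
  have hz : Veq v (σ π / π) 0 := (Veq.div hv (R.vqs hv R.pi) R.pi).congr (by ring)
  have hz1 : Veq v (σ π / π - 1) 0 := by
    have := Veq.div hv R.bs R.pi
    have e1 : (σ π - π) / π = σ π / π - 1 := by field_simp
    rw [e1] at this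
    exact this.congr (by omega)
  have h3 := (R.splitM hv hz).2 (by norm_num)
  rw [map_div₀, R.ss] at h3
  have h4 : Veq v (σ π / π + 1) 0 := by
    have e1 : σ π / π + 1 = (σ π / π - 1) + 2 := by ring
    rw [e1]
    exact Veq.add hv hz1 R.two.ge (by have := R.epos; omega)
  have h5 := Veq.neg hv (Veq.div hv (Veq.mul hv hz1 h4) hz)
  have e2 : -((σ π / π - 1) * (σ π / π + 1) / (σ π / π)) = π / σ π - σ π / π := by
    field_simp; ring
  rw [e2] at h5
  have := h3.le_of_eq h5
  omega

theorem Ram.s_odd (hs : s < 4 * e) : s % 2 = 1 := by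
  have hs0 := R.s_pos hv
  by_contra hne
  have hpi0 := Veq.ne_zero hv R.pi
  have hspi0 := Veq.ne_zero hv (R.vqs hv R.pi)
  have ha := Veq.div hv R.bs R.pi
  set a := (σ π - π) / π with had
  have h1 := (R.splitM hv ha).2 (by omega)
  have h2 := Veq.mul hv R.two ha
  have h3 := Veq.mul hv ha (R.vqs hv ha)
  have e1 : -(a * σ a) = 2 * a + (σ a - a) := by
    have : σ a = (π - σ π) / σ π := by rw [had, map_div₀, map_sub, R.ss]
    rw [this, had]
    field_simp
    ring
  have h4 := (Veq.neg hv h3).ge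
  have h5 := Veq.neg hv h3
  have h6 : Vge v (2 * a + (σ a - a)) (s + 1 - 1 + s + 1) :=
    Vge.add hv (h2.mono (by omega)) (h1.mono (by omega))
  rw [← e1] at h6
  have := h6.le_of_eq h5
  omega

/-- the break of the fixed field of `σ` -/
theorem Ram.breakE (hs : s < 4 * e) (ht : t < 4 * e) (hst : s ≠ t) :
    Veq v (τ (π * σ π) / (π * σ π) - 1) (t + min s t) := by
  have hs0 := R.s_pos hv
  have ht0 := R.symm.s_pos hv
  have hodd := R.symm.s_odd hv ht
  have hpi0 := Veq.ne_zero hv R.pi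
  have hspi0 := Veq.ne_zero hv (R.vqs hv R.pi)
  have ha := Veq.div hv R.bt R.pi
  set a := (τ π - π) / π with had
  have h1 := (R.splitM hv ha).1 (by omega)
  have h2 := Veq.mul hv R.two ha
  have h3 := Veq.mul hv ha (R.vqs hv ha)
  have e1 : τ (π * σ π) / (π * σ π) - 1 = (σ a - a) + a * σ a + 2 * a := by
    have : σ a = (τ (σ π) - σ π) / σ π := by rw [had, map_div₀, map_sub, R.comm]
    rw [this, had, map_mul]
    field_simp
    ring
  rw [e1]
  refine Veq.add hv ?_ h2.ge (by omega)
  rcases lt_or_gt_of_ne hst with h | h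
  · exact (Veq.add hv h1 h3.ge (by omega)).congr (by omega)
  · rw [add_comm]
    exact (Veq.add hv h3 h1.ge (by omega)).congr (by omega)

theorem Ram.moveE {B : ℤ} (hB : Veq v (τ (π * σ π) / (π * σ π) - 1) B) {p : M} (hp : σ p = p)
    {n : ℤ} (hn : Veq v p n) :
    Vge v (τ p - p) (n + B) ∧ (n % 4 = 2 → Veq v (τ p - p) (n + B)) := by
  obtain ⟨p0, hp0, q, hq, h1, h2, h3⟩ := R.splitE hv hp hn
  have hl0 := Veq.ne_zero hv (R.lamv hv)
  have e1 : τ p - p = q * (π * σ π) * (τ (π * σ π) / (π * σ π) - 1) := by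
    rw [h2, mul_assoc, mul_sub (π * σ π), mul_one, mul_div_cancel₀ _ hl0]
  rw [e1]
  rcases h3 with ⟨h4, h5, h6⟩ | ⟨h4, h5⟩
  · exact ⟨(Vge.mul hv h6 hB.ge).mono (by omega), fun _ => by omega⟩
  · have := Veq.mul hv h5 hB
    exact ⟨this.ge, fun _ => this⟩

theorem Ram.normalize {B : ℤ} (hB : Veq v (τ (π * σ π) / (π * σ π) - 1) B) (hB0 : 0 < B)
    (hBe : B < 4 * e) {r : M} (hr0 : r ≠ 0) (hr : σ r = r) (hr' : τ r = -r) :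
    ∃ C ∈ K', C ≠ 0 ∧ Veq v ((C * r) ^ 2 - 1) (8 * e - 2 * B) ∧ (8 * e - 2 * B) % 8 = 4 := by
  have he := R.epos
  have hκ : r ^ 2 ∈ K' := by
    rw [R.mem, map_pow, map_pow, hr, hr']
    exact ⟨rfl, by ring⟩
  have hm2 : ∀ x : M, τ x = -x → τ x - x = -(2 * x) := fun x hx => by rw [hx]; ring
  rcases classify hv R.good R.two (T := 8 * e) (by omega) hκ (pow_ne_zero 2 hr0) with
      ⟨l, hl⟩ | ⟨C, hC, hC0, h3⟩
  · have hrv : Veq v r (2 + 4 * l) := Veq.of_sq hv (hl.congr (by ring))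
    have h1 := (R.moveE hv hB hr hrv).2 (by omega)
    rw [hm2 r hr'] at h1
    have h2 := Veq.neg hv (Veq.mul hv R.two hrv)
    have := h1.unique h2
    omega
  refine ⟨C, hC, hC0, ?_⟩
  have hC' := (R.mem C).1 hC
  have hrC : σ (C * r) = C * r := by rw [map_mul, hC'.1, hr]
  have hrC' : τ (C * r) = -(C * r) := by rw [map_mul, hC'.2, hr']; ring
  set z := C * r - 1 with hz
  have hzs : σ z = z := by rw [hz, map_sub, hrC, map_one]
  have hzt : τ z - z = -(2 * (C * r)) := by rw [hz, map_sub, hrC', map_one]; ring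
  have hzw : (1 + z) ^ 2 = 1 + (C ^ 2 * r ^ 2 - 1) := by rw [hz]; ring
  have hunit : Veq v (C * r) 0 := by
    apply Veq.of_sq hv
    have e1 : (C * r) ^ 2 = 1 + (C ^ 2 * r ^ 2 - 1) := by ring
    rw [e1]
    rcases h3 with h3 | ⟨l, h4, h5, h6⟩
    · exact veq_one_add hv h3 (by omega)
    · exact veq_one_add hv h6.ge (by omega)
  have hzt' : Veq v (τ z - z) (4 * e) := by
    rw [hzt]
    exact (Veq.neg hv (Veq.mul hv R.two hunit)).congr (by ring)
  rcases h3 with h3 | ⟨l, h4, h5, h6⟩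
  · exfalso
    have hz0 : z ≠ 0 := by
      intro h
      rw [h, map_zero, sub_zero] at hzt'
      exact Veq.ne_zero hv hzt' rfl
    obtain ⟨m, hm⟩ := exists_veq hv hz0
    have h7 := (R.moveE hv hB hzs hm).1.le_of_eq hzt'
    have e1 : C ^ 2 * r ^ 2 - 1 = z ^ 2 + 2 * z := by linear_combination -hzw
    rw [e1] at h3
    have h8 := Veq.add hv (Veq.sq hv hm) (Veq.mul hv R.two hm).ge (by omega)
    have := h3.le_of_eq h8
    omega
  · have hzv : Veq v z (2 + 4 * l) :=
      sqrt_val hv R.two hzw (h6.congr (by ring)) (by omega)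
    have h7 := ((R.moveE hv hB hzs hzv).2 (by omega)).unique hzt'
    refine ⟨?_, by omega⟩
    have e1 : (C * r) ^ 2 - 1 = C ^ 2 * r ^ 2 - 1 := by ring
    rw [e1]
    exact h6.congr (by omega)

/-- Normalising an element whose norm is close to one. -/
theorem Ram.eta_norm {B m : ℤ} (hB : Veq v (τ (π * σ π) / (π * σ π) - 1) B)
    {η w : M} (hη : σ η = η) (hηw : η * τ η = 1 + w) (hw : Vge v w m) :
    ∃ κ ∈ K', κ ≠ 0 ∧ ∃ C : M, C ≠ 0 ∧ ∃ δ, σ δ = δ ∧ Vge v δ (m - B) ∧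
      η = κ * C ^ 2 * (1 + δ) := by
  have normmem : ∀ x : M, σ x = x → x * τ x ∈ K' := by
    intro x hx
    rw [R.mem, map_mul, map_mul, R.comm, R.tt, hx]
    exact ⟨rfl, mul_comm _ _⟩
  have tne : ∀ x : M, x ≠ 0 → τ x ≠ 0 := fun x hx => by simpa using hx
  have key : ∀ (η : M) (_ : σ η = η) (_ : η * τ η = 1 + w) (n : ℤ) (_ : Veq v (1 + η) n)
      (_ : n ≤ B), ∃ κ ∈ K', κ ≠ 0 ∧ ∃ C : M, C ≠ 0 ∧ ∃ δ, σ δ = δ ∧ Vge v δ (m - B) ∧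
      η = κ * C ^ 2 * (1 + δ) := by
    intro η hη hηw n hn hnB
    have h0 := Veq.ne_zero hv hn
    have ht0 : τ (1 + η) ≠ 0 := tne _ h0
    have hs1 : σ (1 + η) = 1 + η := by rw [map_add, map_one, hη]
    have hws : σ w = w := by
      have : w = η * τ η - 1 := by rw [hηw]; ring
      rw [this, map_sub, map_mul, R.comm, hη, map_one]
    refine ⟨((1 + η) * τ (1 + η))⁻¹, K'.inv_mem (normmem _ hs1),
      inv_ne_zero (mul_ne_zero h0 ht0), 1 + η, h0, w / (1 + η), ?_, ?_, ?_⟩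
    · rw [map_div₀, hs1, hws]
    · exact (Vge.div hv hw hn).mono (by omega)
    · have e1 : τ (1 + η) = 1 + τ η := by rw [map_add, map_one]
      rw [e1] at ht0 ⊢
      field_simp
      linear_combination hηw
  have hBbad : ∀ n, Vge v (1 + η) n ∨ ∃ k, k < n ∧ Veq v (1 + η) k := by
    intro n
    by_cases h : 1 + η = 0
    · left; rw [h]; exact vge_zero hv _
    · obtain ⟨k, hk⟩ := exists_veq hv h
      rcases lt_or_ge k n with h1 | h1
      · exact Or.inr ⟨k, h1, hk⟩
      · exact Or.inl (hk.mono h1)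
  rcases hBbad (B + 1) with hge | ⟨k, hk, hkv⟩
  swap
  · exact key η hη hηw k hkv (by omega)
  have hl0 := Veq.ne_zero hv (R.lamv hv)
  have hlv := R.lamv hv
  have hls := R.lams hv
  set Λ := π * σ π with hΛ
  clear_value Λ
  have htl0 : τ Λ ≠ 0 := tne _ hl0
  have hq0 : Veq v (τ Λ / Λ) 0 := (Veq.div hv (R.vqt hv hlv) hlv).congr (by ring)
  have hq1 : Veq v (1 - τ Λ / Λ) B := by
    rw [← neg_sub]; exact Veq.neg hv hB
  have h1 : Veq v (1 + η * (τ Λ / Λ)) B := by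
    have e1 : 1 + η * (τ Λ / Λ) = (1 - τ Λ / Λ) + (1 + η) * (τ Λ / Λ) := by ring
    rw [e1]
    exact Veq.add hv hq1 (Vge.mul hv hge hq0.ge) (by omega)
  obtain ⟨κ, hκ, hκ0, C, hC0, δ, hδ, hδv, h2⟩ := key (η * (τ Λ / Λ))
    (by rw [map_mul, map_div₀, R.comm, hls, hη])
    (by
      rw [map_mul, map_div₀, R.tt, ← hηw]
      field_simp) B h1 le_rfl
  refine ⟨κ * (Λ * τ Λ)⁻¹, K'.mul_mem hκ (K'.inv_mem (normmem _ hls)),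
    mul_ne_zero hκ0 (inv_ne_zero (mul_ne_zero hl0 htl0)), C * Λ, mul_ne_zero hC0 hl0, δ, hδ, hδv, ?_⟩
  have h3 : η = (η * (τ Λ / Λ)) * (Λ / τ Λ) := by field_simp
  rw [h3, h2]
  field_simp

end ram
end UTB
namespace UTB
section padic

theorem cube_root (z : ℤ_[2]) : ∃ c : ℤ_[2], 1 + 2 * z = (1 + 2 * c) ^ 3 := by
  have h3 : ‖(3 : ℤ_[2])‖ = 1 := by
    rw [← PadicInt.isUnit_iff]
    have h := PadicInt.isUnit_iff (p := 2) (z := (3 : ℤ_[2]))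
    rw [h]
    by_contra hne
    have hlt : ‖(3 : ℤ_[2])‖ < 1 := lt_of_le_of_ne (PadicInt.norm_le_one _) hne
    rw [PadicInt.norm_lt_one_iff_dvd] at hlt
    have h2 : (2 : ℤ_[2]) ∣ 1 := by
      have := dvd_sub hlt (dvd_refl ((2 : ℕ) : ℤ_[2]))
      push_cast at this
      norm_num at this
      exact this
    have h4 : ‖(2 : ℤ_[2])‖ < 1 := by
      rw [PadicInt.norm_lt_one_iff_dvd]; push_cast; exact dvd_refl _
    have h5 := PadicInt.isUnit_iff.1 (isUnit_iff_dvd_one.2 h2)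
    linarith
  have hd : ‖(2 * z : ℤ_[2])‖ < 1 := by
    rw [PadicInt.norm_lt_one_iff_dvd]; push_cast; exact dvd_mul_right _ _
  obtain ⟨w, hw, hw1, -⟩ := hensels_lemma (p := 2)
    (F := (Polynomial.X ^ 3 - Polynomial.C (1 + 2 * z) : Polynomial ℤ_[2])) (a := (1 : ℤ_[2])) (by
      have e3 : (2 + 1 : ℤ_[2]) = 3 := by norm_num
      have hd' : ‖(2 : ℤ_[2])‖ * ‖z‖ < 1 := by rw [← norm_mul]; exact hd
      simp [e3, h3]
      simpa using hd')
  have hw2 : ‖w - 1‖ < 1 := by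
    have e3 : (2 + 1 : ℤ_[2]) = 3 := by norm_num
    simpa [e3, h3] using hw1
  rw [PadicInt.norm_lt_one_iff_dvd] at hw2
  obtain ⟨c, hc⟩ := hw2
  refine ⟨c, ?_⟩
  simp only [map_sub, map_pow, Polynomial.aeval_X, Polynomial.aeval_C] at hw
  have : w = 1 + 2 * c := by
    push_cast at hc
    linear_combination hc
  rw [← this]
  have h6 : (algebraMap ℤ_[2] ℤ_[2]) (1 + 2 * z) = 1 + 2 * z := rfl
  rw [h6] at hw
  linear_combination -hw

theorem two_cases (z : ℤ_[2]) : ∃ c : ℤ_[2], z = 2 * c ∨ z = 1 + 2 * c := by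
  obtain ⟨n, hn, hz⟩ := PadicInt.exists_mem_range z
  rw [PadicInt.maximalIdeal_eq_span_p, Ideal.mem_span_singleton] at hz
  obtain ⟨c, hc⟩ := hz
  push_cast at hc
  refine ⟨c, ?_⟩
  interval_cases n
  · left; push_cast at hc; linear_combination hc
  · right; push_cast at hc; linear_combination hc

variable {F : Type*} [Field F] [Algebra ℚ_[2] F] {v : F → WithTop ℤ}

/-- The structure map from the 2-adic integers. -/
noncomputable def toF (F : Type*) [Field F] [Algebra ℚ_[2] F] : ℤ_[2] →+* F :=
  (algebraMap ℚ_[2] F).comp PadicInt.Coe.ringHom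

theorem toF_inj : Function.Injective (toF F) := by
  intro a b h
  have := (algebraMap ℚ_[2] F).injective h
  exact Subtype.coe_injective this

omit [Algebra ℚ_[2] F] in
theorem Veq.npow (hv : DiscreteVal F v) {a : F} {m : ℤ} (h : Veq v a m) (n : ℕ) :
    Veq v (a ^ n) (n * m) := by
  induction n with
  | zero => simpa using veq_one hv
  | succ n ih => rw [pow_succ]; exact (Veq.mul hv ih h).congr (by push_cast; ring)

theorem unit_val_aux (hv : DiscreteVal F v) (N : ℕ) : ∀ (z : ℤ_[2]) (n : ℤ), n.natAbs ≤ N →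
    Veq v (toF F (1 + 2 * z)) n → n = 0 := by
  induction N with
  | zero => intro z n hn _; omega
  | succ N ih =>
    intro z n hn h
    obtain ⟨c, hc⟩ := cube_root z
    rw [hc, map_pow] at h
    have h0 : toF F (1 + 2 * c) ≠ 0 := by
      intro h0
      rw [h0] at h
      exact Veq.ne_zero hv h (by simp)
    obtain ⟨m, hm⟩ := exists_veq hv h0
    have h1 := (Veq.npow hv hm 3).unique h
    push_cast at h1
    by_contra hne
    have := ih c m (by omega) hm
    omega

theorem odd_ne (z : ℤ_[2]) : (1 + 2 * z) ≠ 0 := by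
  intro h
  have h2 : IsUnit (2 : ℤ_[2]) := isUnit_iff_dvd_one.2 ⟨-z, by linear_combination h⟩
  have h4 : ‖(2 : ℤ_[2])‖ < 1 := by
    rw [PadicInt.norm_lt_one_iff_dvd]; push_cast; exact dvd_refl _
  have h5 := PadicInt.isUnit_iff.1 h2
  linarith

theorem unit_val (hv : DiscreteVal F v) (z : ℤ_[2]) : Veq v (toF F (1 + 2 * z)) 0 := by
  have h0 : toF F (1 + 2 * z) ≠ 0 := fun h =>
    odd_ne z (toF_inj (F := F) (by rw [h, map_zero]))
  obtain ⟨m, hm⟩ := exists_veq hv h0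
  exact hm.congr (unit_val_aux hv _ z m le_rfl hm)

theorem int_val (hv : DiscreteVal F v) (z : ℤ_[2]) : Vge v (toF F z) 0 := by
  rcases eq_or_ne z 0 with rfl | hz
  · rw [map_zero]; exact vge_zero hv _
  have h0 : toF F z ≠ 0 := fun h => hz (toF_inj (F := F) (by rw [h, map_zero]))
  obtain ⟨m, hm⟩ := exists_veq hv h0
  have h20 : toF F 2 ≠ 0 := fun h => two_ne_zero (toF_inj (F := F) (by rw [h, map_zero]))
  obtain ⟨l, hl⟩ := exists_veq hv h20
  have key : ∀ n : ℕ, 0 ≤ l + n * m := by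
    intro n
    have h1 : Vge v (toF F (2 * z ^ n)) 0 := by
      have : toF F (2 * z ^ n) = toF F (1 + 2 * z ^ n) - 1 := by
        rw [map_add, map_one]; ring
      rw [this]
      exact Vge.sub hv (unit_val hv _).ge (veq_one hv).ge
    rw [map_mul, map_pow] at h1
    exact h1.le_of_eq (Veq.mul hv hl (Veq.npow hv hm n))
  refine hm.mono ?_
  by_contra hneg
  have h2 := key (l.natAbs + 1)
  push_cast at h2
  have h3 : l ≤ |l| := le_abs_self l
  have h4 : 0 ≤ |l| := abs_nonneg l
  nlinarith

theorem sum_vge (hv : DiscreteVal F v) {n : ℤ} (s : Finset ℕ) (f : ℕ → F)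
    (h : ∀ i ∈ s, Vge v (f i) n) : Vge v (∑ i ∈ s, f i) n := by
  induction s using Finset.induction_on with
  | empty => simpa using vge_zero hv n
  | insert a s ha ih =>
    rw [Finset.sum_insert ha]
    exact Vge.add hv (h a (Finset.mem_insert_self _ _))
      (ih fun i hi => h i (Finset.mem_insert_of_mem hi))

theorem Vge.npow (hv : DiscreteVal F v) {a : F} (h : Vge v a 0) (n : ℕ) :
    Vge v (a ^ n) 0 := by
  induction n with
  | zero => simpa using (veq_one hv).ge
  | succ n ih => rw [pow_succ]; exact (Vge.mul hv ih h).mono (by simp)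

theorem sq_sum (hv : DiscreteVal F v) (h2 : Vge v (2 : F) 1) (f : ℕ → F)
    (hf : ∀ i, Vge v (f i) 0) (n : ℕ) :
    Vge v ((∑ i ∈ Finset.range n, f i) ^ 2 - ∑ i ∈ Finset.range n, f i ^ 2) 1 := by
  induction n with
  | zero => simpa using vge_zero hv 1
  | succ n ih =>
    rw [Finset.sum_range_succ, Finset.sum_range_succ]
    have : (∑ i ∈ Finset.range n, f i + f n) ^ 2 - (∑ i ∈ Finset.range n, f i ^ 2 + f n ^ 2)
      = ((∑ i ∈ Finset.range n, f i) ^ 2 - ∑ i ∈ Finset.range n, f i ^ 2)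
        + 2 * ((∑ i ∈ Finset.range n, f i) * f n) := by ring
    rw [this]
    refine Vge.add hv ih ?_
    exact (Vge.mul hv h2 (Vge.mul hv (sum_vge hv _ _ fun i _ => hf i) (hf n))).mono (by simp)

theorem sum_split (n : ℕ) (f : ℕ → F) : ∑ i ∈ Finset.range (2 * n), f i =
    ∑ j ∈ Finset.range n, f (2 * j) + ∑ j ∈ Finset.range n, f (2 * j + 1) := by
  induction n with
  | zero => simp
  | succ n ih =>
    rw [mul_add, mul_one, Finset.sum_range_succ, Finset.sum_range_succ, ih,
      Finset.sum_range_succ, Finset.sum_range_succ]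
    ring

theorem perfect_aux (hv : DiscreteVal F v) (h2 : Vge v (2 : F) 1) {a : F} (ha : Veq v a 0)
    (n : ℕ) : ∀ c : ℕ → F, (∀ i, c i = 0 ∨ c i = 1) → (∃ i < 2 ^ n, c i = 1) →
      Vge v (∑ i ∈ Finset.range (2 ^ n), c i * a ^ i) 1 → ∃ b, Vge v (a - b ^ 2) 1 := by
  induction n with
  | zero =>
    rintro c - ⟨i, hi, hc⟩ h
    have : i = 0 := by simpa using hi
    subst this
    simp [hc] at h
    have := h.le_of_eq (veq_one hv)
    omega
  | succ n ih =>
    rintro c hc ⟨i, hi, hci⟩ h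
    have hc0 : ∀ i, Vge v (c i) 0 := by
      intro i
      rcases hc i with h | h <;> rw [h]
      · exact vge_zero hv _
      · exact (veq_one hv).ge
    have hcc : ∀ i, c i ^ 2 = c i := by
      intro i
      rcases hc i with h | h <;> rw [h] <;> simp
    have hai : ∀ i : ℕ, Vge v (a ^ i) 0 := fun i => Vge.npow hv ha.ge i
    rw [pow_succ, mul_comm, sum_split] at h
    set f := ∑ j ∈ Finset.range (2 ^ n), c (2 * j) * a ^ j with hf
    set g := ∑ j ∈ Finset.range (2 ^ n), c (2 * j + 1) * a ^ j with hg
    have hf0 : Vge v f 0 := sum_vge hv _ _ fun j _ => by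
      simpa using Vge.mul hv (hc0 (2 * j)) (hai j)
    have hg0 : Vge v g 0 := sum_vge hv _ _ fun j _ => by
      simpa using Vge.mul hv (hc0 (2 * j + 1)) (hai j)
    have hf2 := sq_sum hv h2 (fun j => c (2 * j) * a ^ j)
      (fun j => by simpa using Vge.mul hv (hc0 (2 * j)) (hai j)) (2 ^ n)
    have hg2 := sq_sum hv h2 (fun j => c (2 * j + 1) * a ^ j)
      (fun j => by simpa using Vge.mul hv (hc0 (2 * j + 1)) (hai j)) (2 ^ n)
    simp only [mul_pow, hcc, ← pow_mul] at hf2 hg2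
    rw [← hf] at hf2
    rw [← hg] at hg2
    have e1 : ∑ j ∈ Finset.range (2 ^ n), c (2 * j) * a ^ (2 * j)
        = ∑ j ∈ Finset.range (2 ^ n), c (2 * j) * a ^ (j * 2) :=
      Finset.sum_congr rfl fun j _ => by rw [mul_comm 2 j]
    have e2 : ∑ j ∈ Finset.range (2 ^ n), c (2 * j + 1) * a ^ (2 * j + 1)
        = a * ∑ j ∈ Finset.range (2 ^ n), c (2 * j + 1) * a ^ (j * 2) := by
      rw [Finset.mul_sum]
      exact Finset.sum_congr rfl fun j _ => by rw [mul_comm 2 j]; ring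
    rw [e1, e2] at h
    have main : Vge v (f ^ 2 + a * g ^ 2) 1 := by
      have := Vge.add hv (Vge.add hv h hf2) ((Vge.mul hv ha.ge hg2).mono (by simp))
      convert this using 1
      ring
    rcases hg0.eq_or with hgv | hgv
    · have hgne := Veq.ne_zero hv hgv
      refine ⟨f / g, ?_⟩
      have h3 : Vge v ((f ^ 2 + a * g ^ 2) / g ^ 2) 1 :=
        (Vge.div hv main (Veq.sq hv hgv)).mono (by simp)
      have h4 : Vge v (2 * (f / g) ^ 2) 1 :=
        (Vge.mul hv h2 (Vge.sq hv (Vge.div hv hf0 hgv))).mono (by simp)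
      have := Vge.sub hv h3 h4
      convert this using 1
      field_simp
      ring
    · have hfv : Vge v f 1 := by
        rcases hf0.eq_or with hf1 | hf1
        · exfalso
          have h5 : Vge v (f ^ 2) 1 := by
            have := Vge.sub hv main ((Vge.mul hv ha.ge (Vge.sq hv hgv)).mono (by norm_num) :
              Vge v (a * g ^ 2) 1)
            convert this using 1
            ring
          have := h5.le_of_eq (Veq.sq hv hf1)
          omega
        · simpa using hf1
      rcases Nat.even_or_odd' i with ⟨j, hj | hj⟩
      · exact ih (fun j => c (2 * j)) (fun j => hc _) ⟨j, by rw [pow_succ] at hi; omega, by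
          rw [← hj]; exact hci⟩ hfv
      · exact ih (fun j => c (2 * j + 1)) (fun j => hc _) ⟨j, by rw [pow_succ] at hi; omega, by
          rw [← hj]; exact hci⟩ (by simpa using hgv)

theorem perfect_zero [FiniteDimensional ℚ_[2] F] (hv : DiscreteVal F v) (h2 : Vge v (2 : F) 1)
    {a : F} (ha : Veq v a 0) : ∃ b, Vge v (a - b ^ 2) 1 := by
  obtain ⟨p, hp0, hp⟩ := (Algebra.IsAlgebraic.isAlgebraic a : IsAlgebraic ℚ_[2] a)
  obtain ⟨i0, hi0, hmax⟩ := Finset.exists_max_image p.support (fun i => ‖p.coeff i‖)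
    (by simpa using hp0)
  have hpi : p.coeff i0 ≠ 0 := by simpa using hi0
  have hle : ∀ i, ‖p.coeff i / p.coeff i0‖ ≤ 1 := by
    intro i
    rw [norm_div]
    apply div_le_one_of_le₀ _ (norm_nonneg _)
    by_cases h : i ∈ p.support
    · exact hmax i h
    · rw [Polynomial.notMem_support_iff.1 h, norm_zero]; exact norm_nonneg _
  let q : ℕ → ℤ_[2] := fun i => ⟨p.coeff i / p.coeff i0, hle i⟩
  have hq : ∀ i, toF F (q i) = algebraMap ℚ_[2] F (p.coeff i / p.coeff i0) := fun i => rfl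
  have hex : ∀ i, ∃ c : F, (c = 0 ∨ c = 1) ∧ (q i = 1 → c = 1) ∧ Vge v (toF F (q i) - c) 1 := by
    intro i
    obtain ⟨w, hw | hw⟩ := two_cases (q i)
    · refine ⟨0, Or.inl rfl, ?_, ?_⟩
      · intro h1
        exact (odd_ne (-w) (by linear_combination hw - h1)).elim
      · rw [hw, sub_zero, map_mul, map_ofNat]
        exact (Vge.mul hv h2 (int_val hv w)).mono (by simp)
    · refine ⟨1, Or.inr rfl, fun _ => rfl, ?_⟩
      rw [hw, map_add, map_one, add_sub_cancel_left, map_mul, map_ofNat]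
      exact (Vge.mul hv h2 (int_val hv w)).mono (by simp)
  choose c hc hc1 hcv using hex
  have hlt : p.natDegree < 2 ^ p.natDegree := Nat.lt_two_pow_self
  refine perfect_aux hv h2 ha p.natDegree c hc ⟨i0, ?_, hc1 i0 ?_⟩ ?_
  · exact lt_of_le_of_lt (Polynomial.le_natDegree_of_ne_zero hpi) hlt
  · apply Subtype.ext
    exact div_self hpi
  · have h0 : ∑ i ∈ Finset.range (2 ^ p.natDegree), toF F (q i) * a ^ i = 0 := by
      rw [Polynomial.aeval_eq_sum_range' hlt] at hp
      have : ∀ i, toF F (q i) * a ^ i = (algebraMap ℚ_[2] F (p.coeff i0))⁻¹ * (p.coeff i • a ^ i) := by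
        intro i
        rw [hq, map_div₀, Algebra.smul_def]
        ring
      simp only [this]
      rw [← Finset.mul_sum, hp, mul_zero]
    have h1 : Vge v (∑ i ∈ Finset.range (2 ^ p.natDegree), (toF F (q i) - c i) * a ^ i) 1 :=
      sum_vge hv _ _ fun i _ =>
        (Vge.mul hv (hcv i) (Vge.npow hv ha.ge i)).mono (by simp)
    simp only [sub_mul] at h1
    rw [Finset.sum_sub_distrib, h0, zero_sub] at h1
    simpa using Vge.neg hv h1

theorem exists_val (hv : DiscreteVal F v) (j : ℤ) : ∃ b, Veq v b j := by
  obtain ⟨π, hπ⟩ := hv.2.2.2.2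
  have hπ : Veq v π 1 := hπ
  rcases Int.eq_nat_or_neg j with ⟨n, rfl | rfl⟩
  · exact ⟨π ^ n, (Veq.npow hv hπ n).congr (by ring)⟩
  · exact ⟨(π ^ n)⁻¹, (Veq.inv hv (Veq.npow hv hπ n)).congr (by ring)⟩

theorem perfect [FiniteDimensional ℚ_[2] F] (hv : DiscreteVal F v) (h2 : Vge v (2 : F) 1)
    {a : F} {j : ℤ} (ha : Veq v a (2 * j)) : ∃ b, Vge v (a - b ^ 2) (2 * j + 1) := by
  obtain ⟨r, hr⟩ := exists_val hv j
  have hr0 := Veq.ne_zero hv hr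
  obtain ⟨b, hb⟩ := perfect_zero hv h2 (a := a / r ^ 2)
    ((Veq.div hv ha (Veq.sq hv hr)).congr (by ring))
  refine ⟨b * r, ?_⟩
  have := Vge.mul hv hb (Veq.sq hv hr).ge
  convert this using 1
  · field_simp
  · ring

end padic

section invariance
variable {K M : Type*} [Field K] [Field M] [Algebra K M]

/-- Field of constants in `M`. -/
def base (K M : Type*) [Field K] [Field M] [Algebra K M] : Subfield M :=
  (algebraMap K M).fieldRange

theorem good_base [Algebra ℚ_[2] K] [FiniteDimensional ℚ_[2] K] {vK : K → WithTop ℤ}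
    {vM : M → WithTop ℤ} (hvK : DiscreteVal K vK) (hvM : DiscreteVal M vM)
    (hram : ∀ a : K, vM (algebraMap K M a) = 4 • vK a) (h2 : Vge vK (2 : K) 1) :
    Good vM (base K M) 4 := by
  have hup : ∀ (a : K) (n : ℤ), Veq vK a n → Veq vM (algebraMap K M a) (4 * n) := by
    intro a n h
    unfold Veq at *
    rw [hram, h]
    exact_mod_cast (by simp : (4 : ℕ) • n = 4 * n)
  refine ⟨Or.inr rfl, ?_, ?_⟩
  · rintro _ ⟨a, rfl⟩ n hn
    have ha : a ≠ 0 := by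
      rintro rfl
      rw [map_zero] at hn
      exact Veq.ne_zero hvM hn rfl
    obtain ⟨m, hm⟩ := exists_veq hvK ha
    exact ⟨m, hn.unique (hup a m hm)⟩
  · rintro _ ⟨a, rfl⟩ j hj
    have ha : a ≠ 0 := by
      rintro rfl
      rw [map_zero] at hj
      exact Veq.ne_zero hvM hj rfl
    obtain ⟨m, hm⟩ := exists_veq hvK ha
    have := hj.unique (hup a m hm)
    obtain ⟨b, hb⟩ := perfect hvK h2 (j := j) (hm.congr (by omega))
    refine ⟨algebraMap K M b, ⟨b, rfl⟩, ?_⟩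
    rw [← map_pow, ← map_sub]
    rcases eq_or_ne (a - b ^ 2) 0 with h0 | h0
    · rw [h0, map_zero]; exact vge_zero hvM _
    · obtain ⟨l, hl⟩ := exists_veq hvK h0
      have := hb.le_of_eq hl
      exact (hup _ _ hl).mono (by omega)

end invariance
end UTB
namespace UTB
section invariance
variable {K M : Type*} [Field K] [Field M] [Algebra K M]

theorem span_four {u v : K} {x y : M} (hx : x ^ 2 = algebraMap K M u) (hy : y ^ 2 = algebraMap K M v)
    (hadj : Algebra.adjoin K ({x, y} : Set M) = ⊤) (m : M) :
    ∃ a b c d : K, m = algebraMap K M a + algebraMap K M b * x + algebraMap K M c * y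
      + algebraMap K M d * (x * y) := by
  have hm : m ∈ Algebra.adjoin K ({x, y} : Set M) := by rw [hadj]; trivial
  induction hm using Algebra.adjoin_induction with
  | mem z hz =>
    rcases hz with rfl | hz
    · exact ⟨0, 1, 0, 0, by simp⟩
    · rw [Set.mem_singleton_iff] at hz
      subst hz
      exact ⟨0, 0, 1, 0, by simp⟩
  | algebraMap r => exact ⟨r, 0, 0, 0, by simp⟩
  | add p q _ _ hp hq =>
    obtain ⟨a, b, c, d, rfl⟩ := hp
    obtain ⟨a', b', c', d', rfl⟩ := hq
    exact ⟨a + a', b + b', c + c', d + d', by simp only [map_add]; ring⟩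
  | mul p q _ _ hp hq =>
    obtain ⟨a, b, c, d, rfl⟩ := hp
    obtain ⟨a', b', c', d', rfl⟩ := hq
    refine ⟨a * a' + b * b' * u + c * c' * v + d * d' * u * v,
      a * b' + b * a' + (c * d' + d * c') * v, a * c' + c * a' + (b * d' + d * b') * u,
      a * d' + d * a' + b * c' + c * b', ?_⟩
    simp only [map_add, map_mul, ← hx, ← hy]
    ring

theorem dep_five {u v : K} {x y : M} (hx : x ^ 2 = algebraMap K M u)
    (hy : y ^ 2 = algebraMap K M v)
    (hadj : Algebra.adjoin K ({x, y} : Set M) = ⊤) (b : Fin 5 → M) :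
    ∃ g : Fin 5 → K, ∑ i, g i • b i = 0 ∧ ∃ i, g i ≠ 0 := by
  classical
  rw [← Fintype.not_linearIndependent_iff]
  intro hli
  have hspan : Submodule.span K (Set.range ![(1 : M), x, y, x * y]) = ⊤ := by
    rw [eq_top_iff]
    rintro m -
    obtain ⟨a, b, c, d, rfl⟩ := span_four hx hy hadj m
    have hmem : ∀ i, (![(1 : M), x, y, x * y]) i ∈
        Submodule.span K (Set.range ![(1 : M), x, y, x * y]) :=
      fun i => Submodule.subset_span ⟨i, rfl⟩
    have h0 := hmem 0
    have h1 := hmem 1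
    have h2 := hmem 2
    have h3 := hmem 3
    refine Submodule.add_mem _ (Submodule.add_mem _ (Submodule.add_mem _ ?_ ?_) ?_) ?_
    · have := Submodule.smul_mem _ a h0
      rw [Algebra.smul_def] at this
      simpa using this
    · have := Submodule.smul_mem _ b h1
      rw [Algebra.smul_def] at this
      simpa using this
    · have := Submodule.smul_mem _ c h2
      rw [Algebra.smul_def] at this
      simpa using this
    · have := Submodule.smul_mem _ d h3
      rw [Algebra.smul_def] at this
      simpa using this
  haveI : Module.Finite K M := ⟨⟨Finset.univ.image ![(1 : M), x, y, x * y], by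
    rw [Finset.coe_image, Finset.coe_univ, Set.image_univ, hspan]⟩⟩
  have h1 := finrank_le_of_span_eq_top hspan
  have h2 := hli.fintype_card_le_finrank
  simp only [Fintype.card_fin] at h1 h2
  omega

variable {v : M → WithTop ℤ} (hv : DiscreteVal M v) {K' : Subfield M}
  (hdvd : ∀ a ∈ K', ∀ n : ℤ, Veq v a n → (4 : ℤ) ∣ n) {π : M} (hπ : Veq v π 1)
include hv hdvd hπ

theorem val_two {b : M} (hb : b ∈ K') {m : ℤ} (hm : Veq v (b * π ^ 2) m) : m % 4 = 2 := by
  have hb0 : b ≠ 0 := by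
    rintro rfl
    rw [zero_mul] at hm
    exact Veq.ne_zero hv hm rfl
  obtain ⟨l, hl⟩ := exists_veq hv hb0
  have h1 := hdvd b hb l hl
  have h2 := hm.unique (Veq.mul hv hl (Veq.sq hv hπ))
  omega

theorem inv1 {a b : M} (ha : a ∈ K') (hb : b ∈ K') {n : ℤ} (h : Veq v (a + b * π ^ 2) n) :
    Vge v a n ∧ Vge v b (n - 2) ∧ n % 2 = 0 := by
  have hd : ∀ {n : ℤ}, Vge v (b * π ^ 2) n → Vge v b (n - 2) := by
    intro n hn
    have h0 : π ≠ 0 := Veq.ne_zero hv hπ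
    have := Vge.div hv hn (Veq.sq hv hπ)
    rw [mul_div_cancel_right₀ _ (pow_ne_zero 2 h0)] at this
    exact this.mono (by omega)
  rcases split_val hv h (fun m hm hm' => by
    have h1 := hdvd a ha m hm
    have h2 := val_two hv hdvd hπ hb hm'
    omega) with ⟨h1, h2⟩ | ⟨h1, h2⟩
  · have := hdvd a ha n h1
    exact ⟨h1.ge, (hd h2).mono (by omega), by omega⟩
  · have := val_two hv hdvd hπ hb h1
    exact ⟨h2.mono (by omega), hd h1.ge, by omega⟩

theorem inv2 {a b c d : M} (ha : a ∈ K') (hb : b ∈ K') (hc : c ∈ K') (hd : d ∈ K') {n : ℤ}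
    (h : Veq v ((a + b * π ^ 2) + (c + d * π ^ 2) * π) n) :
    Vge v a n ∧ Vge v b (n - 2) ∧ Vge v c (n - 1) ∧ Vge v d (n - 3) := by
  have h0 : π ≠ 0 := Veq.ne_zero hv hπ
  have key : ∀ {m : ℤ}, Veq v ((c + d * π ^ 2) * π) m → Veq v (c + d * π ^ 2) (m - 1) := by
    intro m hm
    have := Veq.div hv hm hπ
    rwa [mul_div_cancel_right₀ _ h0] at this
  have ge : ∀ {p q : M} {m : ℤ}, p ∈ K' → q ∈ K' → Vge v (p + q * π ^ 2) m →
      Vge v p m ∧ Vge v q (m - 2) := by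
    intro p q m hp hq hm
    rcases eq_or_ne (p + q * π ^ 2) 0 with hz | hz
    · rcases eq_or_ne q 0 with rfl | hq0
      · rw [zero_mul, add_zero] at hz
        rw [hz]
        exact ⟨vge_zero hv _, vge_zero hv _⟩
      · exfalso
        obtain ⟨l, hl⟩ := exists_veq hv (mul_ne_zero hq0 (pow_ne_zero 2 h0))
        have h1 := val_two hv hdvd hπ hq hl
        have hp' : p = -(q * π ^ 2) := by linear_combination hz
        have h2 := hdvd p hp l (by rw [hp']; exact Veq.neg hv hl)
        omega
    · obtain ⟨l, hl⟩ := exists_veq hv hz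
      have h1 := hm.le_of_eq hl
      have h2 := inv1 hv hdvd hπ hp hq hl
      exact ⟨h2.1.mono h1, h2.2.1.mono (by omega)⟩
  rcases split_val hv h (fun m hm hm' => by
    have h1 := (inv1 hv hdvd hπ ha hb hm).2.2
    have h2 := (inv1 hv hdvd hπ hc hd (key hm')).2.2
    omega) with ⟨h1, h2⟩ | ⟨h1, h2⟩
  · have h3 : Vge v (c + d * π ^ 2) (n - 1) := by
      have := Vge.div hv h2 hπ
      rw [mul_div_cancel_right₀ _ h0] at this
      exact this.mono (by omega)
    have e1 := ge ha hb h1.ge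
    have e2 := ge hc hd h3
    exact ⟨e1.1, e1.2, e2.1, e2.2.mono (by omega)⟩
  · have e1 := ge ha hb h2
    have e2 := ge hc hd (key h1).ge
    exact ⟨e1.1.mono (by omega), e1.2.mono (by omega), e2.1, e2.2.mono (by omega)⟩

theorem inv3 {a b c d : M} (ha : a ∈ K') (hb : b ∈ K') (hc : c ∈ K') (hd : d ∈ K')
    (h : (a + b * π ^ 2) + (c + d * π ^ 2) * π = 0) : a = 0 ∧ b = 0 ∧ c = 0 ∧ d = 0 := by
  have h0 : π ≠ 0 := Veq.ne_zero hv hπ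
  have z : ∀ {p q : M}, p ∈ K' → q ∈ K' → p + q * π ^ 2 = 0 → p = 0 ∧ q = 0 := by
    intro p q hp hq hz
    rcases eq_or_ne q 0 with rfl | hq0
    · rw [zero_mul, add_zero] at hz
      exact ⟨hz, rfl⟩
    · exfalso
      obtain ⟨l, hl⟩ := exists_veq hv (mul_ne_zero hq0 (pow_ne_zero 2 h0))
      have h1 := val_two hv hdvd hπ hq hl
      have hp' : p = -(q * π ^ 2) := by linear_combination hz
      have h2 := hdvd p hp l (by rw [hp']; exact Veq.neg hv hl)
      omega
  rcases eq_or_ne (c + d * π ^ 2) 0 with hz | hz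
  · rw [hz, zero_mul, add_zero] at h
    have e1 := z ha hb h
    have e2 := z hc hd hz
    exact ⟨e1.1, e1.2, e2.1, e2.2⟩
  · exfalso
    obtain ⟨l, hl⟩ := exists_veq hv hz
    have h1 := (inv1 hv hdvd hπ hc hd hl).2.2
    have h2 : a + b * π ^ 2 = -((c + d * π ^ 2) * π) := by linear_combination h
    have h3 : Veq v (a + b * π ^ 2) (l + 1) := by
      rw [h2]; exact Veq.neg hv (Veq.mul hv hl hπ)
    have h4 := (inv1 hv hdvd hπ ha hb h3).2.2
    omega

omit hdvd in
theorem basis_four {u w : K} {x y : M} (hx : x ^ 2 = algebraMap K M u)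
    (hy : y ^ 2 = algebraMap K M w) (hadj : Algebra.adjoin K ({x, y} : Set M) = ⊤)
    (hdvd : ∀ a ∈ base K M, ∀ n : ℤ, Veq v a n → (4 : ℤ) ∣ n) (m : M) :
    ∃ a ∈ base K M, ∃ b ∈ base K M, ∃ c ∈ base K M, ∃ d ∈ base K M,
      m = (a + b * π ^ 2) + (c + d * π ^ 2) * π := by
  obtain ⟨g, hg, i, hi⟩ := dep_five hx hy hadj ![1, π, π ^ 2, π ^ 3, m]
  have hmem : ∀ i, algebraMap K M (g i) ∈ base K M := fun i => ⟨g i, rfl⟩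
  simp only [Fin.sum_univ_five, Algebra.smul_def] at hg
  have hg' : (algebraMap K M (g 0) + algebraMap K M (g 2) * π ^ 2)
      + (algebraMap K M (g 1) + algebraMap K M (g 3) * π ^ 2) * π
      = - (algebraMap K M (g 4) * m) := by
    have : algebraMap K M (g 0) * 1 + algebraMap K M (g 1) * π + algebraMap K M (g 2) * π ^ 2
      + algebraMap K M (g 3) * π ^ 3 + algebraMap K M (g 4) * m = 0 := hg
    linear_combination this
  have h4 : algebraMap K M (g 4) ≠ 0 := by
    intro h4
    rw [h4, zero_mul, neg_zero] at hg'
    obtain ⟨e0, e2, e1, e3⟩ := inv3 hv hdvd hπ (hmem _) (hmem _) (hmem _) (hmem _) hg'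
    apply hi
    apply (algebraMap K M).injective
    rw [map_zero]
    fin_cases i
    · exact e0
    · exact e1
    · exact e2
    · exact e3
    · exact h4
  have q : ∀ i, -(algebraMap K M (g i)) / algebraMap K M (g 4) ∈ base K M := fun i =>
    (base K M).div_mem ((base K M).neg_mem (hmem i)) (hmem 4)
  refine ⟨_, q 0, _, q 2, _, q 1, _, q 3, ?_⟩
  have h5 : m = -((algebraMap K M (g 0) + algebraMap K M (g 2) * π ^ 2)
      + (algebraMap K M (g 1) + algebraMap K M (g 3) * π ^ 2) * π) / algebraMap K M (g 4) := by
    rw [hg', neg_neg, mul_div_cancel_left₀ _ h4]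
  rw [h5]
  ring

omit hdvd in
theorem val_inv {u w : K} {x y : M} (hx : x ^ 2 = algebraMap K M u)
    (hy : y ^ 2 = algebraMap K M w) (hadj : Algebra.adjoin K ({x, y} : Set M) = ⊤)
    (hdvd : ∀ a ∈ base K M, ∀ n : ℤ, Veq v a n → (4 : ℤ) ∣ n) (s : M ≃ₐ[K] M) (hs : s * s = 1)
    (m : M) : v (s m) = v m := by
  have h0 : π ≠ 0 := Veq.ne_zero hv hπ
  have hfix : ∀ a ∈ base K M, s a = a := by
    rintro _ ⟨a, rfl⟩
    exact s.commutes a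
  have hsp : Veq v (s π) 1 := by
    obtain ⟨a, ha, b, hb, c, hc, d, hd, h⟩ := basis_four hv hπ hx hy hadj hdvd (π ^ 4)
    have hp4 := Veq.npow hv hπ 4
    have := inv2 hv hdvd hπ ha hb hc hd (n := 4) (by rw [← h]; exact hp4.congr (by norm_num))
    obtain ⟨va, vb, vc, vd⟩ := this
    have up : ∀ {z : M} {n : ℤ}, z ∈ base K M → Vge v z n → 0 < n → Vge v z 4 := by
      intro z n hz hn hpos
      rcases eq_or_ne z 0 with rfl | hz0
      · exact vge_zero hv _
      · obtain ⟨l, hl⟩ := exists_veq hv hz0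
        have h1 := hdvd z hz l hl
        have h2 := hn.le_of_eq hl
        exact hl.mono (by omega)
    have vb := up hb vb (by norm_num)
    have vc := up hc vc (by norm_num)
    have vd := up hd vd (by norm_num)
    have va' : Veq v a 4 := by
      have e1 : a = π ^ 4 - (b * π ^ 2 + (c * π + d * π ^ 3)) := by linear_combination -h
      rw [e1]
      refine Veq.sub hv (n := 5) (hp4.congr (by norm_num)) ?_ (by norm_num)
      refine Vge.add hv ((Vge.mul hv vb (Veq.sq hv hπ).ge).mono (by norm_num)) (Vge.add hv
        ((Vge.mul hv vc hπ.ge).mono (by norm_num))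
        ((Vge.mul hv vd (Veq.npow hv hπ 3).ge).mono (by norm_num)))
    have h' : (s π) ^ 4 = (a + b * (s π) ^ 2) + (c + d * (s π) ^ 2) * s π := by
      have := congrArg s h
      simpa only [map_add, map_mul, map_pow, hfix a ha, hfix b hb, hfix c hc, hfix d hd] using this
    have hs0 : s π ≠ 0 := by
      intro h1
      exact h0 (s.injective (by rw [h1, map_zero]))
    obtain ⟨q, hq⟩ := exists_veq hv hs0
    refine hq.congr ?_
    have q2 := Veq.npow hv hq 2
    have q3 := Veq.npow hv hq 3
    have q4 := Veq.npow hv hq 4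
    push_cast at q2 q3 q4
    have t1 := Vge.mul hv vb q2.ge
    have t2 := Vge.mul hv vc hq.ge
    have t3 := Vge.mul hv vd q3.ge
    by_contra hne
    rcases lt_or_ge q 1 with hlt | hge
    · have e1 : (s π) ^ 4 = a + (b * (s π) ^ 2 + (c * s π + d * (s π) ^ 3)) := by
        linear_combination h'
      have e2 : Vge v ((s π) ^ 4) (4 * q + 1) := by
        rw [e1]
        exact Vge.add hv (va.mono (by omega)) (Vge.add hv (t1.mono (by omega))
          (Vge.add hv (t2.mono (by omega)) (t3.mono (by omega))))
      have := e2.le_of_eq q4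
      omega
    · have e1 : a = (s π) ^ 4 - (b * (s π) ^ 2 + (c * s π + d * (s π) ^ 3)) := by
        linear_combination -h'
      have e2 : Vge v a 5 := by
        rw [e1]
        exact Vge.sub hv (q4.mono (by omega)) (Vge.add hv (t1.mono (by omega))
          (Vge.add hv (t2.mono (by omega)) (t3.mono (by omega))))
      have := e2.le_of_eq va'
      omega
  have key : ∀ m, v m ≤ v (s m) := by
    intro m
    rcases eq_or_ne m 0 with rfl | hm0
    · rw [map_zero]
    obtain ⟨n, hn⟩ := exists_veq hv hm0
    obtain ⟨a, ha, b, hb, c, hc, d, hd, h⟩ := basis_four hv hπ hx hy hadj hdvd m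
    obtain ⟨va, vb, vc, vd⟩ := inv2 hv hdvd hπ ha hb hc hd (n := n) (by rw [← h]; exact hn)
    rw [show v m = (n : WithTop ℤ) from hn]
    change Vge v (s m) n
    rw [h]
    simp only [map_add, map_mul, map_pow, hfix a ha, hfix b hb, hfix c hc, hfix d hd]
    have t3 : Vge v (c + d * (s π) ^ 2) (n - 1) :=
      Vge.add hv vc ((Vge.mul hv vd (Veq.sq hv hsp).ge).mono (by omega))
    exact Vge.add hv (Vge.add hv va ((Vge.mul hv vb (Veq.sq hv hsp).ge).mono (by omega)))
      ((Vge.mul hv t3 hsp.ge).mono (by omega))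
  refine le_antisymm ?_ (key m)
  have h1 := key (s m)
  have h2 : s (s m) = m := by
    have := DFunLike.congr_fun hs m
    simpa using this
  rwa [h2] at h1

end invariance
end UTB
namespace UTB
section final
variable {M : Type*} [Field M] {v : M → WithTop ℤ}

theorem Ram.final (hv : DiscreteVal M v) {K' : Subfield M} {σ τ : M ≃+* M} {π : M}
    {b₁ b₂ e : ℤ} (R : Ram v K' σ τ π b₂ b₁ e) (hb : b₁ < b₂) (hbe : b₁ + b₂ < 2 * e)
    {i : M} (hiK : i ∈ K') (hi : i ^ 2 = -1) {X Y η k q α : M} (hX0 : X ≠ 0) (hY0 : Y ≠ 0)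
    (hσX : σ X = X) (hσY : σ Y = -Y) (hτX : τ X = -X) (hτY : τ Y = Y)
    (hση : σ η = η) (hη : η * τ η = Y ^ 2) (hk : k ∈ K') (hk0 : k ≠ 0) (hq0 : q ≠ 0)
    (hα : α = k * (X * Y) * η * q ^ 2) {d : ℤ} (hd : HasQuadDefect v α (d : WithTop ℤ)) :
    Concl e b₁ b₂ d := by
  have hb0 := R.symm.s_pos hv
  have hb2 := R.s_pos hv
  have he := R.epos
  have hodd := R.symm.s_odd hv (by omega)
  have hBL := (R.breakE hv (by omega) (by omega) (by omega)).congr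
    (show _ = 2 * b₁ by omega)
  have hBE := (R.symm.breakE hv (by omega) (by omega) (by omega)).congr
    (show _ = b₁ + b₂ by omega)
  obtain ⟨C₁, hC₁, hC₁0, hw₁v, -⟩ := R.normalize hv hBL (by omega) (by omega) hX0 hσX hτX
  obtain ⟨C₂, hC₂, hC₂0, hw₂v, hmod⟩ :=
    R.symm.normalize hv hBE (by omega) (by omega) hY0 hτY hσY
  have hC₁f := (R.mem _).1 hC₁
  have hC₂f := (R.mem _).1 hC₂
  have hif := (R.mem _).1 hiK
  have hi0 : i ≠ 0 := by
    rintro rfl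
    have h1 : (1 : M) ≠ 0 := one_ne_zero
    apply h1
    linear_combination hi
  have hw₁ : (C₁ * X) ^ 2 - 1 ∈ K' := by
    rw [R.mem]
    simp only [map_sub, map_pow, map_mul, map_one, hC₁f.1, hC₁f.2, hσX, hτX]
    exact ⟨trivial, by ring⟩
  have hw₂ : (C₂ * Y) ^ 2 - 1 ∈ K' := by
    rw [R.mem]
    simp only [map_sub, map_pow, map_mul, map_one, hC₂f.1, hC₂f.2, hσY, hτY]
    exact ⟨by ring, trivial⟩
  have hw : Vge v (((C₁ * X) ^ 2 - 1) + ((C₂ * Y) ^ 2 - 1)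
      + ((C₁ * X) ^ 2 - 1) * ((C₂ * Y) ^ 2 - 1)) (8 * e - 2 * b₁ - 2 * b₂) :=
    Vge.add hv (Vge.add hv (hw₁v.mono (by omega)) (hw₂v.mono (by omega)))
      ((Veq.mul hv hw₁v hw₂v).mono (by omega))
  obtain ⟨κ, hκ, hκ0, C, hC0, δ, hδ, hδv, hηe⟩ := R.eta_norm hv hBL
    (η := i * (C₁ * X) * (C₂ * η))
    (by simp only [map_mul, hif.1, hC₁f.1, hC₂f.1, hσX, hση])
    (by
      simp only [map_mul, hif.2, hC₁f.2, hC₂f.2, hτX]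
      have : i * (C₁ * X) * (C₂ * η) * (i * (C₁ * -X) * (C₂ * τ η))
        = -(i ^ 2) * (C₁ * X) ^ 2 * C₂ ^ 2 * (η * τ η) := by ring
      rw [this, hη, hi]
      ring) hw
  obtain ⟨C', n, hC', hn0, hn, hnodd, hcon⟩ := core hv R.good (R.goodE hv) (R.symm.goodE hv)
    (R.le_fix hv) (R.symm.le_fix hv) R.two hiK hi hb0 hb hbe hodd (by omega)
    (z₁ := C₁ * X - 1) (z₂ := C₂ * Y - 1) (w₁ := (C₁ * X) ^ 2 - 1) (w₂ := (C₂ * Y) ^ 2 - 1)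
    (δ := δ) (k := k * κ / (i * C₁ * C₂ ^ 2))
    (by ring) (by ring) hw₁ hw₂
    (mem_fix.2 (by simp only [map_sub, map_mul, map_one, hC₁f.1, hσX]))
    (mem_fix.2 (by simp only [map_sub, map_mul, map_one, hC₂f.2, hτY]))
    (hw₁v.congr (by ring)) (hw₂v.congr (by ring)) (mem_fix.2 hδ) (hδv.mono (by omega))
    (K'.div_mem (K'.mul_mem hk hκ) (K'.mul_mem (K'.mul_mem hiK hC₁) (K'.pow_mem hC₂ 2)))
    (div_ne_zero (mul_ne_zero hk0 hκ0)
      (mul_ne_zero (mul_ne_zero hi0 hC₁0) (pow_ne_zero 2 hC₂0)))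
  have heq : (C' / (C * q)) ^ 2 * α =
      C' ^ 2 * (k * κ / (i * C₁ * C₂ ^ 2) * (1 + (C₂ * Y - 1)) * (1 + δ)) := by
    have h1 : k * κ / (i * C₁ * C₂ ^ 2) * (1 + (C₂ * Y - 1)) * (1 + δ)
        = k * Y / (i * C₁ * C₂) / C ^ 2 * (κ * C ^ 2 * (1 + δ)) := by
      field_simp
      ring
    rw [h1, ← hηe, hα]
    field_simp
  rw [← heq] at hC'
  have := defect_eq hv R.two hC' hn0 (by omega) hnodd hd
  rw [this]
  exact hcon

theorem swap_form {K' : Subfield M} (h2 : (2 : M) ≠ 0) {p q : M ≃+* M} {x y H : M}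
    (hpp : ∀ a, p (p a) = a) (hpq : ∀ a, p (q a) = q (p a))
    (hmem : ∀ a, p a = a → q a = a → a ∈ K') (hx0 : x ≠ 0) (hy0 : y ≠ 0)
    (hpx : p x = -x) (hpy : p y = y) (hqx : q x = x) (hqy : q y = -y)
    (hqH : q H = H) (hH : H * p H = y ^ 2) :
    ∃ b ∈ K', b ≠ 0 ∧ ∃ η c, c ≠ 0 ∧ p η = η ∧ η * q η = x ^ 2 ∧ H = b * η * c ^ 2 := by
  have hH0 : H ≠ 0 := by
    rintro rfl
    rw [zero_mul] at hH
    exact pow_ne_zero 2 hy0 hH.symm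
  have hne : ∀ c : M, c = y ∨ c = -y → H ≠ c := by
    intro c hc he
    have h3 : y = -y := by
      rcases hc with rfl | rfl
      · rw [← he] at hqy
        rw [← he, ← hqy, hqH]
      · rw [he, map_neg, hqy, neg_neg] at hqH
        exact hqH
    have h4 : 2 * y = 0 := by linear_combination h3
    rcases mul_eq_zero.1 h4 with h | h
    · exact h2 h
    · exact hy0 h
  have hpH : p H = y ^ 2 / H := by
    rw [← hH]; field_simp
  have hs : y + H ≠ 0 := fun h => hne (-y) (Or.inr rfl) (by linear_combination h)
  have hd : y ^ 2 - H ^ 2 ≠ 0 := by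
    intro h
    have h5 : (y - H) * (y + H) = 0 := by linear_combination h
    rcases mul_eq_zero.1 h5 with h | h
    · exact hne y (Or.inl rfl) (by linear_combination -h)
    · exact hs h
  set b' := (p H - H) / x with hb'
  have hb'e : b' = (y ^ 2 - H ^ 2) / (H * x) := by
    rw [hb', hpH]; field_simp
  have hb'p : p b' = b' := by
    rw [hb', map_div₀, map_sub, hpp, hpx]
    field_simp
    ring
  have hb'q : q b' = b' := by
    rw [hb', map_div₀, map_sub, ← hpq, hqH, hqx]
  have hb'K : b' ∈ K' := hmem _ hb'p hb'q
  have hb'0 : b' ≠ 0 := by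
    rw [hb'e]; exact div_ne_zero hd (mul_ne_zero hH0 hx0)
  have hy2 : y ^ 2 ∈ K' := hmem _ (by rw [map_pow, hpy]) (by rw [map_pow, hqy]; ring)
  refine ⟨y ^ 2 / b', K'.div_mem hy2 hb'K, div_ne_zero (pow_ne_zero 2 hy0) hb'0,
    (y + H) ^ 2 / (H * b'), (y + H) / y / ((y + H) ^ 2 / (H * b')), ?_, ?_, ?_, ?_⟩
  · exact div_ne_zero (div_ne_zero hs hy0)
      (div_ne_zero (pow_ne_zero 2 hs) (mul_ne_zero hH0 hb'0))
  · rw [map_div₀, map_pow, map_mul, map_add, hpy, hb'p, hpH]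
    field_simp
    ring
  · rw [map_div₀, map_pow, map_mul, map_add, hqy, hb'q, hqH, hb'e]
    field_simp
    ring
  · field_simp

end final
end UTB
namespace UTB
section signs
variable {K M : Type*} [Field K] [Field M] [Algebra K M]

theorem sign_cases {u : K} {x : M} (hx : x ^ 2 = algebraMap K M u) (s : M ≃ₐ[K] M) :
    s x = x ∨ s x = -x := by
  have h : (s x) ^ 2 = x ^ 2 := by rw [← map_pow, hx, s.commutes]
  exact sq_eq_sq_iff_eq_or_eq_neg.1 h

theorem exists_sign {u v : K} {x y : M} (hx : x ^ 2 = algebraMap K M u)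
    (hy : y ^ 2 = algebraMap K M v) (hadj : Algebra.adjoin K ({x, y} : Set M) = ⊤)
    (hcard : Nat.card (M ≃ₐ[K] M) = 4) :
    (∃ s : M ≃ₐ[K] M, s x ≠ x ∧ s y = y) ∧ (∃ s : M ≃ₐ[K] M, s x = x ∧ s y ≠ y) := by
  classical
  haveI : Finite (M ≃ₐ[K] M) := Nat.finite_of_card_ne_zero (by rw [hcard]; norm_num)
  let f : (M ≃ₐ[K] M) → Prop × Prop := fun s => (s x = x, s y = y)
  have hinj : Function.Injective f := by
    intro s t h
    have h1 : (s x = x) = (t x = x) := congrArg Prod.fst h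
    have h2 : (s y = y) = (t y = y) := congrArg Prod.snd h
    have e1 : s x = t x := by
      rcases sign_cases hx s with hs | hs
      · rw [hs, h1.mp hs]
      · rcases sign_cases hx t with ht | ht
        · rw [h1.mpr ht, ht]
        · rw [hs, ht]
    have e2 : s y = t y := by
      rcases sign_cases hy s with hs | hs
      · rw [hs, h2.mp hs]
      · rcases sign_cases hy t with ht | ht
        · rw [h2.mpr ht, ht]
        · rw [hs, ht]
    ext m
    obtain ⟨a, b, c, d, rfl⟩ := span_four hx hy hadj m
    simp only [map_add, map_mul, AlgEquiv.commutes, e1, e2]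
  have hbij : Function.Bijective f := by
    rw [Nat.bijective_iff_injective_and_card]
    refine ⟨hinj, ?_⟩
    rw [hcard]
    simp
  constructor
  · obtain ⟨s, hs⟩ := hbij.2 (False, True)
    have h1 : (s x = x) = False := congrArg Prod.fst hs
    have h2 : (s y = y) = True := congrArg Prod.snd hs
    exact ⟨s, h1.mp, h2.mpr trivial⟩
  · obtain ⟨s, hs⟩ := hbij.2 (True, False)
    have h1 : (s x = x) = True := congrArg Prod.fst hs
    have h2 : (s y = y) = False := congrArg Prod.snd hs
    exact ⟨s, h1.mpr trivial, h2.mp⟩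

theorem mem_base {u v : K} {x y : M} (hx : x ^ 2 = algebraMap K M u)
    (hy : y ^ 2 = algebraMap K M v) (hadj : Algebra.adjoin K ({x, y} : Set M) = ⊤)
    (h2 : (2 : M) ≠ 0) {p q : M ≃ₐ[K] M} (hpx : p x = -x) (hpy : p y = y) (hqx : q x = x)
    (hqy : q y = -y) {a : M} (hp : p a = a) (hq : q a = a) : a ∈ base K M := by
  obtain ⟨a, b, c, d, rfl⟩ := span_four hx hy hadj a
  simp only [map_add, map_mul, AlgEquiv.commutes, hpx, hpy, hqx, hqy] at hp hq
  have e1 : algebraMap K M b * x + algebraMap K M d * (x * y) = 0 := by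
    apply mul_left_cancel₀ h2
    linear_combination -hp
  have e2 : algebraMap K M c * y + algebraMap K M d * (x * y) = 0 := by
    apply mul_left_cancel₀ h2
    linear_combination -hq
  have e3 : algebraMap K M b * x - algebraMap K M c * y = 0 := by linear_combination e1 - e2
  have e4 := congrArg p e3
  simp only [map_sub, map_mul, map_zero, AlgEquiv.commutes, hpx, hpy] at e4
  have e5 : algebraMap K M b * x = 0 := by
    apply mul_left_cancel₀ h2
    linear_combination e3 - e4
  refine ⟨a, ?_⟩
  linear_combination -e5 - e2

end signs
end UTB

/-- Unstable two-break case (Lemma 4.2): `K` contains `i = √-1`, `M = K(√u, √v)` is a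
fully ramified biquadratic extension with two breaks `b₁ < b₂` satisfying
`b₁ + b₂ < 2 e_K`, contained in a quaternion extension `N = M(√α_k)` with
`α_k = k·√(uv)·η` where `N_{K(√u)/K}(η) = v`.  Then `def_M(α_k)` equals `b₂ + 2b₁`, or
`8 e_K - 3 b₂ - 2 b₁`, or lies strictly between these with
`def_M(α_k) ≡ -b₂ (mod 8)`. -/
theorem unstable_two_break_defect
    (K : Type*) [Field K] [Algebra ℚ_[2] K] [FiniteDimensional ℚ_[2] K]
    (vK : K → WithTop ℤ) (hvK : DiscreteVal K vK)
    (eK : ℤ) (he : vK 2 = (eK : WithTop ℤ))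
    (hi : ∃ i : K, i ^ 2 = -1)
    (M : Type*) [Field M] [Algebra K M]
    (vM : M → WithTop ℤ) (hvM : DiscreteVal M vM)
    (hram : ∀ a : K, vM (algebraMap K M a) = 4 • vK a)
    (hbiquad : Nat.card (M ≃ₐ[K] M) = 4)
    (hexp2 : ∀ s : M ≃ₐ[K] M, s * s = 1)
    (u v : K) (x y : M) (hx : x ^ 2 = algebraMap K M u) (hy : y ^ 2 = algebraMap K M v)
    (hadj : Algebra.adjoin K ({x, y} : Set M) = ⊤)
    (πM : M) (hπM : vM πM = 1)
    (b₁ b₂ : ℤ) (hb : b₁ < b₂) (hunstable : b₁ + b₂ < 2 * eK)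
    (σ₀ : M ≃ₐ[K] M) (hσ₀ : σ₀ ≠ 1)
    (hbreak₂ : vM (σ₀ πM - πM) = ((b₂ + 1 : ℤ) : WithTop ℤ))
    (hbreak₁ : ∀ s : M ≃ₐ[K] M, s ≠ 1 → s ≠ σ₀ →
      vM (s πM - πM) = ((b₁ + 1 : ℤ) : WithTop ℤ))
    -- Lu = K(√u) and the element η of norm v
    (Lu : Type*) [Field Lu] [Algebra K Lu] [Algebra Lu M] [IsScalarTower K Lu M]
    (xu : Lu) (hxu : algebraMap Lu M xu = x)
    (hLuadj : Algebra.adjoin K ({xu} : Set Lu) = ⊤)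
    (su : Lu ≃ₐ[K] Lu) (hsu : su xu = -xu)
    (η : Lu) (hη : η * su η = algebraMap K Lu v)
    -- the element α = α_k (here √-1 ∈ K, so no τ term)
    (k : K) (hk : k ≠ 0) (α : M)
    (hα : α = algebraMap K M k * (x * y) * algebraMap Lu M η) :
    ∀ d : ℤ, HasQuadDefect vM α (d : WithTop ℤ) →
      (d = b₂ + 2 * b₁ ∨ d = 8 * eK - 3 * b₂ - 2 * b₁ ∨
        (b₂ + 2 * b₁ < d ∧ d < 8 * eK - 3 * b₂ - 2 * b₁ ∧ Int.ModEq 8 d (-b₂))) := by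
  classical
  intro d hd
  obtain ⟨i, hi⟩ := hi
  -- valuation facts
  have hup : ∀ (a : K) (n : ℤ), UTB.Veq vK a n → UTB.Veq vM (algebraMap K M a) (4 * n) := by
    intro a n h
    unfold UTB.Veq at *
    rw [hram, h]
    exact_mod_cast (by simp : (4 : ℕ) • n = 4 * n)
  have htwo : UTB.Veq vM (2 : M) (4 * eK) := by
    have := hup 2 eK he
    rwa [map_ofNat] at this
  have h20 : (2 : M) ≠ 0 := UTB.Veq.ne_zero hvM htwo
  have hdvd : ∀ a ∈ UTB.base K M, ∀ n : ℤ, UTB.Veq vM a n → (4 : ℤ) ∣ n := by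
    rintro _ ⟨a, rfl⟩ n hn
    have ha : a ≠ 0 := by
      rintro rfl
      rw [map_zero] at hn
      exact UTB.Veq.ne_zero hvM hn rfl
    obtain ⟨m, hm⟩ := UTB.exists_veq hvK ha
    exact ⟨m, hn.unique (hup a m hm)⟩
  have hπ : UTB.Veq vM πM 1 := hπM
  have hinv : ∀ (s : M ≃ₐ[K] M) (a : M), vM (s a) = vM a := fun s a =>
    UTB.val_inv hvM hπ hx hy hadj hdvd s (hexp2 s) a
  have hsq : ∀ (s : M ≃ₐ[K] M) (a : M), s (s a) = a := by
    intro s a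
    have := DFunLike.congr_fun (hexp2 s) a
    simpa using this
  have hcomm : ∀ (s t : M ≃ₐ[K] M) (a : M), s (t a) = t (s a) := by
    intro s t a
    have h1 : t (s (s (t a))) = a := by rw [hsq, hsq]
    have h2 : (t * s) ((t * s) (s (t a))) = s (t a) := hsq (t * s) _
    simp only [AlgEquiv.mul_apply] at h2
    rw [h1] at h2
    exact h2.symm
  have hbase : ∀ (s : M ≃ₐ[K] M), ∀ a ∈ UTB.base K M, s a = a := by
    rintro s _ ⟨a, rfl⟩
    exact s.commutes a
  -- signs
  obtain ⟨⟨p, hpx, hpy⟩, ⟨q, hqx, hqy⟩⟩ := UTB.exists_sign hx hy hadj hbiquad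
  have hx0 : x ≠ 0 := by rintro rfl; exact hpx (map_zero _)
  have hy0 : y ≠ 0 := by rintro rfl; exact hqy (map_zero _)
  replace hpx := (UTB.sign_cases hx p).resolve_left hpx
  replace hqy := (UTB.sign_cases hy q).resolve_left hqy
  have hneg : ∀ z : M, z ≠ 0 → z ≠ -z := by
    intro z hz h
    have h4 : 2 * z = 0 := by linear_combination h
    rcases mul_eq_zero.1 h4 with h | h
    · exact h20 h
    · exact hz h
  have hmem : ∀ a, p a = a → q a = a → a ∈ UTB.base K M := fun a h1 h2 =>
    UTB.mem_base hx hy hadj h20 hpx hpy hqx hqy h1 h2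
  have hiM : algebraMap K M i ∈ UTB.base K M := ⟨i, rfl⟩
  have hi2 : (algebraMap K M i) ^ 2 = -1 := by rw [← map_pow, hi, map_neg, map_one]
  have hkM : algebraMap K M k ∈ UTB.base K M := ⟨k, rfl⟩
  have hk0 : algebraMap K M k ≠ 0 := by
    rw [Ne, map_eq_zero]; exact hk
  have hi0 : algebraMap K M i ≠ 0 := by
    intro h
    rw [h] at hi2
    exact one_ne_zero (α := M) (by linear_combination hi2)
  -- the element η
  set H : M := algebraMap Lu M η with hHdef
  have hHneg : ∀ g : M ≃ₐ[K] M, g x = -x → H * g H = y ^ 2 := by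
    intro g hg
    have hext : (g : M →ₐ[K] M).comp (IsScalarTower.toAlgHom K Lu M)
        = (IsScalarTower.toAlgHom K Lu M).comp (su : Lu →ₐ[K] Lu) := by
      refine AlgHom.ext_of_adjoin_eq_top hLuadj ?_
      intro z hz
      rw [Set.mem_singleton_iff] at hz
      subst hz
      simp [hsu, hxu, hg]
    have h1 : g H = algebraMap Lu M (su η) := DFunLike.congr_fun hext η
    rw [h1, hHdef, ← map_mul, hη, hy, ← IsScalarTower.algebraMap_apply]
  have hHpos : ∀ g : M ≃ₐ[K] M, g x = x → g H = H := by
    intro g hg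
    have hext : (g : M →ₐ[K] M).comp (IsScalarTower.toAlgHom K Lu M)
        = IsScalarTower.toAlgHom K Lu M := by
      refine AlgHom.ext_of_adjoin_eq_top hLuadj ?_
      intro z hz
      rw [Set.mem_singleton_iff] at hz
      subst hz
      simp [hxu, hg]
    exact DFunLike.congr_fun hext η
  -- ramification data
  have hram' : ∀ τ : M ≃ₐ[K] M, τ ≠ 1 → τ ≠ σ₀ →
      (∀ a, σ₀ a = a → τ a = a → a ∈ UTB.base K M) →
      UTB.Ram vM (UTB.base K M) σ₀.toRingEquiv τ.toRingEquiv πM b₂ b₁ eK := by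
    intro τ h1 h2 h3
    have hs : UTB.Veq vM (σ₀ πM - πM) (b₂ + 1) := hbreak₂
    have ht : UTB.Veq vM (τ πM - πM) (b₁ + 1) := hbreak₁ τ h1 h2
    have hpos : ∀ (s : M ≃ₐ[K] M) (n : ℤ), UTB.Veq vM (s πM - πM) (n + 1) → 0 ≤ n := by
      intro s n hn
      have h4 : UTB.Veq vM (s πM) 1 := by
        unfold UTB.Veq; rw [hinv]; exact hπM
      have := (UTB.Vge.sub hvM h4.ge hπ.ge).le_of_eq hn
      omega
    have hb1 := hpos _ _ ht
    have hb2 := hpos _ _ hs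
    have he0 : 0 < eK := by omega
    have hK2 : UTB.Veq vK 2 eK := he
    exact
      { ss := hsq σ₀
        tt := hsq τ
        comm := hcomm σ₀ τ
        vs := hinv σ₀
        vt := hinv τ
        mem := fun a => ⟨fun h => ⟨hbase _ a h, hbase _ a h⟩, fun h => h3 a h.1 h.2⟩
        good := UTB.good_base hvK hvM hram (hK2.mono (by omega))
        pi := hπ
        bs := hs
        bt := ht
        two := htwo
        epos := he0 }
  have hne1 : ∀ (s : M ≃ₐ[K] M) (z : M), z ≠ 0 → s z = -z → s ≠ 1 := by
    rintro s z hz h rfl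
    exact hneg z hz h
  have hneσ : ∀ (s t : M ≃ₐ[K] M) (z : M), z ≠ 0 → s z = -z → t z = z → s ≠ t := by
    rintro s t z hz h h' rfl
    exact hneg z hz (h'.symm.trans h)
  have hq1 : q ≠ 1 := hne1 q y hy0 hqy
  have hp1 : p ≠ 1 := hne1 p x hx0 hpx
  have hxy0 : x * y ≠ 0 := mul_ne_zero hx0 hy0
  rcases UTB.sign_cases hx σ₀ with hsx | hsx <;> rcases UTB.sign_cases hy σ₀ with hsy | hsy
  · exfalso
    apply hσ₀
    ext m
    obtain ⟨a, b, c, e, rfl⟩ := UTB.span_four hx hy hadj m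
    simp only [map_add, map_mul, AlgEquiv.commutes, hsx, hsy, AlgEquiv.one_apply]
  · have R := hram' p hp1 (hneσ _ _ x hx0 hpx hsx)
      (fun a h1 h2 => UTB.mem_base hx hy hadj h20 hpx hpy hsx hsy h2 h1)
    exact R.final hvM hb hunstable hiM hi2 hx0 hy0 hsx hsy hpx hpy (hHpos σ₀ hsx)
      (hHneg p hpx) hkM hk0 one_ne_zero (by rw [hα]; ring) hd
  · have hm : ∀ a, σ₀ a = a → q a = a → a ∈ UTB.base K M :=
      fun a h1 h2 => UTB.mem_base hx hy hadj h20 hsx hsy hqx hqy h1 h2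
    have R := hram' q hq1 (hneσ _ _ y hy0 hqy hsy) hm
    obtain ⟨b, hbK, hb0, η', c, hc0, h1, h2, h3⟩ := UTB.swap_form (K' := UTB.base K M) h20
      (p := σ₀.toRingEquiv) (q := q.toRingEquiv) (H := H) (hsq σ₀) (hcomm σ₀ q) hm hx0 hy0
      hsx hsy hqx hqy (hHpos q hqx) (hHneg σ₀ hsx)
    exact R.final hvM hb hunstable hiM hi2 hy0 hx0 hsy hsx hqy hqx h1 h2
      (Subfield.mul_mem _ hkM hbK) (mul_ne_zero hk0 hb0) hc0 (by rw [hα, h3]; ring) hd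
  · have hm : ∀ a, σ₀ a = a → q a = a → a ∈ UTB.base K M := by
      intro a h1 h2
      refine UTB.mem_base hx hy hadj h20 (p := σ₀ * q) (q := q) ?_ ?_ hqx hqy ?_ h2
      · rw [AlgEquiv.mul_apply, hqx, hsx]
      · rw [AlgEquiv.mul_apply, hqy, map_neg, hsy, neg_neg]
      · rw [AlgEquiv.mul_apply, h2, h1]
    have hsxy : σ₀ (x * y) = x * y := by rw [map_mul, hsx, hsy]; ring
    have hqxy : q (x * y) = -(x * y) := by rw [map_mul, hqx, hqy]; ring
    have R := hram' q hq1 (hneσ _ _ (x * y) hxy0 hqxy hsxy) hm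
    obtain ⟨b, hbK, hb0, η', c, hc0, h1, h2, h3⟩ := UTB.swap_form (K' := UTB.base K M) h20
      (p := σ₀.toRingEquiv) (q := q.toRingEquiv) (x := x) (y := x * y)
      (H := algebraMap K M i * x * H)
      (hsq σ₀) (hcomm σ₀ q) hm hx0 hxy0 hsx hsxy hqx hqxy
      (by
        change q (algebraMap K M i * x * H) = _
        rw [map_mul, map_mul, hqx, AlgEquiv.commutes, hHpos q hqx])
      (by
        change _ * σ₀ (algebraMap K M i * x * H) = _
        rw [map_mul, map_mul, hsx, AlgEquiv.commutes, mul_pow, ← hHneg σ₀ hsx]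
        linear_combination -(x ^ 2 * (H * σ₀ H)) * hi2)
    have hx2 : x ^ 2 ∈ UTB.base K M := ⟨u, hx.symm⟩
    refine R.final hvM hb hunstable hiM hi2 hxy0 hx0 hsxy hsx hqxy hqx h1 h2
      (k := algebraMap K M k * b / (algebraMap K M i * x ^ 2))
      (Subfield.div_mem _ (Subfield.mul_mem _ hkM hbK) (Subfield.mul_mem _ hiM hx2))
      (div_ne_zero (mul_ne_zero hk0 hb0) (mul_ne_zero hi0 (pow_ne_zero 2 hx0))) hc0 ?_ hd
    have h4 : H = b * η' * c ^ 2 / (algebraMap K M i * x) := by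
      rw [← h3]; field_simp
    rw [hα, h4]
    field_simp
end

section
/- Let K be a 2-adic field containing i = √−1 and t an odd integer with 0 < t < e_K. For cyclic degree-4 extensions K(√k·⁴√w)/K containing a fixed ramified quadratic K(√w)/K with break t, the second ramification break b₂ takes exactly the values: b₂ = 3t, b₂ = 4e_K − t, or b₂ = t + 4m with 3t < t + 4m < 4e_K − t (equivalently b₂ ≡ −t mod 4 strictly between 3t and 4e_K − t). -/
/-- A cyclic degree-4 extension `E = K(√k·⁴√w)` of `K` containing `K(√w)`, with its
normalized valuation (for a fully ramified extension), a generator `g` of its Galois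
group, and a uniformizer. -/
structure CyclicQuarticExt (K : Type) [Field K] (vK : K → WithTop ℤ) (w k : K) where
  E : Type
  [fieldE : Field E]
  [algE : Algebra K E]
  hdeg : Module.finrank K E = 4
  y : E
  hy : y ^ 4 = algebraMap K E (k ^ 2 * w)
  hadj : Algebra.adjoin K ({y} : Set E) = ⊤
  g : E ≃ₐ[K] E
  hord : orderOf g = 4
  vE : E → WithTop ℤ
  hvE : DiscreteVal E vE
  hram : ∀ a : K, vE (algebraMap K E a) = 4 • vK a
  πE : E
  hπE : vE πE = 1

attribute [instance] CyclicQuarticExt.fieldE CyclicQuarticExt.algE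

/-- The second (largest) lower ramification break of the cyclic quartic extension:
`b₂` with `v_E (g² π_E - π_E) = b₂ + 1`. -/
def CyclicQuarticExt.SecondBreakIs {K : Type} [Field K] {vK : K → WithTop ℤ} {w k : K}
    (Q : CyclicQuarticExt K vK w k) (b₂ : ℤ) : Prop :=
  Q.vE (Q.g (Q.g Q.πE) - Q.πE) = ((b₂ + 1 : ℤ) : WithTop ℤ)


set_option linter.unusedSectionVars false
set_option linter.unusedVariables false

namespace Wy

/-- `v x ≥ n`. -/
def VGe {F : Type*} (v : F → WithTop ℤ) (n : ℤ) (x : F) : Prop := ((n : ℤ) : WithTop ℤ) ≤ v x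
/-- `v x = n`. -/
def VEq {F : Type*} (v : F → WithTop ℤ) (n : ℤ) (x : F) : Prop := v x = ((n : ℤ) : WithTop ℤ)

section basics
variable {F : Type*} [Field F] {v : F → WithTop ℤ}

theorem VEq.ge {n m : ℤ} {x : F} (h : VEq v n x) (hm : m ≤ n) : VGe v m x := by
  unfold VEq at h; unfold VGe; rw [h]; exact_mod_cast hm

theorem VGe.mono {n m : ℤ} {x : F} (h : VGe v n x) (hm : m ≤ n) : VGe v m x :=
  le_trans (by exact_mod_cast hm) h

theorem VEq.cast {n m : ℤ} {x : F} (h : VEq v n x) (hm : n = m) : VEq v m x := hm ▸ h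

theorem VEq.congr {n m : ℤ} {x y : F} (h : VEq v n x) (hx : x = y) (hm : n = m) : VEq v m y :=
  hx ▸ hm ▸ h

theorem VGe.congr {n m : ℤ} {x y : F} (h : VGe v n x) (hx : x = y) (hm : m ≤ n) : VGe v m y :=
  hx ▸ h.mono hm

theorem VEq.inj {n m : ℤ} {x : F} (h : VEq v n x) (h' : VEq v m x) : n = m := by
  unfold VEq at h h'; rw [h] at h'; exact_mod_cast h'

theorem VEq.le_of_ge {n m : ℤ} {x : F} (h : VEq v n x) (h' : VGe v m x) : m ≤ n := by
  unfold VEq at h; unfold VGe at h'; rw [h] at h'; exact_mod_cast h'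

theorem VGe.lt_or_eq {n : ℤ} {x : F} (h : VGe v n x) : VGe v (n + 1) x ∨ VEq v n x := by
  unfold VGe VEq at *
  rcases hx : v x with _ | m
  · left; exact le_top
  · rw [hx] at h
    have : n ≤ m := WithTop.coe_le_coe.mp h
    rcases eq_or_lt_of_le this with h1 | h1
    · right; rw [h1]; rfl
    · left; exact WithTop.coe_le_coe.mpr h1

theorem vge_zero (hv : DiscreteVal F v) (n : ℤ) : VGe v n 0 := by
  unfold VGe; rw [hv.1]; exact le_top

theorem VEq.ne_zero (hv : DiscreteVal F v) {n : ℤ} {x : F} (h : VEq v n x) : x ≠ 0 := by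
  rintro rfl; unfold VEq at h; rw [hv.1] at h; exact WithTop.top_ne_coe h

theorem exists_veq (hv : DiscreteVal F v) {x : F} (hx : x ≠ 0) : ∃ n : ℤ, VEq v n x := by
  rcases h : v x with _ | m
  · exact absurd (hv.2.1 x h) hx
  · exact ⟨m, h⟩

theorem VEq.mul (hv : DiscreteVal F v) {n m : ℤ} {x y : F} (h : VEq v n x) (h' : VEq v m y) :
    VEq v (n + m) (x * y) := by
  unfold VEq at *; rw [hv.2.2.1, h, h']; rfl

theorem VGe.mul (hv : DiscreteVal F v) {n m : ℤ} {x y : F} (h : VGe v n x) (h' : VGe v m y) :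
    VGe v (n + m) (x * y) := by
  unfold VGe at *; rw [hv.2.2.1, WithTop.coe_add]; exact add_le_add h h'

theorem VGe.add (hv : DiscreteVal F v) {n : ℤ} {x y : F} (h : VGe v n x) (h' : VGe v n y) :
    VGe v n (x + y) := le_trans (le_min h h') (hv.2.2.2.1 x y)

theorem veq_one (hv : DiscreteVal F v) : VEq v 0 (1 : F) := by
  obtain ⟨n, hn⟩ := exists_veq hv (one_ne_zero : (1 : F) ≠ 0)
  have := (hn.mul hv hn).congr (mul_one 1) rfl
  have := this.inj hn
  exact hn.cast (by omega)

theorem veq_neg_one (hv : DiscreteVal F v) : VEq v 0 (-1 : F) := by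
  obtain ⟨n, hn⟩ := exists_veq hv (neg_ne_zero.mpr one_ne_zero : (-1 : F) ≠ 0)
  have := (hn.mul hv hn).congr (by ring : (-1 : F) * -1 = 1) rfl
  have := this.inj (veq_one hv)
  exact hn.cast (by omega)

theorem VEq.neg (hv : DiscreteVal F v) {n : ℤ} {x : F} (h : VEq v n x) : VEq v n (-x) :=
  ((veq_neg_one hv).mul hv h).congr (by ring) (by ring)

theorem VGe.neg (hv : DiscreteVal F v) {n : ℤ} {x : F} (h : VGe v n x) : VGe v n (-x) :=
  (((veq_neg_one hv).ge le_rfl).mul hv h).congr (by ring) (by omega)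

theorem VGe.sub (hv : DiscreteVal F v) {n : ℤ} {x y : F} (h : VGe v n x) (h' : VGe v n y) :
    VGe v n (x - y) := (h.add hv (h'.neg hv)).congr (by ring) le_rfl

theorem VEq.add_ge (hv : DiscreteVal F v) {n : ℤ} {x y : F} (h : VEq v n x)
    (h' : VGe v (n + 1) y) : VEq v n (x + y) := by
  rcases (((h.ge le_rfl).add hv (h'.mono (by omega))).lt_or_eq) with h1 | h1
  · have := (h1.sub hv h').congr (by ring : x + y - y = x) le_rfl
    have := h.le_of_ge this
    omega
  · exact h1

theorem VEq.inv (hv : DiscreteVal F v) {n : ℤ} {x : F} (h : VEq v n x) : VEq v (-n) x⁻¹ := by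
  have hx := h.ne_zero hv
  obtain ⟨m, hm⟩ := exists_veq hv (inv_ne_zero hx)
  have := ((h.mul hv hm).congr (mul_inv_cancel₀ hx) rfl).inj (veq_one hv)
  exact hm.cast (by omega)

theorem VEq.sq (hv : DiscreteVal F v) {n : ℤ} {x : F} (h : VEq v n x) : VEq v (2 * n) (x ^ 2) :=
  (h.mul hv h).congr (by ring) (by ring)

theorem VGe.sq (hv : DiscreteVal F v) {n : ℤ} {x : F} (h : VGe v n x) : VGe v (2 * n) (x ^ 2) :=
  (h.mul hv h).congr (by ring) (by omega)

theorem VEq.pow (hv : DiscreteVal F v) {n : ℤ} {x : F} (h : VEq v n x) (k : ℕ) :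
    VEq v (k * n) (x ^ k) := by
  induction k with
  | zero => exact (veq_one hv).congr (by simp) (by simp)
  | succ k ih => exact (ih.mul hv h).congr (by ring) (by push_cast; ring)

theorem exists_unif (hv : DiscreteVal F v) (n : ℤ) : ∃ x : F, VEq v n x := by
  obtain ⟨π, hπ⟩ := hv.2.2.2.2
  have hπ : VEq v 1 π := hπ
  rcases le_total 0 n with h | h
  · exact ⟨π ^ n.toNat, (hπ.pow hv _).cast (by simp [h])⟩
  · exact ⟨(π ^ (-n).toNat)⁻¹, ((hπ.pow hv _).inv hv).cast (by simp [h])⟩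

/-- If `v 2 = e` and `z ^ 2 = 1 + η` with `v η = 2 D < 2 e`, then `v (z - 1) = D`. -/
theorem veq_sub_one (hv : DiscreteVal F v) {e n : ℤ} (he : VEq v e (2 : F)) {z η : F}
    (hz : z ^ 2 = 1 + η) (hη : VEq v n η) (hn : n < 2 * e) :
    ∃ m, n = 2 * m ∧ VEq v m (z - 1) := by
  have hne := hη.ne_zero hv
  have hprod : (z - 1) * (z + 1) = η := by linear_combination hz
  have h1 : z - 1 ≠ 0 := fun h => hne (by rw [← hprod, h, zero_mul])
  obtain ⟨m, hm⟩ := exists_veq hv h1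
  rcases lt_or_ge m e with h | h
  · have h2 : VEq v m (z + 1) := (hm.add_ge hv (he.ge (by omega))).congr (by ring) rfl
    exact ⟨m, by have := ((hm.mul hv h2).congr hprod rfl).inj hη; omega, hm⟩
  · have h2 : VGe v e (z + 1) := ((hm.ge h).add hv (he.ge le_rfl)).congr (by ring) le_rfl
    have := hη.le_of_ge ((((hm.ge h).mul hv h2)).congr hprod le_rfl)
    omega

end basics

/-- Units are squares modulo the maximal ideal. -/
def SqApprox {F : Type*} [Field F] (v : F → WithTop ℤ) : Prop :=
  ∀ x : F, VEq v 0 x → ∃ c : F, VGe v 1 (x - c ^ 2)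

section base
variable {K : Type*} [Field K] {v : K → WithTop ℤ}

theorem sq_approx (hv : DiscreteVal K v) (hs : SqApprox v) {n : ℤ} {x : K}
    (hx : VEq v (2 * n) x) : ∃ c : K, VEq v n c ∧ VGe v (2 * n + 1) (x - c ^ 2) := by
  obtain ⟨p, hp⟩ := exists_unif hv n
  have hp0 := hp.ne_zero hv
  obtain ⟨c, hc⟩ := hs (x * (p⁻¹) ^ 2) ((hx.mul hv ((hp.inv hv).sq hv)).cast (by ring))
  have h1 : VGe v (2 * n + 1) (x - (c * p) ^ 2) :=
    (hc.mul hv ((hp.sq hv).ge le_rfl)).congr (by field_simp) (by omega)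
  refine ⟨c * p, ?_, h1⟩
  have h2 : VEq v (2 * n) ((c * p) ^ 2) :=
    (hx.add_ge hv (h1.neg hv)).congr (by ring) rfl
  have h3 : c * p ≠ 0 := by
    intro h
    exact h2.ne_zero hv (by rw [h]; ring)
  obtain ⟨m, hm⟩ := exists_veq hv h3
  have := (hm.sq hv).inj h2
  exact hm.cast (by omega)

/-- Decomposition of `κ` as `ω c² + f²` up to precision `e`. -/
theorem decomp (hv : DiscreteVal K v) (hs : SqApprox v) {e d s p q : ℤ} (he : VEq v e (2 : K))
    {ω κ : K} (hω : VEq v d ω) (hκ : VEq v s κ) (hp : s = d + 2 * p) (hq : 2 * q = s + 1)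
    (N : ℕ) (hN : (N : ℤ) ≤ e) :
    ∃ c f : K, VGe v p c ∧ VGe v q f ∧ VGe v (s + N) (κ - ω * c ^ 2 - f ^ 2) := by
  induction N with
  | zero => exact ⟨0, 0, vge_zero hv _, vge_zero hv _, hκ.ge (by simp) |>.congr (by ring) le_rfl⟩
  | succ N ih =>
    push_cast at hN
    obtain ⟨c, f, hc, hf, hr⟩ := ih (by omega)
    rcases hr.lt_or_eq with h | h
    · exact ⟨c, f, hc, hf, h.mono (by push_cast; omega)⟩
    · rcases Nat.even_or_odd' N with ⟨j, hj | hj⟩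
      · have hω0 := hω.ne_zero hv
        have h1 : VEq v (2 * (p + j)) ((κ - ω * c ^ 2 - f ^ 2) * ω⁻¹) :=
          (h.mul hv (hω.inv hv)).cast (by rw [hj]; push_cast; omega)
        obtain ⟨c1, hc1, hc2⟩ := sq_approx hv hs h1
        refine ⟨c + c1, f, hc.add hv (hc1.ge (by omega)), hf, ?_⟩
        have h2 : VGe v (s + (N + 1 : ℕ)) (κ - ω * c ^ 2 - f ^ 2 - ω * c1 ^ 2) :=
          ((hω.ge le_rfl).mul hv hc2).congr (by field_simp) (by rw [hj]; push_cast; omega)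
        have h3 : VGe v (s + (N + 1 : ℕ)) (2 * (ω * (c * c1))) :=
          ((he.ge le_rfl).mul hv ((hω.ge le_rfl).mul hv (hc.mul hv (hc1.ge le_rfl)))).congr rfl
            (by push_cast; omega)
        exact (h2.sub hv h3).congr (by ring) le_rfl
      · have h1 : VEq v (2 * (q + j)) (κ - ω * c ^ 2 - f ^ 2) :=
          h.cast (by rw [hj]; push_cast; omega)
        obtain ⟨c1, hc1, hc2⟩ := sq_approx hv hs h1
        refine ⟨c, f + c1, hc, hf.add hv (hc1.ge (by omega)), ?_⟩
        have h3 : VGe v (s + (N + 1 : ℕ)) (2 * (f * c1)) :=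
          ((he.ge le_rfl).mul hv ((hf.mul hv (hc1.ge le_rfl)))).congr rfl
            (by push_cast; omega)
        exact ((hc2.mono (by rw [hj]; push_cast; omega)).sub hv h3).congr (by ring) le_rfl

/-- The possible shapes of the deviation `κ`. -/
def Shape (v : K → WithTop ℤ) (n : ℤ) (κ : K) : Prop :=
  VGe v n κ ∨ ∃ s : ℤ, Odd s ∧ 0 < s ∧ s < n ∧ VEq v s κ

theorem unit_shape (hv : DiscreteVal K v) (hs : SqApprox v) {e : ℤ} (he : VEq v e (2 : K))
    {x : K} (hx : VEq v 0 x) (N : ℕ) (hN : (N : ℤ) + 1 ≤ 2 * e) :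
    ∃ s κ : K, s ≠ 0 ∧ x * s ^ 2 = 1 + κ ∧ Shape v (N + 1) κ := by
  induction N with
  | zero =>
    obtain ⟨c, hc, hc2⟩ := sq_approx hv hs (hx.cast (by ring : (0 : ℤ) = 2 * 0))
    have hc0 := hc.ne_zero hv
    refine ⟨c⁻¹, (x - c ^ 2) * (c⁻¹) ^ 2, inv_ne_zero hc0, by field_simp; ring, Or.inl ?_⟩
    exact (hc2.mul hv (((hc.inv hv).sq hv).ge le_rfl)).congr rfl (by simp)
  | succ N ih =>
    push_cast at hN
    obtain ⟨s, κ, hs0, hκ, h | ⟨m, hm, hm0, hmN, hmκ⟩⟩ := ih (by omega)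
    · rcases h.lt_or_eq with h | h
      · exact ⟨s, κ, hs0, hκ, Or.inl (h.mono (by push_cast; omega))⟩
      · rcases Int.even_or_odd' ((N : ℤ) + 1) with ⟨j, hj | hj⟩
        · obtain ⟨c, hc, hc2⟩ := sq_approx hv hs (h.cast hj)
          have h1 : VEq v 0 (1 + c) := (veq_one hv).add_ge hv (hc.ge (by omega))
          have h10 := h1.ne_zero hv
          refine ⟨s * (1 + c)⁻¹, (κ - c ^ 2 - 2 * c) * ((1 + c)⁻¹) ^ 2,
            mul_ne_zero hs0 (inv_ne_zero h10), ?_, Or.inl ?_⟩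
          · have : x * (s * (1 + c)⁻¹) ^ 2 = (x * s ^ 2) * ((1 + c)⁻¹) ^ 2 := by ring
            rw [this, hκ]; field_simp; ring
          · have h3 : VGe v (2 * j + 1) (2 * c) := (he.mul hv hc).ge (by omega)
            exact ((hc2.sub hv h3).mul hv (((h1.inv hv).sq hv).ge le_rfl)).congr rfl
              (by push_cast; omega)
        · exact ⟨s, κ, hs0, hκ, Or.inr ⟨N + 1, ⟨j, by omega⟩, by omega, by push_cast; omega, h⟩⟩
    · exact ⟨s, κ, hs0, hκ, Or.inr ⟨m, hm, hm0, by push_cast; omega, hmκ⟩⟩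

theorem all_shape (hv : DiscreteVal K v) (hs : SqApprox v) {e d : ℤ} (he : VEq v e (2 : K))
    {ω : K} (hω : VEq v d ω) (hd : Odd d) (hd0 : 0 < d) (hde : d < 2 * e)
    {x : K} (hx : x ≠ 0) :
    ∃ s κ : K, s ≠ 0 ∧ (x * s ^ 2 = 1 + κ ∨ x * s ^ 2 = ω * (1 + κ)) ∧ Shape v d κ := by
  obtain ⟨n, hn⟩ := exists_veq hv hx
  have key : ∀ y : K, ∀ m : ℤ, VEq v (2 * m) y → ∃ s κ : K, s ≠ 0 ∧ y * s ^ 2 = 1 + κ ∧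
      Shape v d κ := by
    intro y m hy
    obtain ⟨p, hp⟩ := exists_unif hv (-m)
    obtain ⟨s, κ, hs0, hκ, hsh⟩ := unit_shape hv hs he
      ((hy.mul hv (hp.sq hv)).cast (by ring)) (d - 1).toNat (by omega)
    refine ⟨p * s, κ, mul_ne_zero (hp.ne_zero hv) hs0, by rw [← hκ]; ring, ?_⟩
    have : (((d - 1).toNat : ℤ)) + 1 = d := by omega
    rwa [this] at hsh
  rcases Int.even_or_odd' n with ⟨m, hm | hm⟩
  · obtain ⟨s, κ, h0, h1, h2⟩ := key x m (hn.cast hm)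
    exact ⟨s, κ, h0, Or.inl h1, h2⟩
  · obtain ⟨j, hj⟩ := hd
    obtain ⟨s, κ, h0, h1, h2⟩ := key (x * ω⁻¹) (m - j)
      ((hn.mul hv (hω.inv hv)).cast (by omega))
    refine ⟨s, κ, h0, Or.inr ?_, h2⟩
    have hω0 := hω.ne_zero hv
    rw [← h1]; field_simp

end base

section core
variable {K : Type*} [Field K] {v : K → WithTop ℤ} {F : Type*} [Field F] [Algebra K F]
  {vF : F → WithTop ℤ}

/-- Equality modulo nonzero squares from `T`. -/
def Rel (T : IntermediateField K F) (x y : F) : Prop := ∃ s ∈ T, s ≠ 0 ∧ x * s ^ 2 = y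

theorem Rel.mul {T : IntermediateField K F} {x y x' y' : F} (h : Rel T x y) (h' : Rel T x' y') :
    Rel T (x * x') (y * y') := by
  obtain ⟨s, hs, hs0, e⟩ := h
  obtain ⟨s', hs', hs0', e'⟩ := h'
  exact ⟨s * s', T.mul_mem hs hs', mul_ne_zero hs0 hs0', by rw [← e, ← e']; ring⟩

theorem Rel.refl (T : IntermediateField K F) (x : F) : Rel T x x :=
  ⟨1, T.one_mem, one_ne_zero, by ring⟩

/-- `F` has a valuation which is `2ρ` times that of `K` on `K`. -/
structure Lifts (v : K → WithTop ℤ) (vF : F → WithTop ℤ) (ρ : ℤ) : Prop where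
  hρ : ρ = 1 ∨ ρ = 2
  hF : DiscreteVal F vF
  eq : ∀ (n : ℤ) (a : K), VEq v n a → VEq vF (2 * ρ * n) (algebraMap K F a)
  ge : ∀ (n : ℤ) (a : K), VGe v n a → VGe vF (2 * ρ * n) (algebraMap K F a)

theorem veq_theta {ρ e d : ℤ} (L : Lifts v vF ρ) (he : VEq v e (2 : K)) {ω : K} (hω : VEq v d ω)
    (hde : d < 2 * e) {B : F} (hB : B ^ 2 = algebraMap K F (1 + ω)) : VEq vF (ρ * d) (B - 1) := by
  have h2 : VEq vF (2 * ρ * e) (2 : F) := (L.eq e 2 he).congr (map_ofNat (algebraMap K F) 2) rfl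
  obtain ⟨m, hm, h⟩ := veq_sub_one L.hF h2 (hB.trans (by simp)) (L.eq d ω hω)
    (by rcases L.hρ with h | h <;> subst h <;> omega)
  exact h.cast (by rcases L.hρ with h | h <;> subst h <;> omega)

theorem veq_i (hv : DiscreteVal K v) {i : K} (hi : i ^ 2 = -1) : VEq v 0 i := by
  have h0 : i ≠ 0 := by
    rintro rfl
    norm_num at hi
  obtain ⟨n, hn⟩ := exists_veq hv h0
  have := ((hn.sq hv).congr hi rfl).inj (veq_neg_one hv)
  exact hn.cast (by omega)

theorem veq_den (hv : DiscreteVal K v) {e d : ℤ} (he : VEq v e (2 : K)) {i ω : K}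
    (hi : i ^ 2 = -1) (hω : VEq v d ω) (hed : e < d) (hd0 : 0 < d) :
    VEq v e (2 * i * (1 + ω) + ω) := by
  have h1 : VEq v 0 (1 + ω) := (veq_one hv).add_ge hv (hω.ge (by omega))
  exact (((he.mul hv (veq_i hv hi)).mul hv h1).cast (by ring)).add_ge hv (hω.ge (by omega))

theorem core_base (hv : DiscreteVal K v) {ρ e d : ℤ} (L : Lifts v vF ρ) (he : VEq v e (2 : K))
    {i ω : K} (hi : i ^ 2 = -1) (hω : VEq v d ω) (hed : e < d) (hde : d < 2 * e) (hd0 : 0 < d)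
    (T : IntermediateField K F) {B : F} (hBT : B ∈ T) (hB : B ^ 2 = algebraMap K F (1 + ω)) :
    ∃ η : F, Rel T (algebraMap K F (2 * i * (1 + ω) + ω)⁻¹ * B) (1 + η) ∧
      VEq vF (ρ * (3 * d - 2 * e)) η := by
  have hden := veq_den hv he hi hω hed hd0
  have hden0 := hden.ne_zero hv
  set k := (2 * i * (1 + ω) + ω)⁻¹ with hk
  have hθ := veq_theta L he hω hde hB
  have hη : VEq vF (ρ * (3 * d - 2 * e)) (algebraMap K F k * algebraMap K F ω * (B - 1)) :=
    (((L.eq _ _ (hden.inv hv)).mul L.hF (L.eq _ _ hω)).mul L.hF hθ).cast (by ring)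
  have heq : algebraMap K F k * B * (algebraMap K F i + B) ^ 2 =
      1 + algebraMap K F k * algebraMap K F ω * (B - 1) := by
    have hi' : (algebraMap K F i) ^ 2 = -1 := by rw [← map_pow, hi]; simp
    have hk' : algebraMap K F k * (2 * algebraMap K F i * (1 + algebraMap K F ω)
        + algebraMap K F ω) = 1 := by
      have : k * (2 * i * (1 + ω) + ω) = 1 := inv_mul_cancel₀ hden0
      have := congrArg (algebraMap K F) this
      simpa only [map_mul, map_add, map_one, map_ofNat] using this
    have hB' : B ^ 2 = 1 + algebraMap K F ω := by rw [hB]; simp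
    linear_combination (algebraMap K F k * B) * hi' +
      (algebraMap K F k * B + 2 * algebraMap K F k * algebraMap K F i) * hB' + hk'
  refine ⟨_, ⟨algebraMap K F i + B, T.add_mem (T.algebraMap_mem i) hBT, ?_, heq⟩, hη⟩
  intro h
  rw [h] at heq
  have h1 : VEq vF 0 (1 + algebraMap K F k * algebraMap K F ω * (B - 1)) :=
    (veq_one L.hF).add_ge L.hF (hη.ge (by rcases L.hρ with h | h <;> subst h <;> omega))
  exact h1.ne_zero L.hF (by rw [← heq]; ring)

theorem core_kappa (hv : DiscreteVal K v) (hs : SqApprox v) {ρ e d s : ℤ} (L : Lifts v vF ρ)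
    (he : VEq v e (2 : K))
    {ω κ : K} (hω : VEq v d ω) (hd : Odd d) (hde : d < 2 * e) (hd0 : 0 < d)
    (hκ : VEq v s κ) (hsodd : Odd s) (hs0 : 0 < s) (hsd : s < d)
    (T : IntermediateField K F) {B : F} (hBT : B ∈ T) (hB : B ^ 2 = algebraMap K F (1 + ω)) :
    ∃ μ : F, Rel T (algebraMap K F (1 + κ)) (1 + μ) ∧ VEq vF (ρ * (2 * s + 2 * e - d)) μ := by
  have hθ := veq_theta L he hω hde hB
  have hρ := L.hρ
  have h2 : VEq vF (2 * ρ * e) (2 : F) := (L.eq e 2 he).congr (map_ofNat (algebraMap K F) 2) rfl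
  obtain ⟨p, hp⟩ : ∃ p, s = d + 2 * p := by
    obtain ⟨a, ha⟩ := hd; obtain ⟨b, hb⟩ := hsodd; exact ⟨b - a, by omega⟩
  obtain ⟨q, hq⟩ : ∃ q, 2 * q = s + 1 := by
    obtain ⟨b, hb⟩ := hsodd; exact ⟨b + 1, by omega⟩
  obtain ⟨c, f, hc, hf, hr⟩ := decomp hv hs he hω hκ hp hq e.toNat (by omega)
  have hr' : VGe v (s + e) (κ - ω * c ^ 2 - f ^ 2) := hr.mono (by omega)
  have hc' : VEq v p c := by
    rcases hc.lt_or_eq with h | h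
    · exfalso
      have h3 : VGe v (s + 1) (ω * c ^ 2) := ((hω.ge le_rfl).mul hv (h.sq hv)).mono (by omega)
      have h4 : VGe v (s + 1) (f ^ 2) := (hf.sq hv).mono (by omega)
      have h5 := hκ.le_of_ge ((((hr'.mono (by omega : s + 1 ≤ s + e)).add hv h3).add hv h4).congr
        (by ring) le_rfl)
      omega
    · exact h
  set A := algebraMap K F with hA
  set θ := B - 1 with hθd
  have hcF := L.eq _ _ hc'
  have hfF := L.ge _ _ hf
  have hrF := L.ge _ _ hr'
  have hz : VEq vF 0 (1 + A c * θ + A f) := by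
    refine ((veq_one L.hF).add_ge L.hF ((hcF.mul L.hF hθ).ge ?_)).add_ge L.hF (hfF.mono ?_) <;>
    rcases hρ with h | h <;> subst h <;> omega
  have hz0 := hz.ne_zero L.hF
  have m1 : VEq vF (ρ * (2 * s + 2 * e - d)) (2 * (A c ^ 2 * θ)) :=
    (h2.mul L.hF ((hcF.sq L.hF).mul L.hF hθ)).cast
      (by rcases hρ with h | h <;> subst h <;> omega)
  have m2 : VGe vF (ρ * (2 * s + 2 * e - d) + 1) (A (κ - ω * c ^ 2 - f ^ 2)) :=
    hrF.mono (by rcases hρ with h | h <;> subst h <;> omega)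
  have m3 : VGe vF (ρ * (2 * s + 2 * e - d) + 1) (2 * (A c * θ)) :=
    (h2.mul L.hF (hcF.mul L.hF hθ)).ge (by rcases hρ with h | h <;> subst h <;> omega)
  have m4 : VGe vF (ρ * (2 * s + 2 * e - d) + 1) (2 * A f) :=
    ((h2.ge le_rfl).mul L.hF hfF).mono (by rcases hρ with h | h <;> subst h <;> omega)
  have m5 : VGe vF (ρ * (2 * s + 2 * e - d) + 1) (2 * (A c * θ) * A f) :=
    (((h2.mul L.hF (hcF.mul L.hF hθ)).ge le_rfl).mul L.hF hfF).mono
      (by rcases hρ with h | h <;> subst h <;> omega)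
  have hμ := m1.add_ge L.hF (((m2.sub L.hF m3).sub L.hF m4).sub L.hF m5)
  refine ⟨_, ⟨(1 + A c * θ + A f)⁻¹, ?_, inv_ne_zero hz0, ?_⟩,
    (hμ.mul L.hF ((hz.inv L.hF).sq L.hF)).cast (by ring)⟩
  · exact T.inv_mem (T.add_mem (T.add_mem T.one_mem (T.mul_mem (T.algebraMap_mem c)
      (T.sub_mem hBT T.one_mem))) (T.algebraMap_mem f))
  · have hω' : A ω = θ ^ 2 + 2 * θ := by
      have : B ^ 2 = 1 + A ω := by rw [hB]; simp
      rw [hθd]; linear_combination -this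
    have : A (1 + κ) = (1 + A c * θ + A f) ^ 2 + (2 * (A c ^ 2 * θ) +
        (A (κ - ω * c ^ 2 - f ^ 2) - 2 * (A c * θ) - 2 * A f - 2 * (A c * θ) * A f)) := by
      simp only [map_add, map_sub, map_mul, map_pow, map_one, hω']
      ring
    rw [this]
    field_simp

theorem core_omega {ρ e d : ℤ} (L : Lifts v vF ρ) (he : VEq v e (2 : K)) {ω : K}
    (hω : VEq v d ω) (hde : d < 2 * e) (T : IntermediateField K F) {B : F} (hBT : B ∈ T)
    (hB : B ^ 2 = algebraMap K F (1 + ω)) :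
    ∃ μ : F, Rel T (algebraMap K F ω) (1 + μ) ∧ VEq vF (ρ * (2 * e - d)) μ := by
  have hθ := veq_theta L he hω hde hB
  have h2 : VEq vF (2 * ρ * e) (2 : F) := (L.eq e 2 he).congr (map_ofNat (algebraMap K F) 2) rfl
  have h0 := hθ.ne_zero L.hF
  refine ⟨2 * (B - 1)⁻¹, ⟨(B - 1)⁻¹, T.inv_mem (T.sub_mem hBT T.one_mem), inv_ne_zero h0, ?_⟩,
    (h2.mul L.hF (hθ.inv L.hF)).cast (by ring)⟩
  have : algebraMap K F ω = (B - 1) ^ 2 + 2 * (B - 1) := by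
    have : B ^ 2 = 1 + algebraMap K F ω := by rw [hB]; simp
    linear_combination -this
  rw [this]; field_simp

theorem dev_mul (hF : DiscreteVal F vF) {n : ℤ} {a b : F} (hn : 0 ≤ n) (ha : VEq vF n a)
    (hb : VGe vF (n + 1) b) : ∃ c, (1 + a) * (1 + b) = 1 + c ∧ VEq vF n c :=
  ⟨a + (b + a * b), by ring, ha.add_ge hF
    (hb.add hF (((ha.ge le_rfl).mul hF hb).mono (by omega)))⟩

theorem Rel.of_base {T : IntermediateField K F} {k k' s : K} (hs : s ≠ 0) (h : k * s ^ 2 = k')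
    {B y : F} (hr : Rel T (algebraMap K F k' * B) y) : Rel T (algebraMap K F k * B) y := by
  obtain ⟨z, hz, hz0, e⟩ := hr
  refine ⟨algebraMap K F s * z, T.mul_mem (T.algebraMap_mem s) hz,
    mul_ne_zero (by simpa using hs) hz0, ?_⟩
  rw [← e, ← h]; simp only [map_mul, map_pow]; ring

/-- Type of a twisting parameter `k`, with the corresponding defect `D`. -/
def Kind (v : K → WithTop ℤ) (e d : ℤ) (i ω k : K) (D : ℤ) : Prop :=
  ∃ s κ : K, s ≠ 0 ∧
    ((k * s ^ 2 = (2 * i * (1 + ω) + ω)⁻¹ * (1 + κ) ∧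
        ∃ m : ℤ, Odd m ∧ 0 < m ∧ m < 2 * d - 2 * e ∧ VEq v m κ ∧ D = 2 * m + 2 * e - d) ∨
     (k * s ^ 2 = (2 * i * (1 + ω) + ω)⁻¹ * (1 + κ) ∧ Shape v d κ ∧ VGe v (2 * d - 2 * e) κ ∧
        D = 3 * d - 2 * e) ∨
     (k * s ^ 2 = (2 * i * (1 + ω) + ω)⁻¹ * (ω * (1 + κ)) ∧ Shape v d κ ∧ D = 2 * e - d))

theorem kind_exists (hv : DiscreteVal K v) (hs : SqApprox v) {e d : ℤ} (he : VEq v e (2 : K))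
    {i ω k : K} (hi : i ^ 2 = -1) (hω : VEq v d ω) (hd : Odd d) (hed : e < d) (hde : d < 2 * e)
    (hd0 : 0 < d) (hk : k ≠ 0) : ∃ D, Kind v e d i ω k D := by
  have hden := veq_den hv he hi hω hed hd0
  have hden0 := hden.ne_zero hv
  obtain ⟨s, κ, hs0, hh, hsh⟩ := all_shape hv hs he hω hd hd0 hde
    (mul_ne_zero hk hden0)
  rcases hh with hh | hh
  · have hh' : k * s ^ 2 = (2 * i * (1 + ω) + ω)⁻¹ * (1 + κ) := by
      rw [← hh]; field_simp
    rcases hsh with h | ⟨m, hm, hm0, hmd, hmκ⟩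
    · exact ⟨_, s, κ, hs0, Or.inr (Or.inl ⟨hh', Or.inl h, h.mono (by omega), rfl⟩)⟩
    · rcases lt_or_ge m (2 * d - 2 * e) with h | h
      · exact ⟨_, s, κ, hs0, Or.inl ⟨hh', m, hm, hm0, h, hmκ, rfl⟩⟩
      · exact ⟨_, s, κ, hs0, Or.inr (Or.inl ⟨hh', Or.inr ⟨m, hm, hm0, hmd, hmκ⟩, hmκ.ge h, rfl⟩)⟩
  · refine ⟨_, s, κ, hs0, Or.inr (Or.inr ⟨?_, hsh, rfl⟩)⟩
    rw [← hh]; field_simp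

theorem kind_core (hv : DiscreteVal K v) (hs : SqApprox v) {ρ e d D : ℤ} (L : Lifts v vF ρ)
    (he : VEq v e (2 : K))
    {i ω k : K} (hi : i ^ 2 = -1) (hω : VEq v d ω) (hd : Odd d) (hed : e < d) (hde : d < 2 * e)
    (hd0 : 0 < d) (hk : Kind v e d i ω k D)
    (T : IntermediateField K F) {B : F} (hBT : B ∈ T) (hB : B ^ 2 = algebraMap K F (1 + ω)) :
    ∃ η : F, Rel T (algebraMap K F k * B) (1 + η) ∧ VEq vF (ρ * D) η := by
  have hρ := L.hρ
  obtain ⟨η0, hr0, hη0⟩ := core_base hv L he hi hω hed hde hd0 T hBT hB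
  obtain ⟨s, κ, hs0, ⟨hk, m, hm, hm0, hmd, hκ, rfl⟩ | ⟨hk, hsh, hκ, rfl⟩ | ⟨hk, hsh, rfl⟩⟩ := hk
  · obtain ⟨μ, hr1, hμ⟩ := core_kappa hv hs L he hω hd hde hd0 hκ hm hm0 (by omega) T hBT hB
    obtain ⟨c, hc, hcv⟩ := dev_mul L.hF
      (by rcases hρ with h | h <;> subst h <;> omega) hμ
      (hη0.ge (by rcases hρ with h | h <;> subst h <;> omega))
    refine ⟨c, Rel.of_base hs0 hk ?_, hcv⟩
    rw [← hc]
    convert hr1.mul hr0 using 1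
    rw [map_mul]; ring
  · have : ∃ μ : F, Rel T (algebraMap K F (1 + κ)) (1 + μ) ∧
        VGe vF (ρ * (3 * d - 2 * e) + 1) μ := by
      rcases hsh with h | ⟨m, hm, hm0, hmd, hmκ⟩
      · exact ⟨algebraMap K F κ, by simpa using Rel.refl T _, (L.ge _ _ h).mono
          (by rcases hρ with h | h <;> subst h <;> omega)⟩
      · obtain ⟨μ, hr1, hμ⟩ := core_kappa hv hs L he hω hd hde hd0 hmκ hm hm0 hmd T hBT hB
        have := hmκ.le_of_ge hκ
        obtain ⟨j, hj⟩ := hm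
        exact ⟨μ, hr1, hμ.ge (by rcases hρ with h | h <;> subst h <;> omega)⟩
    obtain ⟨μ, hr1, hμ⟩ := this
    obtain ⟨c, hc, hcv⟩ := dev_mul L.hF
      (by rcases hρ with h | h <;> subst h <;> omega) hη0 hμ
    refine ⟨c, Rel.of_base hs0 hk ?_, hcv⟩
    rw [← hc]
    convert hr0.mul hr1 using 1
    rw [map_mul]; ring
  · have : ∃ μ : F, Rel T (algebraMap K F (1 + κ)) (1 + μ) ∧
        VGe vF (ρ * (2 * e - d) + 1) μ := by
      rcases hsh with h | ⟨m, hm, hm0, hmd, hmκ⟩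
      · exact ⟨algebraMap K F κ, by simpa using Rel.refl T _, (L.ge _ _ h).mono
          (by rcases hρ with h | h <;> subst h <;> omega)⟩
      · obtain ⟨μ, hr1, hμ⟩ := core_kappa hv hs L he hω hd hde hd0 hmκ hm hm0 hmd T hBT hB
        exact ⟨μ, hr1, hμ.ge (by rcases hρ with h | h <;> subst h <;> omega)⟩
    obtain ⟨μ, hr1, hμ⟩ := this
    obtain ⟨ν, hr2, hν⟩ := core_omega L he hω hde T hBT hB
    obtain ⟨c, hc, hcv⟩ := dev_mul L.hF
      (by rcases hρ with h | h <;> subst h <;> omega) hν hμ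
    obtain ⟨c', hc', hcv'⟩ := dev_mul L.hF
      (by rcases hρ with h | h <;> subst h <;> omega) hcv
      (hη0.ge (by rcases hρ with h | h <;> subst h <;> omega))
    refine ⟨c', Rel.of_base hs0 hk ?_, hcv'⟩
    rw [← hc', ← hc]
    convert (hr2.mul hr1).mul hr0 using 1
    rw [map_mul, map_mul]; ring

/-- The admissible defects. -/
def Adm (e d D : ℤ) : Prop :=
  (∃ m : ℤ, Odd m ∧ 0 < m ∧ m < 2 * d - 2 * e ∧ D = 2 * m + 2 * e - d) ∨ D = 3 * d - 2 * e ∨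
    D = 2 * e - d

theorem Kind.adm {e d D : ℤ} {i ω k : K} (h : Kind v e d i ω k D) : Adm e d D := by
  obtain ⟨s, κ, hs0, ⟨hk, m, hm, hm0, hmd, hκ, h⟩ | ⟨hk, hsh, hκ, h⟩ | ⟨hk, hsh, h⟩⟩ := h
  · exact Or.inl ⟨m, hm, hm0, hmd, h⟩
  · exact Or.inr (Or.inl h)
  · exact Or.inr (Or.inr h)

theorem adm_kind (hv : DiscreteVal K v) {e d D : ℤ} (he : VEq v e (2 : K))
    {i ω : K} (hi : i ^ 2 = -1) (hω : VEq v d ω) (hed : e < d)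
    (hd0 : 0 < d) (h : Adm e d D) : ∃ k, k ≠ 0 ∧ Kind v e d i ω k D := by
  have hden := veq_den hv he hi hω hed hd0
  have hden0 := hden.ne_zero hv
  rcases h with ⟨m, hm, hm0, hmd, h⟩ | h | h
  · obtain ⟨κ, hκ⟩ := exists_unif hv m
    have h1 : VEq v 0 (1 + κ) := (veq_one hv).add_ge hv (hκ.ge (by omega))
    exact ⟨_, mul_ne_zero (inv_ne_zero hden0) (h1.ne_zero hv), 1, κ, one_ne_zero,
      Or.inl ⟨by ring, m, hm, hm0, hmd, hκ, h⟩⟩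
  · exact ⟨_, inv_ne_zero hden0, 1, 0, one_ne_zero,
      Or.inr (Or.inl ⟨by ring, Or.inl (vge_zero hv _), vge_zero hv _, h⟩)⟩
  · exact ⟨_, mul_ne_zero (inv_ne_zero hden0) (hω.ne_zero hv), 1, 0, one_ne_zero,
      Or.inr (Or.inr ⟨by ring, Or.inl (vge_zero hv _), h⟩)⟩

end core

theorem lifts_of_smul {K F : Type*} [Field K] [Field F] [Algebra K F] {v : K → WithTop ℤ}
    {vF : F → WithTop ℤ} (hF : DiscreteVal F vF) (r : ℕ) (hr : r = 1 ∨ r = 2)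
    (h : ∀ a : K, vF (algebraMap K F a) = (2 * r) • v a) : Lifts v vF (r : ℤ) := by
  have key : ∀ n : ℤ, (2 * r) • ((n : ℤ) : WithTop ℤ) = ((2 * (r : ℤ) * n : ℤ) : WithTop ℤ) := by
    intro n
    rw [← WithTop.coe_nsmul]
    congr 1
  refine ⟨by omega, hF, ?_, ?_⟩
  · intro n a ha
    unfold VEq at *
    rw [h, ha, key]
  · intro n a ha
    unfold VGe at *
    rw [h, ← key]
    exact nsmul_le_nsmul_right ha _

section brk
variable {K : Type} [Field K] {vK : K → WithTop ℤ} {w k : K}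

theorem fixed_mem (Q : CyclicQuarticExt K vK w k) {x : Q.E} (hx : Q.g x = x) :
    ∃ a : K, algebraMap K Q.E a = x := by
  have : FiniteDimensional K Q.E := Module.finite_of_finrank_pos (by rw [Q.hdeg]; norm_num)
  have h1 := IntermediateField.finrank_fixedField_eq_card (F := K) (E := Q.E)
    (Subgroup.zpowers Q.g)
  rw [Nat.card_zpowers, Q.hord] at h1
  have h2 := Module.finrank_mul_finrank K
    (IntermediateField.fixedField (Subgroup.zpowers Q.g)) Q.E
  rw [h1, Q.hdeg] at h2
  have h3 : IntermediateField.fixedField (Subgroup.zpowers Q.g) = ⊥ :=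
    IntermediateField.finrank_eq_one_iff.mp (by omega)
  have h4 : x ∈ IntermediateField.fixedField (Subgroup.zpowers Q.g) := by
    rw [IntermediateField.mem_fixedField_iff]
    intro f hf
    obtain ⟨n, rfl⟩ := Subgroup.mem_zpowers_iff.mp hf
    have : Q.g ∈ MulAction.stabilizer (Q.E ≃ₐ[K] Q.E) x := hx
    exact Subgroup.zpow_mem _ this n
  rw [h3, IntermediateField.mem_bot] at h4
  exact h4

theorem gy (Q : CyclicQuarticExt K vK w k) (hk : k ≠ 0) (hw : w ≠ 0) {i : K} (hi : i ^ 2 = -1) :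
    Q.g Q.y = algebraMap K Q.E i * Q.y ∨ Q.g Q.y = -(algebraMap K Q.E i * Q.y) := by
  have hi' : (algebraMap K Q.E i) ^ 2 = -1 := by rw [← map_pow, hi]; simp
  have h4 : (Q.g Q.y) ^ 4 = Q.y ^ 4 := by
    rw [← map_pow, Q.hy, AlgEquiv.commutes]
  have hprod : (Q.g Q.y ^ 2 - Q.y ^ 2) * ((Q.g Q.y - algebraMap K Q.E i * Q.y) *
      (Q.g Q.y + algebraMap K Q.E i * Q.y)) = 0 := by
    linear_combination h4 - (Q.g Q.y ^ 2 - Q.y ^ 2) * Q.y ^ 2 * hi'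
  rcases mul_eq_zero.mp hprod with h | h
  · exfalso
    have hgg : Q.g (Q.g Q.y) = Q.y := by
      have : (Q.g Q.y - Q.y) * (Q.g Q.y + Q.y) = 0 := by linear_combination h
      rcases mul_eq_zero.mp this with h | h
      · rw [sub_eq_zero.mp h, sub_eq_zero.mp h]
      · rw [eq_neg_of_add_eq_zero_left h, map_neg, eq_neg_of_add_eq_zero_left h, neg_neg]
    have hone : Q.g ^ 2 = 1 := by
      have : ((Q.g ^ 2 : Q.E ≃ₐ[K] Q.E) : Q.E →ₐ[K] Q.E) = AlgHom.id K Q.E := by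
        apply AlgHom.ext_of_adjoin_eq_top Q.hadj
        intro z hz
        rw [Set.mem_singleton_iff] at hz
        subst hz
        simpa [pow_two] using hgg
      ext z
      exact DFunLike.congr_fun this z
    have := orderOf_dvd_of_pow_eq_one hone
    rw [Q.hord] at this
    omega
  · rcases mul_eq_zero.mp h with h | h
    · left; exact sub_eq_zero.mp h
    · right; exact eq_neg_of_add_eq_zero_left h

theorem ggy (Q : CyclicQuarticExt K vK w k) (hk : k ≠ 0) (hw : w ≠ 0) {i : K} (hi : i ^ 2 = -1) :
    Q.g (Q.g Q.y) = -Q.y := by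
  have hi' : (algebraMap K Q.E i) ^ 2 = -1 := by rw [← map_pow, hi]; simp
  rcases gy Q hk hw hi with h | h
  · rw [h, map_mul, AlgEquiv.commutes, h]; linear_combination Q.y * hi'
  · rw [h, map_neg, map_mul, AlgEquiv.commutes, h]; linear_combination Q.y * hi'

/-- The fixed field of `g ^ 2`. -/
def TT (Q : CyclicQuarticExt K vK w k) : IntermediateField K Q.E :=
  IntermediateField.fixedField (Subgroup.zpowers (Q.g ^ 2))

theorem mem_TT (Q : CyclicQuarticExt K vK w k) (x : Q.E) : x ∈ TT Q ↔ Q.g (Q.g x) = x := by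
  unfold TT
  rw [IntermediateField.mem_fixedField_iff]
  constructor
  · intro h
    have := h (Q.g ^ 2) (Subgroup.mem_zpowers _)
    simpa [pow_two] using this
  · intro hx f hf
    obtain ⟨n, rfl⟩ := Subgroup.mem_zpowers_iff.mp hf
    have : Q.g ^ 2 ∈ MulAction.stabilizer (Q.E ≃ₐ[K] Q.E) x := by
      rw [MulAction.mem_stabilizer_iff]
      simpa [pow_two] using hx
    exact Subgroup.zpow_mem _ this n

theorem lifts_Q (Q : CyclicQuarticExt K vK w k) : Lifts vK Q.vE 2 :=
  lifts_of_smul Q.hvE 2 (Or.inr rfl) Q.hram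

/-- The square root of `w' = 1 + ω`. -/
def BB (Q : CyclicQuarticExt K vK w k) (k' : K) : Q.E := Q.y ^ 2 * (algebraMap K Q.E k')⁻¹

theorem BB_sq (Q : CyclicQuarticExt K vK w k) {k' ω : K} (hk' : k' ≠ 0)
    (h : k ^ 2 * w = k' ^ 2 * (1 + ω)) : BB Q k' ^ 2 = algebraMap K Q.E (1 + ω) := by
  have h0 : algebraMap K Q.E k' ≠ 0 := by simpa using hk'
  have h1 := Q.hy
  rw [h, map_mul, map_pow] at h1
  have : BB Q k' ^ 2 = Q.y ^ 4 * ((algebraMap K Q.E k')⁻¹) ^ 2 := by unfold BB; ring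
  rw [this, h1]
  field_simp

theorem g_BB (Q : CyclicQuarticExt K vK w k) (hk : k ≠ 0) (hw : w ≠ 0) {i : K} (hi : i ^ 2 = -1)
    (k' : K) : Q.g (BB Q k') = - BB Q k' := by
  have hi' : (algebraMap K Q.E i) ^ 2 = -1 := by rw [← map_pow, hi]; simp
  unfold BB
  rw [map_mul, map_inv₀, AlgEquiv.commutes, map_pow]
  rcases gy Q hk hw hi with h | h <;> rw [h] <;>
    linear_combination (Q.y ^ 2 * (algebraMap K Q.E k')⁻¹) * hi'

theorem BB_mem (Q : CyclicQuarticExt K vK w k) (hk : k ≠ 0) (hw : w ≠ 0) {i : K} (hi : i ^ 2 = -1)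
    (k' : K) : BB Q k' ∈ TT Q := by
  rw [mem_TT, g_BB Q hk hw hi, map_neg, g_BB Q hk hw hi, neg_neg]

theorem TT_even (hv : DiscreteVal K vK) (Q : CyclicQuarticExt K vK w k) (hk : k ≠ 0) (hw : w ≠ 0)
    {i : K} (hi : i ^ 2 = -1)
    {k' ω : K} (hk' : k' ≠ 0) (h : k ^ 2 * w = k' ^ 2 * (1 + ω)) {e d : ℤ} (he : VEq vK e (2 : K))
    (hω : VEq vK d ω) (hd : Odd d) (hde : d < 2 * e) {x : Q.E} (hx : x ∈ TT Q) :
    x = 0 ∨ ∃ n, VEq Q.vE (2 * n) x := by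
  have L := lifts_Q Q
  have hB := BB_sq Q hk' h
  have hgB := g_BB Q hk hw hi k'
  have hθ := veq_theta L he hω hde hB
  set B := BB Q k'
  have h2 : VEq Q.vE (2 * 2 * e) (2 : Q.E) :=
    (L.eq e 2 he).congr (map_ofNat (algebraMap K Q.E) 2) rfl
  have h20 := h2.ne_zero L.hF
  have hB0 : B ≠ 0 := by
    have := (mul_ne_zero (pow_ne_zero 2 hk) hw)
    rw [h] at this
    have h3 := right_ne_zero_of_mul this
    intro hb
    rw [hb] at hB
    apply h3
    apply (algebraMap K Q.E).injective
    rw [← hB]; simp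
  rw [mem_TT] at hx
  obtain ⟨p, hp⟩ := fixed_mem Q (x := (x + Q.g x) * 2⁻¹) (by
    rw [map_mul, map_add, hx, map_inv₀, map_ofNat]; ring)
  obtain ⟨q, hq⟩ := fixed_mem Q (x := (x - Q.g x) * 2⁻¹ * B⁻¹) (by
    rw [map_mul, map_mul, map_sub, hx, map_inv₀, map_inv₀, map_ofNat, hgB]; field_simp; ring)
  have hxe : algebraMap K Q.E (p + q) + algebraMap K Q.E q * (B - 1) = x := by
    rw [map_add, hp, hq]; field_simp; ring
  obtain ⟨j, hj⟩ := hd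
  by_cases hq0 : q = 0
  · subst hq0
    by_cases hp0 : p = 0
    · left; rw [← hxe, hp0]; simp
    · obtain ⟨n, hn⟩ := exists_veq hv hp0
      right; exact ⟨2 * n, (L.eq _ _ hn).congr (by rw [← hxe]; simp) (by ring)⟩
  · obtain ⟨n, hn⟩ := exists_veq hv hq0
    have hqθ := (L.eq _ _ hn).mul L.hF hθ
    by_cases hp0 : p + q = 0
    · right; exact ⟨2 * n + d, hqθ.congr (by rw [← hxe, hp0]; simp) (by ring)⟩
    · obtain ⟨m, hm⟩ := exists_veq hv hp0
      have hpE := L.eq _ _ hm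
      right
      rcases lt_or_ge (2 * 2 * m) (2 * 2 * n + 2 * d) with hlt | hge
      · exact ⟨2 * m, (hpE.add_ge L.hF (hqθ.ge hlt)).congr hxe (by ring)⟩
      · refine ⟨2 * n + d, (hqθ.add_ge L.hF (hpE.ge ?_)).congr (by rw [← hxe]; ring) (by ring)⟩
        omega

theorem break_lemma (hv : DiscreteVal K vK) (Q : CyclicQuarticExt K vK w k) (hk : k ≠ 0)
    (hw : w ≠ 0) {i : K} (hi : i ^ 2 = -1)
    {k' ω : K} (hk' : k' ≠ 0) (h : k ^ 2 * w = k' ^ 2 * (1 + ω)) {e d D : ℤ}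
    (he : VEq vK e (2 : K))
    (hω : VEq vK d ω) (hd : Odd d) (hde : d < 2 * e) {η : Q.E}
    (hr : Rel (TT Q) (algebraMap K Q.E k' * BB Q k') (1 + η)) (hη : VEq Q.vE (2 * D) η)
    (hD : Odd D) (hD0 : 0 < D) (hDe : D < 4 * e) : Q.SecondBreakIs (4 * e - D) := by
  have L := lifts_Q Q
  have even : ∀ x ∈ TT Q, x = 0 ∨ ∃ n, VEq Q.vE (2 * n) x := fun x hx =>
    TT_even hv Q hk hw hi hk' h he hω hd hde hx
  have h2 : VEq Q.vE (2 * 2 * e) (2 : Q.E) :=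
    (L.eq e 2 he).congr (map_ofNat (algebraMap K Q.E) 2) rfl
  have h20 := h2.ne_zero L.hF
  obtain ⟨s, hs, hs0, hse⟩ := hr
  have hk0 : algebraMap K Q.E k' ≠ 0 := by simpa using hk'
  have hY2 : (Q.y * s) ^ 2 = 1 + η := by
    rw [← hse]; unfold BB; field_simp
  have hσY : Q.g (Q.g (Q.y * s)) = -(Q.y * s) := by
    rw [map_mul, map_mul, ggy Q hk hw hi, (mem_TT Q s).mp hs]; ring
  set Y := Q.y * s
  obtain ⟨m, hm, hΘ⟩ := veq_sub_one L.hF h2 hY2 hη (by omega)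
  have hmD : m = D := by omega
  subst hmD
  have hY : VEq Q.vE 0 Y :=
    ((veq_one L.hF).add_ge L.hF (hΘ.ge (by omega))).congr (by ring) rfl
  have hY0 := hY.ne_zero L.hF
  have hπ : VEq Q.vE 1 Q.πE := Q.hπE
  have hfix : ∀ x : Q.E, Q.g (Q.g (Q.g (Q.g x))) = x := by
    intro x
    have h4 : Q.g ^ 4 = 1 := by rw [← Q.hord]; exact pow_orderOf_eq_one _
    have := DFunLike.congr_fun h4 x
    simpa [pow_succ] using this
  have hq : (Q.πE - Q.g (Q.g Q.πE)) * 2⁻¹ * Y⁻¹ ∈ TT Q := by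
    rw [mem_TT]
    simp only [map_mul, map_sub, map_inv₀, map_ofNat, hfix, hσY]
    field_simp; ring
  have hp : (Q.πE + Q.g (Q.g Q.πE)) * 2⁻¹ ∈ TT Q := by
    rw [mem_TT]
    simp only [map_mul, map_add, map_inv₀, map_ofNat, hfix]
    ring
  set q := (Q.πE - Q.g (Q.g Q.πE)) * 2⁻¹ * Y⁻¹ with hqd
  set p := (Q.πE + Q.g (Q.g Q.πE)) * 2⁻¹ with hpd
  have hπe : (p + q) + q * (Y - 1) = Q.πE := by
    rw [hqd, hpd]; field_simp; ring
  have hqv : VEq Q.vE (1 - m) q := by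
    obtain ⟨j, hj⟩ := hD
    rcases even (p + q) ((TT Q).add_mem hp hq) with hpq | ⟨a, ha⟩
    · have : q * (Y - 1) = Q.πE := by rw [← hπe, hpq, zero_add]
      refine (hπ.mul L.hF (hΘ.inv L.hF)).congr ?_ (by ring)
      rw [← this]; field_simp [hΘ.ne_zero L.hF]
    · rcases even q hq with hq0 | ⟨b, hb⟩
      · rw [hq0, zero_mul, add_zero] at hπe
        rw [hq0] at ha
        have := (ha.congr hπe rfl).inj hπ
        omega
      · have hqΘ := hb.mul L.hF hΘ
        rcases lt_or_ge (2 * a) (2 * b + m) with hlt | hge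
        · have := ((ha.add_ge L.hF (hqΘ.ge hlt)).congr hπe rfl).inj hπ
          omega
        · have := ((hqΘ.add_ge L.hF (ha.ge (by omega))).congr
            (by rw [← hπe]; ring) rfl).inj hπ
          exact hb.cast (by omega)
  have hfin : VEq Q.vE (4 * e - m + 1) (Q.g (Q.g Q.πE) - Q.πE) := by
    refine (((h2.mul L.hF hqv).mul L.hF hY).neg L.hF).congr ?_ (by ring)
    rw [hqd]; field_simp; ring
  exact hfin

end brk

section quadext

theorem quad_min {F : Type} [Field F] {v : F → WithTop ℤ} (hv : DiscreteVal F v) {e D : ℤ}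
    (he : VEq v e (2 : F)) {η : F} (hη : VEq v D η) (hD : Odd D) (hDe : D < 2 * e) (a b : F) :
    v (a ^ 2 - 2 * (a * b) - η * b ^ 2) = min (v (a ^ 2)) (v (η * b ^ 2)) := by
  obtain ⟨j, hj⟩ := hD
  by_cases hb : b = 0
  · subst hb; simp [hv.1]
  by_cases ha : a = 0
  · subst ha
    obtain ⟨n, hn⟩ := exists_veq hv hb
    have h1 := hη.mul hv (hn.sq hv)
    have h2 := h1.neg hv
    unfold VEq at h1 h2
    simp [hv.1, h1, h2]
  obtain ⟨m, hm⟩ := exists_veq hv ha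
  obtain ⟨n, hn⟩ := exists_veq hv hb
  have h1 := hm.sq hv
  have h2 := hη.mul hv (hn.sq hv)
  have h3 := he.mul hv (hm.mul hv hn)
  rcases lt_or_ge (2 * m) (D + 2 * n) with h | h
  · have h4 : VEq v (2 * m) (a ^ 2 - 2 * (a * b) - η * b ^ 2) :=
      ((h1.add_ge hv ((h3.neg hv).ge (by omega))).add_ge hv ((h2.neg hv).ge (by omega))).congr
        (by ring) rfl
    unfold VEq at h1 h2 h4
    rw [h1, h2, h4, min_eq_left]
    exact_mod_cast h.le
  · have h4 : VEq v (D + 2 * n) (a ^ 2 - 2 * (a * b) - η * b ^ 2) :=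
      (((h2.neg hv).add_ge hv ((h3.neg hv).ge (by omega))).add_ge hv (h1.ge (by omega))).congr
        (by ring) rfl
    unfold VEq at h1 h2 h4
    rw [h1, h2, h4, min_eq_right]
    exact_mod_cast h

theorem sq_le_add {F : Type} [Field F] {v : F → WithTop ℤ} (hv : DiscreteVal F v) (a b : F) :
    min (v (a ^ 2)) (v (b ^ 2)) ≤ v ((a + b) ^ 2) := by
  simp only [pow_two, hv.2.2.1]
  rcases le_total (v a) (v b) with h | h
  · have h1 : v a ≤ v (a + b) := le_trans (le_min le_rfl h) (hv.2.2.2.1 a b)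
    exact (min_le_left _ _).trans (add_le_add h1 h1)
  · have h1 : v b ≤ v (a + b) := le_trans (le_min h le_rfl) (hv.2.2.2.1 a b)
    exact (min_le_right _ _).trans (add_le_add h1 h1)

theorem quad_ext {F : Type} [Field F] {v : F → WithTop ℤ} (hv : DiscreteVal F v) {e D : ℤ}
    (he : VEq v e (2 : F)) {η : F} (hη : VEq v D η) (hD : Odd D) (hDe : D < 2 * e) :
    ∃ (F' : Type) (_ : Field F') (_ : Algebra F F') (v' : F' → WithTop ℤ) (Y : F'),
      DiscreteVal F' v' ∧ Y ^ 2 = algebraMap F F' (1 + η) ∧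
      (∀ a : F, v' (algebraMap F F' a) = 2 • v a) ∧ Module.finrank F F' = 2 ∧
      ∀ z : F', ∃ a b : F, z = algebraMap F F' a + algebraMap F F' b * Y := by
  have : Fact (∀ r : F, r ^ 2 ≠ η + (-2) * r) := ⟨by
    intro r hr
    obtain ⟨m, hm, _⟩ := veq_sub_one hv he (z := r + 1) (η := η) (by linear_combination hr) hη hDe
    obtain ⟨j, hj⟩ := hD
    omega⟩
  have hnorm : ∀ z : QuadraticAlgebra F η (-2),
      z.norm = z.re ^ 2 - 2 * (z.re * z.im) - η * z.im ^ 2 := by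
    intro z; rw [QuadraticAlgebra.norm_def]; ring
  have hmin : ∀ z : QuadraticAlgebra F η (-2),
      v z.norm = min (v (z.re ^ 2)) (v (η * z.im ^ 2)) := by
    intro z; rw [hnorm, quad_min hv he hη hD hDe]
  have hpi : ∀ a : F, v ((algebraMap F (QuadraticAlgebra F η (-2)) a).norm) = 2 • v a := by
    intro a
    rw [QuadraticAlgebra.norm_algebraMap, pow_two, hv.2.2.1, two_nsmul]
  refine ⟨QuadraticAlgebra F η (-2), inferInstance, inferInstance, fun z => v z.norm,
    1 + QuadraticAlgebra.omega, ⟨?_, ?_, ?_, ?_, ?_⟩, ?_, hpi, QuadraticAlgebra.finrank_eq_two _ _, ?_⟩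
  · show v (QuadraticAlgebra.norm 0) = ⊤
    rw [QuadraticAlgebra.norm_zero, hv.1]
  · intro x hx
    exact QuadraticAlgebra.norm_eq_zero_iff_eq_zero.mp (hv.2.1 _ hx)
  · intro x y
    show v (x * y).norm = v x.norm + v y.norm
    rw [map_mul, hv.2.2.1]
  · intro x y
    show min (v x.norm) (v y.norm) ≤ v (x + y).norm
    rw [hmin, hmin, hmin]
    refine le_min ?_ ?_
    · refine le_trans (le_min ?_ ?_) (sq_le_add hv _ _)
      · exact (min_le_left _ _).trans (min_le_left _ _)
      · exact (min_le_right _ _).trans (min_le_left _ _)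
    · have h := sq_le_add hv x.im y.im
      rw [hv.2.2.1 η ((x + y).im ^ 2), QuadraticAlgebra.im_add]
      refine le_trans ?_ (add_le_add le_rfl h)
      rw [← min_add_add_left, ← hv.2.2.1, ← hv.2.2.1]
      exact min_le_min (min_le_right _ _) (min_le_right _ _)
  · obtain ⟨j, hj⟩ := hD
    obtain ⟨p, hp⟩ := exists_unif hv (-j)
    refine ⟨⟨0, p⟩, ?_⟩
    have h1 := ((hη.mul hv (hp.sq hv)).neg hv).cast (m := 1) (by omega)
    show v _ = _
    rw [hnorm]
    refine Eq.trans ?_ h1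
    congr 1; ring
  · ext <;> simp [pow_two, QuadraticAlgebra.re_one, QuadraticAlgebra.im_one, QuadraticAlgebra.algebraMap_eq] <;> ring
  · intro z
    refine ⟨z.re - z.im, z.im, ?_⟩
    ext <;> simp [QuadraticAlgebra.re_one, QuadraticAlgebra.im_one, QuadraticAlgebra.algebraMap_eq]

end quadext

section padic
open Polynomial

theorem padic_root (b : ℤ_[2]) (n : ℕ) (hn : Odd n) : ∃ z : ℤ_[2], z ^ n = 1 + 2 * b := by
  have hnu : ‖((n : ℤ_[2]))‖ = 1 := by
    rw [← PadicInt.isUnit_iff]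
    rw [PadicInt.isUnit_iff]
    have := (PadicInt.norm_int_lt_one_iff_dvd (p := 2) (n : ℤ)).not.mpr (by
      intro h
      obtain ⟨j, rfl⟩ := hn
      have : (2 : ℤ) ∣ 2 * j + 1 := by exact_mod_cast h
      omega)
    have h1 := PadicInt.norm_le_one (n : ℤ_[2])
    push_cast at this
    exact le_antisymm h1 (not_lt.mp this)
  have h2 : ‖(2 : ℤ_[2])‖ < 1 := by
    have := (PadicInt.norm_int_lt_one_iff_dvd (p := 2) (2 : ℤ)).mpr (by norm_num)
    exact_mod_cast this
  have key := hensels_lemma (p := 2) (R := ℤ_[2]) (F := X ^ n - C (1 + 2 * b)) (a := 1) (by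
    simp only [map_sub, map_pow, aeval_X, aeval_C, derivative_sub, derivative_X_pow, derivative_C,
      sub_zero, map_mul, map_natCast, one_pow, mul_one, hnu]
    have : (1 : ℤ_[2]) - algebraMap ℤ_[2] ℤ_[2] (1 + 2 * b) = -(2 * b) := by simp
    rw [this, norm_neg, norm_mul]
    have := PadicInt.norm_le_one b
    nlinarith [norm_nonneg (2 : ℤ_[2]), norm_nonneg b])
  obtain ⟨z, hz, -⟩ := key
  refine ⟨z, ?_⟩
  simp only [map_sub, map_pow, aeval_X, aeval_C] at hz
  simpa using sub_eq_zero.mp hz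

variable {K : Type*} [Field K] [Algebra ℚ_[2] K] {v : K → WithTop ℤ}

theorem padic_ge (hv : DiscreteVal K v) {e : ℤ} (he : VEq v e (2 : K)) (he0 : 0 < e) (a : ℤ_[2]) :
    VGe v 0 (algebraMap ℚ_[2] K (a : ℚ_[2])) := by
  set f : ℤ_[2] →+* K := (algebraMap ℚ_[2] K).comp PadicInt.Coe.ringHom with hf
  change VGe v 0 (f a)
  by_cases ha : f a = 0
  · rw [ha]; exact vge_zero hv _
  obtain ⟨m, hm⟩ := exists_veq hv ha
  rcases le_or_gt 0 m with h | h
  · exact hm.ge h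
  exfalso
  have h1 : VEq v (e + ((e.toNat + 1 : ℕ) : ℤ) * m) (f (2 * a ^ (e.toNat + 1))) :=
    (he.mul hv (hm.pow hv _)).congr (by rw [map_mul, map_pow, map_ofNat]) rfl
  have hneg : e + ((e.toNat + 1 : ℕ) : ℤ) * m < 0 := by
    have : ((e.toNat + 1 : ℕ) : ℤ) = e + 1 := by push_cast; omega
    rw [this]; nlinarith
  set r := e + ((e.toNat + 1 : ℕ) : ℤ) * m
  have h2 : VEq v r (f (1 + 2 * a ^ (e.toNat + 1))) :=
    (h1.add_ge hv ((veq_one hv).ge (by omega))).congr (by simp [add_comm]) rfl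
  obtain ⟨z, hz⟩ := padic_root (a ^ (e.toNat + 1)) (2 * (-r).toNat + 1) ⟨_, rfl⟩
  rw [← hz, map_pow] at h2
  have hz0 : f z ≠ 0 := by
    intro h
    apply h2.ne_zero hv
    rw [h]; simp
  obtain ⟨x, hx⟩ := exists_veq hv hz0
  have h3 := (hx.pow hv _).inj h2
  have h4 : ((2 * (-r).toNat + 1 : ℕ) : ℤ) = -2 * r + 1 := by push_cast; omega
  rw [h4] at h3
  rcases lt_trichotomy x 0 with h | h | h
  · nlinarith
  · subst h; omega
  · nlinarith

/-- The valuation ring. -/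
def VR (hv : DiscreteVal K v) : ValuationSubring K where
  carrier := {x | VGe v 0 x}
  mul_mem' := fun {a b} ha hb => (VGe.mul hv ha hb).mono (by norm_num)
  one_mem' := (veq_one hv).ge le_rfl
  add_mem' := fun {a b} ha hb => VGe.add hv ha hb
  zero_mem' := vge_zero hv 0
  neg_mem' := fun {a} ha => VGe.neg hv ha
  mem_or_inv_mem' := by
    intro x
    by_cases hx : x = 0
    · left; subst hx; exact vge_zero hv 0
    · obtain ⟨n, hn⟩ := exists_veq hv hx
      rcases le_total 0 n with h | h
      · left; exact hn.ge h
      · right; exact (hn.inv hv).ge (by omega)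

theorem residue_zero (hv : DiscreteVal K v) (x : VR hv)  :
    IsLocalRing.residue (VR hv) x = 0 ↔ VGe v 1 (x : K) := by
  rw [IsLocalRing.residue_eq_zero_iff, IsLocalRing.mem_maximalIdeal, mem_nonunits_iff]
  have hx : VGe v 0 (x : K) := x.2
  constructor
  · intro h
    rcases hx.lt_or_eq with h1 | h1
    · exact h1
    · exfalso
      apply h
      have h2 : VGe v 0 ((x : K)⁻¹) := (h1.inv hv).ge (by simp)
      have h0 := h1.ne_zero hv
      refine IsUnit.of_mul_eq_one (⟨(x : K)⁻¹, h2⟩ : VR hv) ?_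
      apply Subtype.ext
      show (x : K) * (x : K)⁻¹ = 1
      exact mul_inv_cancel₀ h0
  · intro h hu
    obtain ⟨y, hy⟩ := hu.exists_right_inv
    have h1 : (x : K) * (y : K) = 1 := congrArg Subtype.val hy
    have h2 : VGe v 0 (y : K) := y.2
    have := (veq_one hv).le_of_ge ((h.mul hv h2).congr h1 le_rfl)
    omega

theorem sqApprox_of_finite [FiniteDimensional ℚ_[2] K] (hv : DiscreteVal K v) {e : ℤ}
    (he : VEq v e (2 : K)) (he0 : 0 < e) : SqApprox v := by
  intro x hx
  classical
  let f : ℤ_[2] →+* K := (algebraMap ℚ_[2] K).comp PadicInt.Coe.ringHom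
  have hfinj : Function.Injective f :=
    (algebraMap ℚ_[2] K).injective.comp Subtype.val_injective
  let fO : ℤ_[2] →+* VR hv := f.codRestrict (VR hv).toSubring (fun a => padic_ge hv he he0 a)
  let k := IsLocalRing.ResidueField (VR hv)
  let xO : VR hv := ⟨x, hx.ge le_rfl⟩
  let φ : ℤ_[2] →+* k := (IsLocalRing.residue (VR hv)).comp fO
  have h2k : (2 : k) = 0 := by
    have : IsLocalRing.residue (VR hv) 2 = 0 := by
      rw [residue_zero]
      exact he.ge (by omega)
    rw [← this, map_ofNat]
  haveI : CharP k 2 := CharTwo.of_one_ne_zero_of_two_eq_zero one_ne_zero h2k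
  letI : Algebra (ZMod 2) k := ZMod.algebra k 2
  have hφ : φ = (algebraMap (ZMod 2) k).comp (PadicInt.toZMod (p := 2)) := by
    have hker : RingHom.ker (PadicInt.toZMod (p := 2)) ≤ RingHom.ker φ := by
      rw [PadicInt.ker_toZMod, PadicInt.maximalIdeal_eq_span_p, Ideal.span_singleton_le_iff_mem,
        RingHom.mem_ker]
      have h3 : φ 2 = 0 := (map_ofNat φ 2).trans h2k
      exact_mod_cast h3
    ext a
    have h01 : PadicInt.toZMod (p := 2) a = 0 ∨ PadicInt.toZMod (p := 2) a = 1 := by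
      generalize PadicInt.toZMod (p := 2) a = c
      revert c; decide
    rcases h01 with h | h
    · have h1 : φ a = 0 := hker h
      rw [h1, RingHom.comp_apply, h, map_zero]
    · have h1 : φ (a - 1) = 0 := hker (by rw [RingHom.mem_ker, map_sub, h, map_one, sub_self])
      rw [map_sub, map_one, sub_eq_zero] at h1
      rw [h1, RingHom.comp_apply, h, map_one]
  -- an algebraic relation
  letI : Algebra ℤ_[2] K := f.toAlgebra
  letI : NormalizedGCDMonoid ℤ_[2] := Classical.choice inferInstance
  haveI : IsScalarTower ℤ_[2] ℚ_[2] K := IsScalarTower.of_algebraMap_eq (fun a => rfl)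
  have halg : IsAlgebraic ℤ_[2] x :=
    (IsFractionRing.isAlgebraic_iff ℤ_[2] ℚ_[2] K).mpr (Algebra.IsAlgebraic.isAlgebraic x)
  haveI : Module.IsTorsionFree ℤ_[2] K :=
    Module.isTorsionFree_iff_faithfulSMul.mpr
      ((faithfulSMul_iff_algebraMap_injective _ _).mpr hfinj)
  obtain ⟨p, hp0, hp⟩ := halg
  have hq := aeval_primPart_eq_zero hp0 hp
  have hprim := p.isPrimitive_primPart
  set q := p.primPart
  have hqmap : q.map (PadicInt.toZMod (p := 2)) ≠ 0 := by
    intro h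
    have hdvd : C (2 : ℤ_[2]) ∣ q := by
      rw [C_dvd_iff_dvd_coeff]
      intro i
      have h1 : PadicInt.toZMod (p := 2) (q.coeff i) = 0 := by
        rw [← coeff_map, h, coeff_zero]
      have h2 : q.coeff i ∈ RingHom.ker (PadicInt.toZMod (p := 2)) := h1
      rw [PadicInt.ker_toZMod, PadicInt.maximalIdeal_eq_span_p, Ideal.mem_span_singleton] at h2
      exact_mod_cast h2
    have := hprim 2 hdvd
    have h3 := PadicInt.prime_p (p := 2)
    exact h3.not_unit (by exact_mod_cast this)
  have hroot : eval₂ φ (IsLocalRing.residue (VR hv) xO) q = 0 := by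
    rw [← hom_eval₂]
    have : eval₂ fO xO q = 0 := by
      apply Subtype.ext
      have : (VR hv).subtype (eval₂ fO xO q) = eval₂ f x q := by
        rw [hom_eval₂]; rfl
      exact this.trans hq
    rw [this, map_zero]
  have halg2 : IsAlgebraic (ZMod 2) (IsLocalRing.residue (VR hv) xO) := by
    refine ⟨_, hqmap, ?_⟩
    rw [aeval_def, eval₂_map, ← hφ, hroot]
  set ξ := IsLocalRing.residue (VR hv) xO
  haveI : FiniteDimensional (ZMod 2) (IntermediateField.adjoin (ZMod 2) {ξ}) :=
    IntermediateField.adjoin.finiteDimensional halg2.isIntegral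
  haveI : Finite (IntermediateField.adjoin (ZMod 2) {ξ}) := Module.finite_of_finite (ZMod 2)
  haveI : CharP (IntermediateField.adjoin (ZMod 2) {ξ}) 2 :=
    charP_of_injective_algebraMap (algebraMap (ZMod 2) _).injective 2
  obtain ⟨y, hy⟩ := (bijective_frobenius (IntermediateField.adjoin (ZMod 2) {ξ}) 2).2
    ⟨ξ, IntermediateField.mem_adjoin_simple_self _ _⟩
  have hy' : (y : k) ^ 2 = ξ := congrArg Subtype.val hy
  obtain ⟨c, hc⟩ := IsLocalRing.residue_surjective (R := VR hv) (y : k)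
  refine ⟨(c : K), ?_⟩
  have := (residue_zero hv (xO - c ^ 2)).mp (by
    rw [map_sub, map_pow, hc, hy', sub_self])
  exact this

end padic

section existence
open Polynomial

theorem exists_auto {K L : Type} [Field K] [Field L] [Algebra K L] {i c : K} {y : L}
    (hi : i ^ 2 = -1) (h4 : Module.finrank K L = 4) (hy : y ^ 4 = algebraMap K L c)
    (hadj : Algebra.adjoin K ({y} : Set L) = ⊤) :
    ∃ g : L ≃ₐ[K] L, g y = algebraMap K L i * y := by
  have hfd : FiniteDimensional K L := Module.finite_of_finrank_pos (by omega)
  have hyint : IsIntegral K y := IsIntegral.of_finite K y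
  let pb := PowerBasis.ofAdjoinEqTop hyint hadj
  have hgen : pb.gen = y := PowerBasis.ofAdjoinEqTop_gen hyint hadj
  have hdeg : (minpoly K y).natDegree = 4 := by
    rw [← hgen, pb.natDegree_minpoly, ← pb.finrank, h4]
  have hmin : X ^ 4 - C c = minpoly K y := by
    refine eq_of_monic_of_dvd_of_natDegree_le (minpoly.monic hyint)
      (monic_X_pow_sub_C c (by norm_num)) (minpoly.dvd K y ?_) ?_
    · simp [hy]
    · rw [hdeg, natDegree_X_pow_sub_C]
  have hroot : aeval (algebraMap K L i * y) (minpoly K pb.gen) = 0 := by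
    rw [hgen, ← hmin]
    have h1 : (algebraMap K L i) ^ 4 = 1 := by
      rw [← map_pow]
      have : i ^ 4 = 1 := by
        calc i ^ 4 = (i ^ 2) ^ 2 := by ring
          _ = 1 := by rw [hi]; ring
      rw [this, map_one]
    simp [mul_pow, h1, hy]
  let f := pb.lift _ hroot
  refine ⟨AlgEquiv.ofBijective f f.bijective, ?_⟩
  have := pb.lift_gen _ hroot
  rw [hgen] at this
  exact this

theorem adm_bounds {e d D : ℤ} (hd : Odd d) (hed : e < d) (hde : d < 2 * e) (h : Adm e d D) :
    Odd D ∧ 0 < D ∧ D < 4 * e := by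
  obtain ⟨j, rfl⟩ := hd
  rcases h with ⟨m, ⟨n, rfl⟩, h1, h2, rfl⟩ | rfl | rfl
  · exact ⟨⟨2 * n + 1 + e - j - 1, by ring⟩, by omega, by omega⟩
  · exact ⟨⟨3 * j + 1 - e, by ring⟩, by omega, by omega⟩
  · exact ⟨⟨e - j - 1, by ring⟩, by omega, by omega⟩

theorem exists_quartic {K : Type} [Field K] {vK : K → WithTop ℤ} (hv : DiscreteVal K vK)
    (hs : SqApprox vK) {e d D : ℤ} (he : VEq vK e 2) {i ω k k' w : K} (hi : i ^ 2 = -1)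
    (hω : VEq vK d ω) (hd : Odd d) (hed : e < d) (hde : d < 2 * e) (hd0 : 0 < d)
    (hk' : k' ≠ 0) (hk : k ≠ 0) (hw : w ≠ 0) (hkw : k ^ 2 * w = k' ^ 2 * (1 + ω))
    (hkind : Kind vK e d i ω k' D) : Nonempty (CyclicQuarticExt K vK w k) := by
  obtain ⟨hDodd, hD0, hDe⟩ := adm_bounds hd hed hde hkind.adm
  obtain ⟨M, _, _, vM, B, hvM, hB, hMram, hMrank, hMgen⟩ := quad_ext hv he hω hd hde
  have hL : Lifts vK vM ((1 : ℕ) : ℤ) :=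
    lifts_of_smul hvM 1 (Or.inl rfl) (fun a => by rw [hMram a])
  obtain ⟨η, ⟨s, -, hs0, hsη⟩, hη⟩ :=
    kind_core hv hs hL he hi hω hd hed hde hd0 hkind ⊤ (B := B) trivial hB
  have hη' : VEq vM D η := hη.cast (by simp)
  have heM : VEq vM (2 * e) (2 : M) := (hL.eq _ _ he).congr (map_ofNat _ 2) (by simp)
  obtain ⟨E, _, _, vE, Y, hvE, hY, hEram, hErank, hEgen⟩ :=
    quad_ext hvM heM hη' hDodd (by omega)
  letI : Algebra K E := ((algebraMap M E).comp (algebraMap K M)).toAlgebra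
  haveI : IsScalarTower K M E := IsScalarTower.of_algebraMap_eq (fun a => rfl)
  have hKE : ∀ a, algebraMap K E a = algebraMap M E (algebraMap K M a) := fun a => rfl
  have hs1 : algebraMap M E s ≠ 0 := by simpa using hs0
  have hk1 : algebraMap K M k' ≠ 0 := by simpa using hk'
  have hk2 : algebraMap K E k' ≠ 0 := by simpa using hk'
  let y : E := Y / algebraMap M E s
  have hYy : Y = y * algebraMap M E s := (div_mul_cancel₀ Y hs1).symm
  have hy2 : y ^ 2 = algebraMap K E k' * algebraMap M E B := by
    have h1 : y ^ 2 * (algebraMap M E s) ^ 2 =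
        (algebraMap K E k' * algebraMap M E B) * (algebraMap M E s) ^ 2 := by
      rw [← mul_pow, ← hYy, hY, ← hsη, hKE]; simp
    exact mul_right_cancel₀ (pow_ne_zero 2 hs1) h1
  have hy4 : y ^ 4 = algebraMap K E (k ^ 2 * w) := by
    calc y ^ 4 = (y ^ 2) ^ 2 := by ring
      _ = algebraMap K E (k ^ 2 * w) := by
        rw [hy2, hkw, mul_pow, ← map_pow _ B, hB, map_mul, map_pow, hKE (1 + ω)]
  have hrank : Module.finrank K E = 4 := by
    rw [← Module.finrank_mul_finrank K M E, hMrank, hErank]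
  have hymem : y ∈ Algebra.adjoin K ({y} : Set E) := Algebra.self_mem_adjoin_singleton K y
  have hBmem : algebraMap M E B ∈ Algebra.adjoin K ({y} : Set E) := by
    have h1 : algebraMap M E B = algebraMap K E k'⁻¹ * y ^ 2 := by
      rw [hy2, map_inv₀, inv_mul_cancel_left₀ hk2]
    rw [h1]
    exact mul_mem (Subalgebra.algebraMap_mem _ _) (pow_mem hymem 2)
  have hMmem : ∀ m : M, algebraMap M E m ∈ Algebra.adjoin K ({y} : Set E) := by
    intro m
    obtain ⟨a, b, rfl⟩ := hMgen m
    rw [map_add, map_mul, ← hKE, ← hKE]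
    exact add_mem (Subalgebra.algebraMap_mem _ _) (mul_mem (Subalgebra.algebraMap_mem _ _) hBmem)
  have hadj : Algebra.adjoin K ({y} : Set E) = ⊤ := by
    rw [eq_top_iff]
    intro z _
    obtain ⟨a, b, rfl⟩ := hEgen z
    refine add_mem (hMmem a) (mul_mem (hMmem b) ?_)
    rw [hYy]
    exact mul_mem hymem (hMmem s)
  obtain ⟨g, hg⟩ := exists_auto hi hrank hy4 hadj
  have hiE : (algebraMap K E i) ^ 2 = -1 := by rw [← map_pow, hi, map_neg, map_one]
  have hg2 : g (g y) = -y := by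
    rw [hg, map_mul, AlgEquiv.commutes, hg, ← mul_assoc, ← sq, hiE, neg_one_mul]
  have hy0 : y ≠ 0 := by
    intro h
    have h1 : algebraMap K E (k ^ 2 * w) = 0 := by rw [← hy4, h]; simp
    have h2 : k ^ 2 * w = 0 := by simpa using h1
    exact mul_ne_zero (pow_ne_zero 2 hk) hw h2
  have h2E : (2 : E) ≠ 0 := by
    have : algebraMap K E 2 ≠ 0 := by
      rw [Ne, map_eq_zero]; exact he.ne_zero hv
    rwa [map_ofNat] at this
  have hord : orderOf g = 4 := by
    have : Fact (Nat.Prime 2) := ⟨Nat.prime_two⟩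
    refine orderOf_eq_prime_pow (p := 2) (n := 1) ?_ ?_
    · intro h
      have h1 : (g ^ 2) y = y := by
        rw [show (g ^ 2) = 1 from h]; rfl
      have h2 : -y = y := by rw [← hg2]; exact h1
      have h3 : 2 * y = 0 := by linear_combination -h2
      rcases mul_eq_zero.mp h3 with h | h
      · exact h2E h
      · exact hy0 h
    · have h1 : (g ^ 4 : E ≃ₐ[K] E).toAlgHom = AlgHom.id K E := by
        refine AlgHom.ext_of_adjoin_eq_top hadj ?_
        intro z hz
        rw [Set.mem_singleton_iff] at hz
        subst hz
        change g (g (g (g y))) = y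
        rw [hg2, map_neg, map_neg, hg2, neg_neg]
      ext z
      exact DFunLike.congr_fun h1 z
  obtain ⟨π, hπ⟩ := hvE.2.2.2.2
  exact ⟨{ E := E, hdeg := hrank, y := y, hy := hy4, hadj := hadj, g := g, hord := hord,
           vE := vE, hvE := hvE,
           hram := fun a => by rw [hKE, hEram, hMram, ← mul_smul]; norm_num,
           πE := π, hπE := hπ }⟩

end existence

end Wy

open Wy
/-- Wyman's classification (specialized to `p = 2`): let `K` be a 2-adic field
containing `i = √-1` and `t` odd with `0 < t < e_K`; let `K(√w)/K` be ramified
quadratic with break `t` (equivalently `def_K(w) = 2e_K - t`).  Among cyclic degree-4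
extensions `K(√k·⁴√w)/K` containing `K(√w)`, the second ramification break `b₂` takes
exactly the values `3t`, `4e_K - t`, and `t + 4m` with `3t < t + 4m < 4e_K - t`. -/
theorem wyman_second_break_classification
    (K : Type) [Field K] [Algebra ℚ_[2] K] [FiniteDimensional ℚ_[2] K]
    (vK : K → WithTop ℤ) (hvK : DiscreteVal K vK)
    (eK : ℤ) (he : vK 2 = (eK : WithTop ℤ))
    (hi : ∃ i : K, i ^ 2 = -1)
    (t : ℤ) (htodd : Odd t) (ht0 : 0 < t) (hte : t < eK)
    (w : K) (hw : w ≠ 0) (hwns : ∀ z : K, z ^ 2 ≠ w)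
    (hwbreak : HasQuadDefect vK w ((2 * eK - t : ℤ) : WithTop ℤ)) :
    (∀ (k : K), k ≠ 0 → ∀ Q : CyclicQuarticExt K vK w k, ∀ b₂ : ℤ,
        Q.SecondBreakIs b₂ →
        (b₂ = 3 * t ∨ b₂ = 4 * eK - t ∨
          ∃ m : ℤ, b₂ = t + 4 * m ∧ 3 * t < b₂ ∧ b₂ < 4 * eK - t)) ∧
    (∀ b₂ : ℤ,
        (b₂ = 3 * t ∨ b₂ = 4 * eK - t ∨
          ∃ m : ℤ, b₂ = t + 4 * m ∧ 3 * t < b₂ ∧ b₂ < 4 * eK - t) →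
        ∃ (k : K), k ≠ 0 ∧ ∃ Q : CyclicQuarticExt K vK w k, Q.SecondBreakIs b₂) := by
  obtain ⟨i, hi⟩ := hi
  have he' : VEq vK eK (2 : K) := he
  have hs : SqApprox vK := sqApprox_of_finite hvK he' (by omega)
  obtain ⟨⟨u, hu⟩, -⟩ := hwbreak
  have hω : VEq vK (2 * eK - t) (u ^ 2 * w - 1) := hu
  have hu0 : u ≠ 0 := by
    intro h
    have h1 : VEq vK (2 * eK - t) (-1 : K) := hω.congr (by rw [h]; ring) rfl
    have := h1.inj (veq_neg_one hvK)
    omega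
  generalize hωdef : u ^ 2 * w - 1 = ω at hω
  have hω1 : u ^ 2 * w = 1 + ω := by rw [← hωdef]; ring
  have hd : Odd (2 * eK - t) := by
    obtain ⟨j, rfl⟩ := htodd
    exact ⟨eK - j - 1, by ring⟩
  have hed : eK < 2 * eK - t := by omega
  have hde : 2 * eK - t < 2 * eK := by omega
  have hd0 : 0 < 2 * eK - t := by omega
  have main : ∀ (k k' : K), k ≠ 0 → k' ≠ 0 → k = k' * u → ∀ Q : CyclicQuarticExt K vK w k,
      ∀ D : ℤ, Kind vK eK (2 * eK - t) i ω k' D → Q.SecondBreakIs (4 * eK - D) := by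
    intro k k' hk hk' hkk Q D hkind
    have hkw : k ^ 2 * w = k' ^ 2 * (1 + ω) := by rw [← hω1, hkk]; ring
    obtain ⟨hDodd, hD0, hDe⟩ := adm_bounds hd hed hde hkind.adm
    obtain ⟨η, hr, hη⟩ := kind_core hvK hs (lifts_Q Q) he' hi hω hd hed hde hd0 hkind (TT Q)
      (BB_mem Q hk hw hi k') (BB_sq Q hk' hkw)
    exact break_lemma hvK Q hk hw hi hk' hkw he' hω hd hde hr hη hDodd hD0 hDe
  refine ⟨?_, ?_⟩
  · intro k hk Q b₂ hb
    have hk' : k / u ≠ 0 := div_ne_zero hk hu0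
    obtain ⟨D, hkind⟩ := kind_exists hvK hs he' hi hω hd hed hde hd0 hk'
    have h1 := main k (k / u) hk hk' (div_mul_cancel₀ k hu0).symm Q D hkind
    have h2 : b₂ + 1 = 4 * eK - D + 1 := WithTop.coe_injective (hb.symm.trans h1)
    rcases hkind.adm with ⟨m, ⟨n, rfl⟩, hm1, hm2, hD⟩ | hD | hD
    · right; right
      obtain ⟨j, rfl⟩ := htodd
      exact ⟨eK - j - 1 - n, by omega, by omega, by omega⟩
    · left; omega
    · right; left; omega
  · intro b₂ hb
    have hadm : Adm eK (2 * eK - t) (4 * eK - b₂) := by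
      rcases hb with h | h | ⟨m, h1, h2, h3⟩
      · right; left; omega
      · right; right; omega
      · left
        obtain ⟨j, rfl⟩ := htodd
        exact ⟨2 * eK - (2 * j + 1) - 2 * m, ⟨eK - j - 1 - m, by ring⟩, by omega, by omega,
          by omega⟩
    obtain ⟨k', hk', hkind⟩ := adm_kind hvK he' hi hω hed hd0 hadm
    have hk : k' * u ≠ 0 := mul_ne_zero hk' hu0
    obtain ⟨Q⟩ := exists_quartic hvK hs he' (k := k' * u) (w := w) hi hω hd hed hde hd0 hk' hk hw
      (by rw [← hω1]; ring) hkind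
    refine ⟨k' * u, hk, Q, ?_⟩
    have h1 := main (k' * u) k' hk hk' rfl Q _ hkind
    have h2 : 4 * eK - (4 * eK - b₂) = b₂ := by ring
    rwa [h2] at h1
end
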